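/- arXiv:1609.07199 — 2 statements merged into one kernel-verified Lean document; each statement's English description precedes it below -/
import Mathlib

section
/- Let θ be a CPWL function and consider the composite optimization setting with the qualification condition N(z̄; dom θ) ∩ ker ∇Φ(x̄)* = {0}, where N(z̄; dom θ) := {v : ⟨v, z − z̄⟩ ≤ 0 for all z ∈ dom θ}. If x̄ is a local minimizer of φ₀ + θ∘Φ, then Λ_com(x̄) ≠ ∅ and the following second-order necessary condition holds: for every u ≠ 0 such that ∇Φ(x̄)u ∈ 𝒦(z̄,v) for some v ∈ Λ_com(x̄), one has sup_{v ∈ Λ_com(x̄)} ⟨∇²ₓₓL(x̄,v)u, u⟩ ≥ 0. -/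
open Filter Topology Set RealInnerProductSpace

noncomputable section

abbrev Ev (k : ℕ) := EuclideanSpace ℝ (Fin k)

/-- The Bouligand–Severi tangent cone to a set `s` at `x`. -/
def tcone {E : Type*} [NormedAddCommGroup E] [NormedSpace ℝ E] (s : Set E) (x : E) : Set E :=
  {w | ∃ (z : ℕ → E) (c : ℕ → ℝ), (∀ k, z k ∈ s) ∧ (∀ k, 0 ≤ c k) ∧
      Tendsto z atTop (𝓝 x) ∧ Tendsto (fun k => c k • (z k - x)) atTop (𝓝 w)}

/-- The data of a convex piecewise linear (CPWL) extended-real-valued function on `ℝ^m`: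
`θ(z) = max_i (⟨a i, z⟩ - al i)` on the polyhedron `dom θ = {z | ⟨d i, z⟩ ≤ be i ∀ i}`,
and `θ(z) = +∞` outside of it. -/
structure CPWL (m : ℕ) where
  l : ℕ
  p : ℕ
  hl : 0 < l
  a : Fin l → Ev m
  al : Fin l → ℝ
  d : Fin p → Ev m
  be : Fin p → ℝ
  dom_nonempty : ∃ z : Ev m, ∀ i, ⟪d i, z⟫ ≤ be i

namespace CPWL

variable {m : ℕ} (θ : CPWL m)

/-- The (polyhedral) domain of the CPWL function. -/
def dom : Set (Ev m) := {z | ∀ i, ⟪θ.d i, z⟫ ≤ θ.be i}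

/-- The real value `max_i (⟨a i, z⟩ - al i)` of the CPWL function (meaningful on its domain). -/
def val (z : Ev m) : ℝ := ⨆ i : Fin θ.l, (⟪θ.a i, z⟫ - θ.al i)

/-- The CPWL function as an extended-real-valued function. -/
def eval (z : Ev m) : EReal :=
  @ite _ (z ∈ θ.dom) (Classical.propDecidable _) ((θ.val z : ℝ) : EReal) ⊤

/-- The subdifferential (of convex analysis) of the CPWL function. -/
def subdiff (z : Ev m) : Set (Ev m) :=
  {v | z ∈ θ.dom ∧ ∀ z' ∈ θ.dom, ⟪v, z' - z⟫ ≤ θ.val z' - θ.val z}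

/-- Active indices `K(z)` of the max-representation. -/
def Kact (z : Ev m) : Set (Fin θ.l) := {i | θ.val z = ⟪θ.a i, z⟫ - θ.al i}

/-- Active indices `I(z)` of the domain constraints. -/
def Iact (z : Ev m) : Set (Fin θ.p) := {i | ⟪θ.d i, z⟫ = θ.be i}

/-- The critical cone `𝒦(z̄,v̄) = {w ∈ T(z̄; dom θ) : ⟨v̄,w⟩ = θ′(z̄;w)}`. -/
def crit (zb vb : Ev m) : Set (Ev m) :=
  {w | w ∈ tcone θ.dom zb ∧
    Tendsto (fun t : ℝ => (θ.val (zb + t • w) - θ.val zb) / t) (𝓝[>] (0 : ℝ))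
      (𝓝 ⟪vb, w⟫)}

/-- The graph of the subdifferential mapping. -/
def gph : Set (Ev m × Ev m) := {zv | zv.2 ∈ θ.subdiff zv.1}

/-- The graphical derivative `(D∂θ)(z̄,v̄)(u)`. -/
def Dsub (zb vb u : Ev m) : Set (Ev m) := {w | (u, w) ∈ tcone θ.gph (zb, vb)}

/-- The regular coderivative `(D̂*∂θ)(z̄,v̄)(u)`. -/
def Dhat (zb vb u : Ev m) : Set (Ev m) :=
  {w | ∀ h ∈ tcone θ.gph (zb, vb), ⟪w, h.1⟫ - ⟪u, h.2⟫ ≤ 0}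

end CPWL

section VarSys

variable {n m : ℕ}

/-- The adjoint `∇Φ(x)*` of the Jacobian of `Φ` at `x`. -/
def adjD (Φ : Ev n → Ev m) (x : Ev n) : Ev m →L[ℝ] Ev n :=
  ContinuousLinearMap.adjoint (fderiv ℝ Φ x)

/-- `Ψ(x,v) = f(x) + ∇Φ(x)* v`. -/
def Psi (f : Ev n → Ev n) (Φ : Ev n → Ev m) (x : Ev n) (v : Ev m) : Ev n :=
  f x + adjD Φ x v

/-- The partial Jacobian `∇ₓΨ(x̄,v̄)`. -/
def gradxPsi (f : Ev n → Ev n) (Φ : Ev n → Ev m) (xb : Ev n) (vb : Ev m) :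
    Ev n →L[ℝ] Ev n :=
  fderiv ℝ (fun x => Psi f Φ x vb) xb

/-- The Lagrange multiplier set `Λ(x̄)` of the variational system. -/
def Lam (f : Ev n → Ev n) (Φ : Ev n → Ev m) (θ : CPWL m) (xb : Ev n) : Set (Ev m) :=
  {v | Psi f Φ xb v = 0 ∧ v ∈ θ.subdiff (Φ xb)}

/-- `v̄` is a critical multiplier for the variational system. -/
def IsCritical (f : Ev n → Ev n) (Φ : Ev n → Ev m) (θ : CPWL m) (xb : Ev n) (vb : Ev m) :
    Prop :=
  ∃ ξ : Ev n, ξ ≠ 0 ∧ ∃ w ∈ θ.Dsub (Φ xb) vb (fderiv ℝ Φ xb ξ),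
    gradxPsi f Φ xb vb ξ + adjD Φ xb w = 0

/-- The solution map of the canonically perturbed variational system. -/
def Smap (f : Ev n → Ev n) (Φ : Ev n → Ev m) (θ : CPWL m) (p₁ : Ev n) (p₂ : Ev m) :
    Set (Ev n × Ev m) :=
  {xv | Psi f Φ xv.1 xv.2 = p₁ ∧ xv.2 ∈ θ.subdiff (Φ xv.1 + p₂)}

end VarSys

section General

variable {n m : ℕ}

/-- The subdifferential of a general extended-real-valued function. -/
def subdiffE (θ : Ev m → EReal) (z : Ev m) : Set (Ev m) :=
  {v | ∀ z', ((⟪v, z' - z⟫ : ℝ) : EReal) ≤ θ z' - θ z}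

/-- The graph of the subdifferential of a general extended-real-valued function. -/
def gphE (θ : Ev m → EReal) : Set (Ev m × Ev m) := {zv | zv.2 ∈ subdiffE θ zv.1}

/-- The graphical derivative of the subdifferential, general case. -/
def DsubE (θ : Ev m → EReal) (zb vb u : Ev m) : Set (Ev m) :=
  {w | (u, w) ∈ tcone (gphE θ) (zb, vb)}

/-- The Lagrange multiplier set, general case. -/
def LamE (f : Ev n → Ev n) (Φ : Ev n → Ev m) (θ : Ev m → EReal) (xb : Ev n) :
    Set (Ev m) :=
  {v | Psi f Φ xb v = 0 ∧ v ∈ subdiffE θ (Φ xb)}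

/-- The solution map of the canonically perturbed variational system, general case. -/
def SmapE (f : Ev n → Ev n) (Φ : Ev n → Ev m) (θ : Ev m → EReal) (p₁ : Ev n)
    (p₂ : Ev m) : Set (Ev n × Ev m) :=
  {xv | Psi f Φ xv.1 xv.2 = p₁ ∧ xv.2 ∈ subdiffE θ (Φ xv.1 + p₂)}

end General

section Composite

variable {n m : ℕ}

/-- The gradient `∇ₓL(·,v)` of the Lagrangian `L(x,v) = φ₀(x) + ⟨Φ(x),v⟩`. -/
def gradL (φ₀ : Ev n → ℝ) (Φ : Ev n → Ev m) (v : Ev m) (x : Ev n) : Ev n :=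
  gradient (fun y => φ₀ y + ⟪Φ y, v⟫) x

/-- The Hessian `∇²ₓₓL(x̄,v)` as a linear operator. -/
def HessOp (φ₀ : Ev n → ℝ) (Φ : Ev n → Ev m) (v : Ev m) (xb : Ev n) : Ev n →L[ℝ] Ev n :=
  fderiv ℝ (gradL φ₀ Φ v) xb

/-- The Lagrange multiplier set `Λ_com(x̄)` of the composite optimization problem. -/
def LamCom (φ₀ : Ev n → ℝ) (Φ : Ev n → Ev m) (θ : CPWL m) (xb : Ev n) : Set (Ev m) :=
  {v | gradient φ₀ xb + adjD Φ xb v = 0 ∧ v ∈ θ.subdiff (Φ xb)}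

/-- Criticality of a multiplier in the composite optimization setting. -/
def IsCriticalCom (φ₀ : Ev n → ℝ) (Φ : Ev n → Ev m) (θ : CPWL m) (xb : Ev n) (v : Ev m) :
    Prop :=
  ∃ ξ : Ev n, ξ ≠ 0 ∧ ∃ w ∈ θ.Dsub (Φ xb) v (fderiv ℝ Φ xb ξ),
    HessOp φ₀ Φ v xb ξ + adjD Φ xb w = 0

/-- The solution map of the canonically perturbed KKT system of composite optimization. -/
def SKKT (φ₀ : Ev n → ℝ) (Φ : Ev n → Ev m) (θ : CPWL m) (p₁ : Ev n) (p₂ : Ev m) :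
    Set (Ev n × Ev m) :=
  {xv | gradient φ₀ xv.1 + adjD Φ xv.1 xv.2 = p₁ ∧ xv.2 ∈ θ.subdiff (Φ xv.1 + p₂)}

/-- `x̄` is a local minimizer of `φ₀ + θ∘Φ`. -/
def LocalMin (φ₀ : Ev n → ℝ) (Φ : Ev n → Ev m) (θ : CPWL m) (xb : Ev n) : Prop :=
  ∃ U ∈ 𝓝 xb, ∀ x ∈ U,
    ((φ₀ xb : ℝ) : EReal) + θ.eval (Φ xb) ≤ ((φ₀ x : ℝ) : EReal) + θ.eval (Φ x)

end Composite

section Calmness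

variable {n m : ℕ}

/-- Isolated calmness of a solution map at `((0,0), q0)`. -/
def IsolCalm (S : Ev n × Ev m → Set (Ev n × Ev m)) (q0 : Ev n × Ev m) : Prop :=
  ∃ c : ℝ, 0 ≤ c ∧ ∃ U ∈ 𝓝 (0 : Ev n × Ev m), ∃ V ∈ 𝓝 q0,
    ∀ p ∈ U, ∀ q ∈ S p ∩ V, ‖q - q0‖ ≤ c * (‖p.1‖ + ‖p.2‖)

/-- Robust isolated calmness of a solution map at `((0,0), q0)`. -/
def RobustIsolCalm (S : Ev n × Ev m → Set (Ev n × Ev m)) (q0 : Ev n × Ev m) : Prop :=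
  ∃ c : ℝ, 0 ≤ c ∧ ∃ U ∈ 𝓝 (0 : Ev n × Ev m), ∃ V ∈ 𝓝 q0,
    (∀ p ∈ U, ∀ q ∈ S p ∩ V, ‖q - q0‖ ≤ c * (‖p.1‖ + ‖p.2‖)) ∧
    (∀ p ∈ U, (S p ∩ V).Nonempty)

/-- The Lipschitz-like (Aubin) property of a solution map around `((0,0), q0)`. -/
def LipschitzLike (S : Ev n × Ev m → Set (Ev n × Ev m)) (q0 : Ev n × Ev m) : Prop :=
  ∃ c : ℝ, 0 ≤ c ∧ ∃ U ∈ 𝓝 (0 : Ev n × Ev m), ∃ V ∈ 𝓝 q0,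
    ∀ p ∈ U, ∀ p' ∈ U, ∀ q ∈ S p ∩ V, ∃ q' ∈ S p', ‖q - q'‖ ≤ c * ‖p - p'‖

end Calmness



theorem sep_fd {E : Type*} [NormedAddCommGroup E] [NormedSpace ℝ E] [FiniteDimensional ℝ E]
    {C : Set E} (hC : Convex ℝ C) (hne : C.Nonempty) {x : E} (hx : x ∉ C) :
    ∃ f : StrongDual ℝ E, f ≠ 0 ∧ ∀ a ∈ C, f a ≤ f x := by
  by_cases hi : (interior C).Nonempty
  · exact geometric_hahn_banach_of_nonempty_interior_point hC (fun h => hx (interior_subset h)) hi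
  · rw [hC.interior_nonempty_iff_affineSpan_eq_top] at hi
    have hd : (affineSpan ℝ C).direction ≠ ⊤ := by
      intro h
      apply hi
      exact (AffineSubspace.direction_eq_top_iff_of_nonempty
        ((affineSpan_nonempty ℝ).2 hne)).1 h
    obtain ⟨g, hg0, hg⟩ := Submodule.exists_le_ker_of_lt_top _ hd.lt_top
    obtain ⟨c0, hc0⟩ := hne
    have key : ∀ a ∈ C, g a = g c0 := by
      intro a ha
      have h1 : a - c0 ∈ (affineSpan ℝ C).direction := by
        have := AffineSubspace.vsub_mem_direction (subset_affineSpan ℝ C ha)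
          (subset_affineSpan ℝ C hc0)
        simpa using this
      have := hg h1
      rw [LinearMap.mem_ker, map_sub] at this
      linarith
    have hg0' : LinearMap.toContinuousLinearMap g ≠ 0 := by
      intro h
      apply hg0
      ext a
      simpa using congrArg (fun f : StrongDual ℝ E => f a) h
    rcases le_total (g c0) (g x) with h | h
    · exact ⟨LinearMap.toContinuousLinearMap g, hg0', fun a ha => by
        simpa [key a ha] using h⟩
    · exact ⟨-LinearMap.toContinuousLinearMap g, neg_ne_zero.2 hg0', fun a ha => by
        simpa [key a ha] using h⟩

/-- A linear functional bounded above vanishes. -/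
theorem inner_bdd_zero {E : Type*} [NormedAddCommGroup E] [InnerProductSpace ℝ E] {v : E} {M : ℝ}
    (h : ∀ s : E, ⟪v, s⟫ ≤ M) : v = 0 := by
  by_contra hv
  have hp : 0 < ⟪v, v⟫ := real_inner_self_pos.2 hv
  have := h (((|M| + 1) / ⟪v, v⟫) • v)
  rw [inner_smul_right, div_mul_cancel₀ _ hp.ne'] at this
  linarith [le_abs_self M]

theorem scale_bdd {a M : ℝ} (h : ∀ T : ℝ, 0 ≤ T → T * a ≤ M) : a ≤ 0 := by
  by_contra hv
  push Not at hv
  have := h ((|M| + 1) / a) (by positivity)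
  rw [div_mul_cancel₀ _ hv.ne'] at this
  linarith [le_abs_self M]

theorem robinson {n m : ℕ} (A : Ev n →L[ℝ] Ev m) {p : ℕ} (d : Fin p → Ev m) (I : Set (Fin p))
    (hqc : ∀ v : Ev m, (∀ k, (∀ j ∈ I, ⟪d j, k⟫ ≤ 0) → ⟪v, k⟫ ≤ 0) →
      ContinuousLinearMap.adjoint A v = 0 → v = 0) (y : Ev m) :
    ∃ s k, (∀ j ∈ I, ⟪d j, k⟫ ≤ 0) ∧ y = k - A s := by
  by_contra hcon
  let C : Set (Ev m) := {y | ∃ s k, (∀ j ∈ I, ⟪d j, k⟫ ≤ 0) ∧ y = k - A s}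
  have hC : Convex ℝ C := by
    rintro _ ⟨s, k, hk, rfl⟩ _ ⟨s', k', hk', rfl⟩ a b ha hb hab
    refine ⟨a • s + b • s', a • k + b • k', ?_, ?_⟩
    · intro j hj
      rw [inner_add_right, inner_smul_right, inner_smul_right]
      nlinarith [hk j hj, hk' j hj]
    · simp only [map_add, map_smul, smul_sub]; abel
  obtain ⟨f, hf0, hf⟩ := sep_fd hC ⟨0, 0, 0, by simp, by simp⟩ (x := y) hcon
  set v := (InnerProductSpace.toDual ℝ (Ev m)).symm f with hv
  have hfv : ∀ z, f z = ⟪v, z⟫ := fun z => by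
    rw [hv, InnerProductSpace.toDual_symm_apply]
  have hv0 : v = 0 := by
    apply hqc
    · intro k hk
      apply scale_bdd (M := f y)
      intro T hT
      have := hf (T • k) ⟨0, T • k, fun j hj => by
        rw [inner_smul_right]; nlinarith [hk j hj], by simp⟩
      simpa [hfv, inner_smul_right] using this
    · have : -(ContinuousLinearMap.adjoint A v) = 0 := by
        apply inner_bdd_zero (M := f y)
        intro s
        have := hf (0 - A s) ⟨s, 0, by simp, rfl⟩
        rw [hfv] at this
        rw [inner_neg_left, ContinuousLinearMap.adjoint_inner_left]
        simpa using this
      simpa using this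
  apply hf0
  ext z
  rw [hfv, hv0]; simp

theorem lp_dual {n m : ℕ} (A : Ev n →L[ℝ] Ev m) {l p : ℕ} (d : Fin p → Ev m) (I : Set (Fin p))
    (a : Fin l → Ev m) (K : Set (Fin l)) (hK : K.Nonempty) (g : Ev n) (q : Ev m) (r : ℝ)
    (hrob : ∀ y : Ev m, ∃ s k, (∀ j ∈ I, ⟪d j, k⟫ ≤ 0) ∧ y = k - A s)
    (hprim : ¬ ∃ s, (∀ j ∈ I, ⟪d j, A s + q⟫ ≤ 0) ∧ ∀ i ∈ K, ⟪g, s⟫ + r + ⟪a i, A s + q⟫ < 0) :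
    ∃ v : Ev m, g + ContinuousLinearMap.adjoint A v = 0 ∧
      (∀ z, (∀ j ∈ I, ⟪d j, z⟫ ≤ 0) → ∃ i ∈ K, ⟪v, z⟫ ≤ ⟪a i, z⟫) ∧ 0 ≤ r + ⟪v, q⟫ := by
  let C : Set (Ev m × ℝ) := {y | ∃ s z, (∀ j ∈ I, ⟪d j, z⟫ ≤ 0) ∧ y.1 = z - A s - q ∧
    ∀ i ∈ K, ⟪g, s⟫ + r + ⟪a i, z⟫ < y.2}
  have hC : Convex ℝ C := by
    rintro ⟨_, τ⟩ ⟨s, z, hz, rfl, h⟩ ⟨_, τ'⟩ ⟨s', z', hz', rfl, h'⟩ c b hc hb hab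
    refine ⟨c • s + b • s', c • z + b • z', ?_, ?_, ?_⟩
    · intro j hj
      rw [inner_add_right, inner_smul_right, inner_smul_right]
      nlinarith [hz j hj, hz' j hj]
    · have : q = c • q + b • q := by rw [← add_smul, hab, one_smul]
      simp only [map_add, map_smul, Prod.fst_add, Prod.smul_fst, smul_sub]
      nth_rw 3 [this]
      abel
    · intro i hi
      have h1 := h i hi
      have h2 := h' i hi
      simp only [inner_add_right, inner_smul_right, Prod.snd_add, Prod.smul_snd, smul_eq_mul] at *
      have hr : r = c * r + b * r := by rw [← add_mul, hab, one_mul]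
      rcases hc.eq_or_lt with rfl | hc'
      · have : b = 1 := by linarith
        subst this
        linarith
      · nlinarith [mul_lt_mul_of_pos_left h1 hc', mul_le_mul_of_nonneg_left h2.le hb]
  have h0 : ((0 : Ev m), (0 : ℝ)) ∉ C := by
    rintro ⟨s, z, hz, h1, h2⟩
    have : z = A s + q := by
      have h1 : (0 : Ev m) = z - A s - q := h1
      rw [eq_comm, sub_sub, sub_eq_zero] at h1; exact h1
    subst this
    exact hprim ⟨s, hz, h2⟩
  have hbig : ∀ s z, ∃ M, ∀ i ∈ K, ⟪g, s⟫ + r + ⟪a i, z⟫ < M := by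
    intro s z
    obtain ⟨i0, hi0, hm⟩ : ∃ i ∈ K, ∀ k ∈ K, ⟪a k, z⟫ ≤ ⟪a i, z⟫ :=
      Set.exists_max_image K (fun i => ⟪a i, z⟫) K.toFinite hK
    exact ⟨⟪g, s⟫ + r + ⟪a i0, z⟫ + 1, fun i hi => by linarith [hm i hi]⟩
  have hCne : C.Nonempty := by
    obtain ⟨M, hM⟩ := hbig 0 0
    exact ⟨(0 - A 0 - q, M), 0, 0, by simp, rfl, hM⟩
  obtain ⟨f, hf0, hf⟩ := sep_fd hC hCne h0
  rw [show ((0 : Ev m), (0 : ℝ)) = 0 from rfl, map_zero] at hf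
  set v' := (InnerProductSpace.toDual ℝ (Ev m)).symm (f.comp (ContinuousLinearMap.inl ℝ _ _))
    with hv'
  set c := f (0, 1) with hc
  have hfv : ∀ y τ, f (y, τ) = ⟪v', y⟫ + c * τ := by
    intro y τ
    rw [hv', InnerProductSpace.toDual_symm_apply]
    have : (y, τ) = (y, (0 : ℝ)) + τ • ((0 : Ev m), (1 : ℝ)) := by simp
    rw [this, map_add, map_smul, ← hc]
    simp [mul_comm]
  have hdir : ∀ s z τ, (∀ j ∈ I, ⟪d j, z⟫ ≤ 0) → (∀ i ∈ K, ⟪g, s⟫ + r + ⟪a i, z⟫ < τ) →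
      ⟪v', z - A s - q⟫ + c * τ ≤ 0 := by
    intro s z τ hz hτ
    rw [← hfv]
    exact hf _ ⟨s, z, hz, rfl, hτ⟩
  have hc0 : c ≤ 0 := by
    obtain ⟨M, hM⟩ := hbig 0 0
    apply scale_bdd (M := -(⟪v', 0 - A 0 - q⟫ + c * M))
    intro T hT
    have := hdir 0 0 (M + T) (by simp) (fun i hi => by linarith [hM i hi])
    linarith
  have hcn : c < 0 := by
    refine lt_of_le_of_ne hc0 fun hc00 => hf0 ?_
    have hv0 : v' = 0 := by
      apply inner_bdd_zero (M := 0)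
      intro y
      obtain ⟨s, k, hk, hy⟩ := hrob (y + q)
      obtain ⟨M, hM⟩ := hbig s k
      have := hdir s k M hk hM
      rw [← hy, hc00] at this
      simpa using this
    ext y <;> simp [hfv, hv0, hc00]
  have hcne : -c ≠ 0 := by linarith
  set v := (-c)⁻¹ • v' with hv
  have hvv : ∀ y, ⟪v', y⟫ = -c * ⟪v, y⟫ := by
    intro y
    rw [hv, inner_smul_left]
    simp only [conj_trivial]
    rw [← mul_assoc, mul_inv_cancel₀ hcne, one_mul]
  have hmain : ∀ s z, (∀ j ∈ I, ⟪d j, z⟫ ≤ 0) → ∀ i ∈ K, (∀ k ∈ K, ⟪a k, z⟫ ≤ ⟪a i, z⟫) →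
      ⟪v, z⟫ - ⟪v, A s⟫ - ⟪v, q⟫ ≤ ⟪g, s⟫ + r + ⟪a i, z⟫ := by
    intro s z hz i hi hmax
    apply le_of_forall_pos_lt_add
    intro ε hε
    have := hdir s z (⟪g, s⟫ + r + ⟪a i, z⟫ + ε / 2) hz (fun k hk => by linarith [hmax k hk])
    rw [hvv, inner_sub_right, inner_sub_right] at this
    have h3 : -c * (⟪v, z⟫ - ⟪v, A s⟫ - ⟪v, q⟫) ≤ -c * (⟪g, s⟫ + r + ⟪a i, z⟫ + ε / 2) := by
      linarith
    have := le_of_mul_le_mul_left h3 (by linarith)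
    linarith
  obtain ⟨i1, hi1⟩ := hK
  have hz0 : ∀ s, -⟪v, A s⟫ - ⟪v, q⟫ ≤ ⟪g, s⟫ + r := by
    intro s
    have := hmain s 0 (by simp) i1 hi1 (by simp)
    simpa using this
  refine ⟨v, ?_, ?_, ?_⟩
  · have : -(g + ContinuousLinearMap.adjoint A v) = 0 := by
      apply inner_bdd_zero (M := r + ⟪v, q⟫)
      intro s
      rw [inner_neg_left, inner_add_left, ContinuousLinearMap.adjoint_inner_left]
      linarith [hz0 s]
    exact neg_eq_zero.1 this
  · intro z hz
    obtain ⟨i0, hi0, hm⟩ : ∃ i ∈ K, ∀ k ∈ K, ⟪a k, z⟫ ≤ ⟪a i, z⟫ :=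
      Set.exists_max_image K (fun i => ⟪a i, z⟫) K.toFinite ⟨i1, hi1⟩
    refine ⟨i0, hi0, ?_⟩
    have : ⟪v, z⟫ - ⟪a i0, z⟫ ≤ 0 := by
      apply scale_bdd (M := r + ⟪v, q⟫)
      intro T hT
      have := hmain 0 (T • z) (fun j hj => by rw [inner_smul_right]; nlinarith [hz j hj]) i0 hi0
        (fun k hk => by
          rw [inner_smul_right, inner_smul_right]
          exact mul_le_mul_of_nonneg_left (hm k hk) hT)
      simp [inner_smul_right] at this
      linarith
    linarith
  · have := hz0 0
    simp at this
    linarith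


theorem taylor2 {E F : Type*} [NormedAddCommGroup E] [NormedSpace ℝ E]
    [NormedAddCommGroup F] [NormedSpace ℝ F] {f : E → F} {x : E} {B : E →L[ℝ] E →L[ℝ] F}
    (hB : HasFDerivAt (fderiv ℝ f) B x) {ε : ℝ} (hε : 0 < ε) :
    ∀ᶠ h in 𝓝 (0 : E), (∀ τ ∈ Icc (0 : ℝ) 1, DifferentiableAt ℝ f (x + τ • h)) →
      ‖f (x + h) - f x - fderiv ℝ f x h - (1 / 2 : ℝ) • B h h‖ ≤ ε * ‖h‖ ^ 2 := by
  have h1 := (hasFDerivAt_iff_isLittleO_nhds_zero.1 hB).def hε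
  obtain ⟨δ, hδ, h2⟩ := Metric.eventually_nhds_iff.1 h1
  refine Metric.eventually_nhds_iff.2 ⟨δ, hδ, fun h hh hd => ?_⟩
  rw [dist_zero_right] at hh
  let G : ℝ → F := fun τ => f (x + τ • h) - τ • fderiv ℝ f x h - (τ ^ 2 / 2) • B h h
  have hG : ∀ τ ∈ Icc (0 : ℝ) 1, HasDerivWithinAt G
      (fderiv ℝ f (x + τ • h) h - fderiv ℝ f x h - τ • B h h) (Icc 0 1) τ := by
    intro τ hτ
    apply HasDerivAt.hasDerivWithinAt
    have e1 : HasDerivAt (fun τ : ℝ => x + τ • h) h τ := by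
      simpa using ((hasDerivAt_id τ).smul_const h).const_add x
    have e2 := (hd τ hτ).hasFDerivAt.comp_hasDerivAt τ e1
    have e3 : HasDerivAt (fun τ : ℝ => τ • fderiv ℝ f x h) (fderiv ℝ f x h) τ := by
      simpa using (hasDerivAt_id τ).smul_const (fderiv ℝ f x h)
    have e4 : HasDerivAt (fun τ : ℝ => (τ ^ 2 / 2) • B h h) (τ • B h h) τ := by
      have := ((hasDerivAt_pow 2 τ).div_const 2).smul_const (B h h)
      simpa using this
    exact (e2.sub e3).sub e4
  have hb : ∀ τ ∈ Icc (0 : ℝ) 1,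
      ‖fderiv ℝ f (x + τ • h) h - fderiv ℝ f x h - τ • B h h‖ ≤ ε * ‖h‖ ^ 2 := by
    intro τ hτ
    have hle : ‖τ • h‖ ≤ ‖h‖ := by
      rw [norm_smul, Real.norm_eq_abs, abs_of_nonneg hτ.1]
      exact mul_le_of_le_one_left (norm_nonneg _) hτ.2
    have h3 := h2 (y := τ • h) (by rw [dist_zero_right]; linarith)
    have h4 : fderiv ℝ f (x + τ • h) h - fderiv ℝ f x h - τ • B h h =
        (fderiv ℝ f (x + τ • h) - fderiv ℝ f x - B (τ • h)) h := by
      simp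
    rw [h4]
    refine (ContinuousLinearMap.le_opNorm _ _).trans ?_
    calc _ ≤ (ε * ‖h‖) * ‖h‖ := by
          gcongr
          exact h3.trans (by gcongr)
      _ = _ := by ring
  have := Convex.norm_image_sub_le_of_norm_hasDerivWithin_le hG hb (convex_Icc 0 1)
    (left_mem_Icc.2 zero_le_one) (right_mem_Icc.2 zero_le_one)
  have e : G 1 - G 0 = f (x + h) - f x - fderiv ℝ f x h - (1 / 2 : ℝ) • B h h := by
    simp [G]; abel
  rw [e] at this
  simpa using this

theorem path_taylor {E F : Type*} [NormedAddCommGroup E] [NormedSpace ℝ E]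
    [NormedAddCommGroup F] [NormedSpace ℝ F] {f : E → F} {x u : E} {B : E →L[ℝ] E →L[ℝ] F}
    (hB : HasFDerivAt (fderiv ℝ f) B x) {h : ℝ → E}
    (hlim : Tendsto (fun t : ℝ => t⁻¹ • h t) (𝓝[>] 0) (𝓝 u))
    (hseg : ∀ᶠ t in 𝓝[>] (0 : ℝ), ∀ τ ∈ Icc (0 : ℝ) 1, DifferentiableAt ℝ f (x + τ • h t)) :
    Tendsto (fun t : ℝ => (t ^ 2)⁻¹ • (f (x + h t) - f x - fderiv ℝ f x (h t)))
      (𝓝[>] 0) (𝓝 ((1 / 2 : ℝ) • B u u)) := by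
  have hpos : ∀ᶠ t in 𝓝[>] (0 : ℝ), 0 < t := eventually_mem_nhdsWithin
  have hid : Tendsto (fun t : ℝ => t) (𝓝[>] 0) (𝓝 0) := tendsto_id.mono_left nhdsWithin_le_nhds
  have hh0 : Tendsto h (𝓝[>] 0) (𝓝 0) := by
    have := hid.smul hlim
    rw [zero_smul] at this
    refine this.congr' ?_
    filter_upwards [hpos] with t ht
    rw [smul_smul, mul_inv_cancel₀ ht.ne', one_smul]
  have h1 : Tendsto (fun t : ℝ => (1 / 2 : ℝ) • B (t⁻¹ • h t) (t⁻¹ • h t)) (𝓝[>] 0)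
      (𝓝 ((1 / 2 : ℝ) • B u u)) := by
    have hc : Continuous fun y : E => (1 / 2 : ℝ) • B y y := by fun_prop
    exact (hc.tendsto u).comp hlim
  have h2 : Tendsto (fun t : ℝ => (t ^ 2)⁻¹ • (f (x + h t) - f x - fderiv ℝ f x (h t)
      - (1 / 2 : ℝ) • B (h t) (h t))) (𝓝[>] 0) (𝓝 0) := by
    rw [Metric.tendsto_nhds]
    intro ε hε
    have hη : 0 < ε / (2 * (‖u‖ ^ 2 + 1)) := by positivity
    have hn : ∀ᶠ t in 𝓝[>] (0 : ℝ), ‖t⁻¹ • h t‖ ^ 2 < ‖u‖ ^ 2 + 1 :=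
      (hlim.norm.pow 2).eventually_lt_const (by linarith)
    filter_upwards [hh0.eventually (taylor2 hB hη), hseg, hn, hpos] with t h1 h2 h3 h4
    have := h1 h2
    rw [dist_zero_right, norm_smul]
    have h5 : ‖h t‖ ^ 2 = t ^ 2 * ‖t⁻¹ • h t‖ ^ 2 := by
      rw [norm_smul, norm_inv, Real.norm_eq_abs, mul_pow, inv_pow, sq_abs]
      field_simp
    rw [h5] at this
    rw [norm_inv, norm_pow, Real.norm_eq_abs, sq_abs]
    calc (t ^ 2)⁻¹ * _ ≤ (t ^ 2)⁻¹ * (ε / (2 * (‖u‖ ^ 2 + 1)) * (t ^ 2 * ‖t⁻¹ • h t‖ ^ 2)) := by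
          gcongr
      _ = ε / (2 * (‖u‖ ^ 2 + 1)) * ‖t⁻¹ • h t‖ ^ 2 := by field_simp
      _ ≤ ε / (2 * (‖u‖ ^ 2 + 1)) * (‖u‖ ^ 2 + 1) := by gcongr
      _ = ε / 2 := by field_simp
      _ < ε := by linarith
  have h3 := h2.add h1
  rw [zero_add] at h3
  refine h3.congr' ?_
  filter_upwards [hpos] with t ht
  have : (1 / 2 : ℝ) • B (t⁻¹ • h t) (t⁻¹ • h t) = (t ^ 2)⁻¹ • ((1 / 2 : ℝ) • B (h t) (h t)) := by
    simp only [map_smul, smul_apply, smul_smul]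
    congr 1
    field_simp
  rw [this, ← smul_add, sub_add_cancel]

theorem diff_seg {E F : Type*} [NormedAddCommGroup E] [NormedSpace ℝ E]
    [NormedAddCommGroup F] [NormedSpace ℝ F] {f : E → F} {x u : E} {B : E →L[ℝ] E →L[ℝ] F}
    (hf : DifferentiableAt ℝ f x)
    (hB : HasFDerivAt (fderiv ℝ f) B x) (hne : fderiv ℝ f x ≠ 0 ∨ B u ≠ 0) {h : ℝ → E}
    (hlim : Tendsto (fun t : ℝ => t⁻¹ • h t) (𝓝[>] 0) (𝓝 u)) :
    ∀ᶠ t in 𝓝[>] (0 : ℝ), ∀ τ ∈ Icc (0 : ℝ) 1, DifferentiableAt ℝ f (x + τ • h t) := by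
  have hpos : ∀ᶠ t in 𝓝[>] (0 : ℝ), 0 < t := eventually_mem_nhdsWithin
  have hid : Tendsto (fun t : ℝ => t) (𝓝[>] 0) (𝓝 0) := tendsto_id.mono_left nhdsWithin_le_nhds
  have hh0 : Tendsto h (𝓝[>] 0) (𝓝 0) := by
    have := hid.smul hlim
    rw [zero_smul] at this
    refine this.congr' ?_
    filter_upwards [hpos] with t ht
    rw [smul_smul, mul_inv_cancel₀ ht.ne', one_smul]
  have hshr : ∀ P : E → Prop, (∀ᶠ y in 𝓝 (0 : E), P y) →
      ∀ᶠ t in 𝓝[>] (0 : ℝ), ∀ τ ∈ Icc (0 : ℝ) 1, P (τ • h t) := by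
    intro P hP
    obtain ⟨δ, hδ, h2⟩ := Metric.eventually_nhds_iff.1 hP
    have : ∀ᶠ t in 𝓝[>] (0 : ℝ), ‖h t‖ < δ := by
      have := hh0.norm
      rw [norm_zero] at this
      exact this.eventually_lt_const hδ
    filter_upwards [this] with t ht τ hτ
    apply h2
    rw [dist_zero_right, norm_smul, Real.norm_eq_abs, abs_of_nonneg hτ.1]
    exact (mul_le_of_le_one_left (norm_nonneg _) hτ.2).trans_lt ht
  by_cases h0 : fderiv ℝ f x = 0
  · have hBu : B u ≠ 0 := by
      rcases hne with h | h
      · exact absurd h0 h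
      · exact h
    have hBp : 0 < ‖B u‖ := norm_pos_iff.2 hBu
    have hε : 0 < ‖B u‖ / (2 * (‖u‖ + 1)) := by positivity
    have h1 := hshr _ ((hasFDerivAt_iff_isLittleO_nhds_zero.1 hB).def hε)
    have h2 : ∀ᶠ t in 𝓝[>] (0 : ℝ),
        ‖B u‖ / (2 * (‖u‖ + 1)) * ‖t⁻¹ • h t‖ < ‖B (t⁻¹ • h t)‖ := by
      have l1 : Tendsto (fun t : ℝ => ‖B u‖ / (2 * (‖u‖ + 1)) * ‖t⁻¹ • h t‖) (𝓝[>] 0)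
        (𝓝 (‖B u‖ / (2 * (‖u‖ + 1)) * ‖u‖)) := hlim.norm.const_mul _
      have l2 : Tendsto (fun t : ℝ => ‖B (t⁻¹ • h t)‖) (𝓝[>] 0) (𝓝 ‖B u‖) :=
        ((B.continuous.tendsto u).comp hlim).norm
      refine l1.eventually_lt l2 ?_
      rw [div_mul_eq_mul_div, div_lt_iff₀ (by positivity)]
      nlinarith [norm_nonneg u]
    filter_upwards [h1, h2, hpos] with t h1 h2 ht τ hτ
    rcases hτ.1.eq_or_lt with h00 | hτ0
    · rw [← h00]; simpa using hf
    by_contra hcon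
    have h3 := h1 τ hτ
    rw [h0, fderiv_zero_of_not_differentiableAt hcon] at h3
    simp only [zero_sub, norm_neg, sub_self] at h3
    have e : τ • h t = (τ * t) • (t⁻¹ • h t) := by
      rw [smul_smul, mul_assoc, mul_inv_cancel₀ ht.ne', mul_one]
    rw [e, map_smul, norm_smul, norm_smul] at h3
    have hp : 0 < ‖τ * t‖ := norm_pos_iff.2 (mul_pos hτ0 ht).ne'
    nlinarith
  · have hc : ContinuousAt (fderiv ℝ f) x := hB.continuousAt
    have h1 : ∀ᶠ y in 𝓝 x, fderiv ℝ f y ≠ 0 := hc.eventually_ne h0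
    have h2 : ∀ᶠ y in 𝓝 (0 : E), fderiv ℝ f (x + y) ≠ 0 := by
      have : Tendsto (fun y => x + y) (𝓝 (0 : E)) (𝓝 x) := by
        have : Continuous fun y : E => x + y := by fun_prop
        simpa using this.tendsto 0
      exact this.eventually h1
    filter_upwards [hshr _ h2] with t ht τ hτ
    by_contra hcon
    exact ht τ hτ (fderiv_zero_of_not_differentiableAt hcon)


theorem lex_neg {X : ℝ → ℝ} {α β γ : ℝ}
    (hX : Tendsto (fun t : ℝ => (t ^ 2)⁻¹ * (X t - α - t * β)) (𝓝[>] 0) (𝓝 γ))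
    (h : α < 0 ∨ (α = 0 ∧ (β < 0 ∨ (β = 0 ∧ γ < 0)))) : ∀ᶠ t in 𝓝[>] (0 : ℝ), X t < 0 := by
  have hpos : ∀ᶠ t in 𝓝[>] (0 : ℝ), 0 < t := eventually_mem_nhdsWithin
  have hid : Tendsto (fun t : ℝ => t) (𝓝[>] 0) (𝓝 0) := tendsto_id.mono_left nhdsWithin_le_nhds
  rcases h with h | ⟨rfl, h | ⟨rfl, h⟩⟩
  · have h1 : Tendsto (fun t : ℝ => t ^ 2 * ((t ^ 2)⁻¹ * (X t - α - t * β)) + t * β + α) (𝓝[>] 0)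
      (𝓝 (0 ^ 2 * γ + 0 * β + α)) := (((hid.pow 2).mul hX).add (hid.mul_const β)).add_const α
    have h2 : (0 : ℝ) ^ 2 * γ + 0 * β + α < 0 := by simpa using h
    filter_upwards [h1.eventually_lt_const h2, hpos] with t ht hp
    rw [← mul_assoc, mul_inv_cancel₀ (by positivity)] at ht
    linarith
  · have h1 : Tendsto (fun t : ℝ => t * ((t ^ 2)⁻¹ * (X t - 0 - t * β)) + β) (𝓝[>] 0)
      (𝓝 (0 * γ + β)) := (hid.mul hX).add_const β
    have h2 : (0 : ℝ) * γ + β < 0 := by simpa using h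
    filter_upwards [h1.eventually_lt_const h2, hpos] with t ht hp
    have e : t * ((t ^ 2)⁻¹ * (X t - 0 - t * β)) + β = t⁻¹ * X t := by field_simp; ring
    rw [e] at ht
    by_contra hc
    push Not at hc
    have : 0 ≤ t⁻¹ * X t := by positivity
    linarith
  · filter_upwards [hX.eventually_lt_const h, hpos] with t ht hp
    by_contra hc
    push Not at hc
    have : 0 ≤ (t ^ 2)⁻¹ * (X t - 0 - t * 0) := by
      have : X t - 0 - t * 0 = X t := by ring
      rw [this]; positivity
    linarith

theorem correction {n m : ℕ} {Φ : Ev n → Ev m} {xb : Ev n}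
    (hPhi2 : DifferentiableAt ℝ (fderiv ℝ Φ) xb) (W : Submodule ℝ (Ev m))
    (hsurj : ∀ w : W, ∃ s, W.orthogonalProjectionOnto (fderiv ℝ Φ xb s) = w) {h : ℝ → Ev n}
    (hh : Tendsto h (𝓝[>] 0) (𝓝 0))
    (hP : Tendsto (fun t : ℝ => (t ^ 2)⁻¹ • W.orthogonalProjectionOnto (Φ (xb + h t) - Φ xb)) (𝓝[>] 0)
      (𝓝 0)) :
    ∃ e : ℝ → Ev n, Tendsto (fun t : ℝ => (t ^ 2)⁻¹ • e t) (𝓝[>] 0) (𝓝 0) ∧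
      ∀ᶠ t in 𝓝[>] (0 : ℝ), W.orthogonalProjectionOnto (Φ (xb + (h t + e t)) - Φ xb) = 0 := by
  by_cases hA : fderiv ℝ Φ xb = 0
  · refine ⟨0, by simp, Eventually.of_forall fun t => ?_⟩
    obtain ⟨s, hs⟩ := hsurj (W.orthogonalProjectionOnto (Φ (xb + (h t + (0 : ℝ → Ev n) t)) - Φ xb))
    rw [← hs, hA]; simp
  have hpos : ∀ᶠ t in 𝓝[>] (0 : ℝ), 0 < t := eventually_mem_nhdsWithin
  have hid : Tendsto (fun t : ℝ => t) (𝓝[>] 0) (𝓝 0) := tendsto_id.mono_left nhdsWithin_le_nhds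
  have hst : HasStrictFDerivAt Φ (fderiv ℝ Φ xb) xb := by
    apply hasStrictFDerivAt_of_hasFDerivAt_of_continuousAt _ hPhi2.continuousAt
    filter_upwards [hPhi2.continuousAt.eventually_ne hA] with y hy
    by_contra hcon
    exact hy (fderiv_zero_of_not_differentiableAt fun hd => hcon hd.hasFDerivAt)
  set P := W.orthogonalProjectionOnto with hPdef
  have hstP : HasStrictFDerivAt (fun x => P (Φ x)) (P.comp (fderiv ℝ Φ xb)) xb :=
    P.hasStrictFDerivAt.comp xb hst
  have hr : (P.comp (fderiv ℝ Φ xb)).range = ⊤ := by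
    rw [LinearMap.range_eq_top]
    intro w
    exact hsurj w
  set S := (P.comp (fderiv ℝ Φ xb)).nonlinearRightInverseOfSurjective hr
  have hN : 0 < S.nnnorm := ContinuousLinearMap.nonlinearRightInverseOfSurjective_nnnorm_pos _ hr
  have hc : 0 < S.nnnorm⁻¹ / 2 := by positivity
  obtain ⟨U, hU, happ⟩ := hstP.approximates_deriv_on_nhds (Or.inr hc)
  obtain ⟨δ, hδ, hball⟩ := Metric.mem_nhds_iff.1 hU
  set N : ℝ := (S.nnnorm : ℝ) with hNdef
  have hN' : 0 < N := by exact_mod_cast hN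
  set ρ : ℝ → ℝ := fun t => 2 * N * ‖P (Φ (xb + h t) - Φ xb)‖ with hρ
  have hρ0 : ∀ t, 0 ≤ ρ t := fun t => by positivity
  have hρlim : Tendsto (fun t : ℝ => (t ^ 2)⁻¹ * ρ t) (𝓝[>] 0) (𝓝 0) := by
    have := hP.norm.const_mul (2 * N)
    rw [norm_zero, mul_zero] at this
    refine this.congr' ?_
    filter_upwards [hpos] with t ht
    rw [norm_smul, norm_inv, norm_pow, Real.norm_eq_abs, sq_abs]
    simp only [hρ]; ring
  have hρ1 : Tendsto ρ (𝓝[>] 0) (𝓝 0) := by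
    have := (hid.pow 2).mul hρlim
    rw [mul_zero] at this
    refine this.congr' ?_
    filter_upwards [hpos] with t ht
    rw [← mul_assoc, mul_inv_cancel₀ (by positivity), one_mul]
  have hex : ∀ᶠ t in 𝓝[>] (0 : ℝ), ∃ e : Ev n, ‖e‖ ≤ ρ t ∧
      P (Φ (xb + (h t + e)) - Φ xb) = 0 := by
    have hhn := hh.norm
    rw [norm_zero] at hhn
    filter_upwards [hρ1.eventually_lt_const (half_pos hδ),
      hhn.eventually_lt_const (half_pos hδ)] with t h1 h2
    have hsub : Metric.closedBall (xb + h t) (ρ t) ⊆ U := by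
      refine Subset.trans ?_ hball
      intro y hy
      rw [Metric.mem_closedBall] at hy
      rw [Metric.mem_ball]
      have := dist_triangle y (xb + h t) xb
      have h3 : dist (xb + h t) xb = ‖h t‖ := by simp
      linarith
    have hs := happ.surjOn_closedBall_of_nonlinearRightInverse S (hρ0 t) hsub
    have hmem : P (Φ xb) ∈ Metric.closedBall (P (Φ (xb + h t)))
        (((S.nnnorm : ℝ)⁻¹ - ((S.nnnorm⁻¹ / 2 : NNReal) : ℝ)) * ρ t) := by
      rw [Metric.mem_closedBall, dist_comm, dist_eq_norm, ← map_sub]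
      push_cast
      rw [← hNdef]
      apply le_of_eq
      simp only [hρ]
      field_simp
      ring
    obtain ⟨y, hy, hyP⟩ := hs hmem
    refine ⟨y - (xb + h t), ?_, ?_⟩
    · rwa [Metric.mem_closedBall, dist_eq_norm] at hy
    · have : xb + (h t + (y - (xb + h t))) = y := by abel
      rw [this, map_sub]
      exact sub_eq_zero.2 hyP
  classical
  refine ⟨fun t => if ht : ∃ e : Ev n, ‖e‖ ≤ ρ t ∧ P (Φ (xb + (h t + e)) - Φ xb) = 0 then
    ht.choose else 0, ?_, ?_⟩
  · apply squeeze_zero_norm' _ hρlim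
    filter_upwards [hex, hpos] with t ht hp
    rw [dif_pos ht, norm_smul, norm_inv, norm_pow, Real.norm_eq_abs, sq_abs]
    gcongr
    exact ht.choose_spec.1
  · filter_upwards [hex] with t ht
    rw [dif_pos ht]
    exact ht.choose_spec.2

theorem CPWL.le_val {m : ℕ} (θ : CPWL m) (z : Ev m) (i : Fin θ.l) :
    ⟪θ.a i, z⟫ - θ.al i ≤ θ.val z :=
  le_ciSup (f := fun i : Fin θ.l => ⟪θ.a i, z⟫ - θ.al i) (Set.finite_range _).bddAbove i

theorem CPWL.exists_val {m : ℕ} (θ : CPWL m) (z : Ev m) :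
    ∃ i : Fin θ.l, θ.val z = ⟪θ.a i, z⟫ - θ.al i := by
  have : Nonempty (Fin θ.l) := ⟨⟨0, θ.hl⟩⟩
  obtain ⟨i, hi⟩ := exists_eq_ciSup_of_finite (f := fun i : Fin θ.l => ⟪θ.a i, z⟫ - θ.al i)
  exact ⟨i, hi.symm⟩

theorem localmin_real {n m : ℕ} {θ : CPWL m} {φ₀ : Ev n → ℝ} {Φ : Ev n → Ev m} {xb : Ev n}
    (hdom : Φ xb ∈ θ.dom) (hmin : LocalMin φ₀ Φ θ xb) :
    ∀ᶠ x in 𝓝 xb, Φ x ∈ θ.dom → φ₀ xb + θ.val (Φ xb) ≤ φ₀ x + θ.val (Φ x) := by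
  obtain ⟨U, hU, h⟩ := hmin
  filter_upwards [hU] with x hx hd
  have := h x hx
  rw [CPWL.eval, CPWL.eval, if_pos hdom, if_pos hd] at this
  exact_mod_cast this

theorem core {n m : ℕ} {θ : CPWL m} {φ₀ : Ev n → ℝ} {Φ : Ev n → Ev m} {xb : Ev n}
    (hPhi2 : DifferentiableAt ℝ (fderiv ℝ Φ) xb)
    (hdom : Φ xb ∈ θ.dom) (hmin : LocalMin φ₀ Φ θ xb)
    (hrob : ∀ y : Ev m, ∃ s k, (∀ j ∈ θ.Iact (Φ xb), ⟪θ.d j, k⟫ ≤ 0) ∧ y = k - fderiv ℝ Φ xb s)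
    (u : Ev n) (hw : ∀ j ∈ θ.Iact (Φ xb), ⟪θ.d j, fderiv ℝ Φ xb u⟫ ≤ 0) (μ : ℝ)
    (hμ : ∀ i ∈ θ.Kact (Φ xb), ⟪θ.a i, fderiv ℝ Φ xb u⟫ ≤ μ) (g : Ev n) (q : Ev m) (r : ℝ)
    (hexp : ∀ (s : Ev n) (e : ℝ → Ev n), Tendsto (fun t : ℝ => (t ^ 2)⁻¹ • e t) (𝓝[>] 0) (𝓝 0) →
      Tendsto (fun t : ℝ => (t ^ 2)⁻¹ •
        (Φ (xb + (t • u + t ^ 2 • s + e t)) - Φ xb - t • fderiv ℝ Φ xb u)) (𝓝[>] 0)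
        (𝓝 (fderiv ℝ Φ xb s + q)) ∧
      Tendsto (fun t : ℝ => (t ^ 2)⁻¹ *
        (φ₀ (xb + (t • u + t ^ 2 • s + e t)) - φ₀ xb + t * μ)) (𝓝[>] 0)
        (𝓝 (⟪g, s⟫ + r))) :
    ¬ ∃ s, (∀ j ∈ {j | j ∈ θ.Iact (Φ xb) ∧ ⟪θ.d j, fderiv ℝ Φ xb u⟫ = 0},
        ⟪θ.d j, fderiv ℝ Φ xb s + q⟫ ≤ 0) ∧
      ∀ i ∈ {i | i ∈ θ.Kact (Φ xb) ∧ ⟪θ.a i, fderiv ℝ Φ xb u⟫ = μ},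
        ⟪g, s⟫ + r + ⟪θ.a i, fderiv ℝ Φ xb s + q⟫ < 0 := by
  rintro ⟨s₀, hs₀, hv₀⟩
  have hpos : ∀ᶠ t in 𝓝[>] (0 : ℝ), 0 < t := eventually_mem_nhdsWithin
  have hid : Tendsto (fun t : ℝ => t) (𝓝[>] 0) (𝓝 0) := tendsto_id.mono_left nhdsWithin_le_nhds
  set A := fderiv ℝ Φ xb with hA
  set zb := Φ xb with hzb
  let K : Set (Ev m) := {k | ∀ j ∈ θ.Iact zb, ⟪θ.d j, k⟫ ≤ 0}
  let Eq : Set (Fin θ.p) := {j | j ∈ θ.Iact zb ∧ ∀ k ∈ K, ⟪θ.d j, k⟫ = 0}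
  -- relative interior point
  have hri : ∃ k₀ ∈ K, ∀ j ∈ θ.Iact zb, j ∉ Eq → ⟪θ.d j, k₀⟫ < 0 := by
    have : ∀ j, ∃ k ∈ K, j ∈ θ.Iact zb → j ∉ Eq → ⟪θ.d j, k⟫ < 0 := by
      intro j
      by_cases hj : j ∈ θ.Iact zb ∧ j ∉ Eq
      · obtain ⟨h1, h2⟩ := hj
        have : ∃ k ∈ K, ⟪θ.d j, k⟫ ≠ 0 := by
          by_contra hcon
          push Not at hcon
          exact h2 ⟨h1, hcon⟩
        obtain ⟨k, hk, hne⟩ := this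
        exact ⟨k, hk, fun _ _ => lt_of_le_of_ne (hk j h1) hne⟩
      · exact ⟨0, fun j _ => by simp, fun h1 h2 => absurd ⟨h1, h2⟩ hj⟩
    choose k hk hkn using this
    refine ⟨∑ j, k j, fun j hj => ?_, fun j hj hjE => ?_⟩
    · rw [inner_sum]
      exact Finset.sum_nonpos fun i _ => hk i j hj
    · rw [inner_sum]
      exact Finset.sum_neg' (fun i _ => hk i j hj) ⟨j, Finset.mem_univ _, hkn j hj hjE⟩
  obtain ⟨k₀, hk₀, hk₀n⟩ := hri
  obtain ⟨s', k₁, hk₁, hs'⟩ := hrob (-k₀)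
  have hAs' : A s' = k₀ + k₁ := by
    have : A s' = k₁ - (k₁ - A s') := by abel
    rw [this, ← hs']; abel
  -- perturbed s
  obtain ⟨s, hsE, hsn, hsv⟩ : ∃ s, (∀ j ∈ Eq, ⟪θ.d j, A s + q⟫ = 0) ∧
      (∀ j ∈ θ.Iact zb, ⟪θ.d j, A u⟫ = 0 → j ∉ Eq → ⟪θ.d j, A s + q⟫ < 0) ∧
      (∀ i ∈ θ.Kact zb, ⟪θ.a i, A u⟫ = μ → ⟪g, s⟫ + r + ⟪θ.a i, A s + q⟫ < 0) := by
    have hev : ∀ᶠ ε in 𝓝[>] (0 : ℝ), ∀ i : Fin θ.l, i ∈ θ.Kact zb → ⟪θ.a i, A u⟫ = μ →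
        ⟪g, s₀ + ε • s'⟫ + r + ⟪θ.a i, A (s₀ + ε • s') + q⟫ < 0 := by
      rw [eventually_all]
      intro i
      by_cases hi : i ∈ θ.Kact zb ∧ ⟪θ.a i, A u⟫ = μ
      · have hc : Continuous fun ε : ℝ =>
            ⟪g, s₀ + ε • s'⟫ + r + ⟪θ.a i, A (s₀ + ε • s') + q⟫ := by fun_prop
        have h1 := (hc.tendsto 0).mono_left (nhdsWithin_le_nhds (s := Ioi 0))
        have h2 := hv₀ i hi
        filter_upwards [h1.eventually_lt_const (by simpa using h2)] with ε hε _ _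
        exact hε
      · exact Eventually.of_forall fun ε h1 h2 => absurd ⟨h1, h2⟩ hi
    obtain ⟨ε, hε, hεp⟩ := (hev.and hpos).exists
    have hsplit : ∀ j, ⟪θ.d j, A (s₀ + ε • s') + q⟫ =
        ⟪θ.d j, A s₀ + q⟫ + ε * (⟪θ.d j, k₀⟫ + ⟪θ.d j, k₁⟫) := by
      intro j
      rw [map_add, map_smul, hAs']
      simp only [inner_add_right, inner_smul_right]; ring
    refine ⟨s₀ + ε • s', ?_, ?_, hε⟩
    · intro j hj
      rw [hsplit, hj.2 k₀ hk₀, hj.2 k₁ hk₁]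
      -- A s₀ + q + T w ∈ K for large T
      have : ∃ T : ℝ, A s₀ + q + T • A u ∈ K := by
        have hT : ∀ᶠ T in atTop, ∀ j : Fin θ.p, j ∈ θ.Iact zb →
            ⟪θ.d j, A s₀ + q⟫ + T * ⟪θ.d j, A u⟫ ≤ 0 := by
          rw [eventually_all]
          intro j
          by_cases hj : j ∈ θ.Iact zb
          · rcases (hw j hj).eq_or_lt with h | h
            · filter_upwards with T _
              rw [h, mul_zero, add_zero]
              exact hs₀ j ⟨hj, h⟩
            · filter_upwards [eventually_ge_atTop (⟪θ.d j, A s₀ + q⟫ / -⟪θ.d j, A u⟫)] with T hT _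
              rw [div_le_iff₀ (by linarith)] at hT
              linarith
          · exact Eventually.of_forall fun T h => absurd h hj
        obtain ⟨T, hT⟩ := hT.exists
        refine ⟨T, fun j hj => ?_⟩
        rw [inner_add_right, inner_smul_right]
        exact hT j hj
      obtain ⟨T, hT⟩ := this
      have h1 := hj.2 _ hT
      rw [inner_add_right, inner_smul_right, hj.2 (A u) hw] at h1
      linarith
    · intro j hj h1 h2
      rw [hsplit]
      have e1 := hs₀ j ⟨hj, h1⟩
      have e2 := hk₀n j hj h2
      have e3 := hk₁ j hj
      nlinarith
  -- correction
  let W : Submodule ℝ (Ev m) := Submodule.span ℝ (θ.d '' Eq)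
  have hWK : ∀ k, (∀ j ∈ Eq, ⟪θ.d j, k⟫ = 0) → W.orthogonalProjectionOnto k = 0 := by
    intro k hk
    rw [Submodule.orthogonalProjectionOnto_eq_zero_iff, Submodule.mem_orthogonal]
    intro w hw
    induction hw using Submodule.span_induction with
    | mem x hx => obtain ⟨j, hj, rfl⟩ := hx; exact hk j hj
    | zero => simp
    | add x y _ _ h1 h2 => rw [inner_add_left, h1, h2, add_zero]
    | smul c x _ h1 => rw [inner_smul_left, h1, mul_zero]
  have hsurj : ∀ w : W, ∃ s, W.orthogonalProjectionOnto (A s) = w := by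
    intro w
    obtain ⟨s, k, hk, hy⟩ := hrob (-(w : Ev m))
    refine ⟨s, ?_⟩
    have : A s = w + k := by
      have : A s = k - (k - A s) := by abel
      rw [this, ← hy]; abel
    rw [this, map_add, hWK k (fun j hj => hj.2 k hk), add_zero]
    simp
  have hh : Tendsto (fun t : ℝ => t • u + t ^ 2 • s) (𝓝[>] 0) (𝓝 0) := by
    have hc : Continuous (fun t : ℝ => t • u + t ^ 2 • s) := by fun_prop
    have := (hc.tendsto 0).mono_left (nhdsWithin_le_nhds (s := Ioi 0))
    simpa using this
  have hwE : ∀ j ∈ Eq, ⟪θ.d j, A u⟫ = 0 := fun j hj => hj.2 _ hw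
  obtain ⟨e, he, hPe⟩ := correction hPhi2 W hsurj hh (by
    have h1 := (hexp s 0 (by simp)).1
    have h2 := (W.orthogonalProjectionOnto.continuous.tendsto _).comp h1
    rw [hWK _ hsE] at h2
    refine h2.congr fun t => ?_
    simp only [Function.comp, Pi.zero_apply, add_zero, map_smul, map_sub]
    rw [hWK _ hwE, smul_zero, sub_zero])
  obtain ⟨hΦ, hφ⟩ := hexp s e he
  set x : ℝ → Ev n := fun t => xb + (t • u + t ^ 2 • s + e t) with hx
  have hxlim : Tendsto x (𝓝[>] 0) (𝓝 xb) := by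
    have h1 : Tendsto e (𝓝[>] 0) (𝓝 0) := by
      have := (hid.pow 2).smul he
      rw [smul_zero] at this
      refine this.congr' ?_
      filter_upwards [hpos] with t ht
      rw [smul_smul, mul_inv_cancel₀ (by positivity), one_smul]
    simpa using (hh.add h1).const_add xb
  have hlin : ∀ c : Ev m, Tendsto (fun t : ℝ => (t ^ 2)⁻¹ * (⟪c, Φ (x t)⟫ - ⟪c, zb⟫ - t * ⟪c, A u⟫))
      (𝓝[>] 0) (𝓝 ⟪c, A s + q⟫) := by
    intro c
    have := (tendsto_const_nhds (x := c)).inner (𝕜 := ℝ) hΦ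
    refine this.congr fun t => ?_
    simp only [inner_smul_right, inner_sub_right]
    rfl
  -- feasibility
  have hfeas : ∀ᶠ t in 𝓝[>] (0 : ℝ), Φ (x t) ∈ θ.dom := by
    have : ∀ᶠ t in 𝓝[>] (0 : ℝ), ∀ j : Fin θ.p, ⟪θ.d j, Φ (x t)⟫ - θ.be j ≤ 0 := by
      rw [eventually_all]
      intro j
      by_cases hjE : j ∈ Eq
      · filter_upwards [hPe] with t ht
        have hz : ⟪θ.d j, Φ (x t) - zb⟫ = 0 := by
          rw [Submodule.orthogonalProjectionOnto_eq_zero_iff, Submodule.mem_orthogonal] at ht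
          exact ht _ (Submodule.subset_span ⟨j, hjE, rfl⟩)
        rw [inner_sub_right] at hz
        have : ⟪θ.d j, zb⟫ = θ.be j := hjE.1
        linarith
      · have : ∀ᶠ t in 𝓝[>] (0 : ℝ), ⟪θ.d j, Φ (x t)⟫ - θ.be j < 0 := by
          apply lex_neg (α := ⟪θ.d j, zb⟫ - θ.be j) (β := ⟪θ.d j, A u⟫) (γ := ⟪θ.d j, A s + q⟫)
          · refine (hlin (θ.d j)).congr fun t => ?_
            ring
          · by_cases hj : j ∈ θ.Iact zb
            · right
              have : ⟪θ.d j, zb⟫ = θ.be j := hj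
              refine ⟨by linarith, ?_⟩
              rcases (hw j hj).eq_or_lt with h | h
              · exact Or.inr ⟨h, hsn j hj h hjE⟩
              · exact Or.inl h
            · left
              have h1 := hdom j
              have : ⟪θ.d j, zb⟫ ≠ θ.be j := hj
              have := lt_of_le_of_ne h1 this
              linarith
        filter_upwards [this] with t ht using ht.le
    filter_upwards [this] with t ht j
    linarith [ht j]
  have hval : ∀ᶠ t in 𝓝[>] (0 : ℝ), ∀ i : Fin θ.l,
      ⟪θ.a i, Φ (x t)⟫ - θ.al i + φ₀ (x t) - θ.val zb - φ₀ xb < 0 := by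
    rw [eventually_all]
    intro i
    apply lex_neg (α := ⟪θ.a i, zb⟫ - θ.al i - θ.val zb) (β := ⟪θ.a i, A u⟫ - μ)
      (γ := ⟪g, s⟫ + r + ⟪θ.a i, A s + q⟫)
    · refine (hφ.add (hlin (θ.a i))).congr fun t => ?_
      ring
    · by_cases hi : i ∈ θ.Kact zb
      · right
        have : θ.val zb = ⟪θ.a i, zb⟫ - θ.al i := hi
        refine ⟨by linarith, ?_⟩
        rcases (hμ i hi).eq_or_lt with h | h
        · exact Or.inr ⟨by linarith, hsv i hi h⟩
        · exact Or.inl (by linarith)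
      · left
        have h1 := θ.le_val zb i
        have h2 : θ.val zb ≠ ⟪θ.a i, zb⟫ - θ.al i := hi
        have := lt_of_le_of_ne h1 h2.symm
        linarith
  obtain ⟨t, h1, h2, h3⟩ :=
    (hfeas.and (hval.and (hxlim.eventually (localmin_real hdom hmin)))).exists
  have h4 := h3 h1
  obtain ⟨i, hi⟩ := θ.exists_val (Φ (x t))
  have h5 := h2 i
  rw [hi] at h4
  linarith


theorem inner_gradient {n : ℕ} (f : Ev n → ℝ) (x h : Ev n) :
    ⟪gradient f x, h⟫ = fderiv ℝ f x h := by
  rw [gradient, InnerProductSpace.toDual_symm_apply]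

def Jd (n : ℕ) : Ev n →L[ℝ] (Ev n →L[ℝ] ℝ) :=
  LinearMap.toContinuousLinearMap
    { toFun := fun x => innerSL ℝ x
      map_add' := fun x y => by ext z; simp [inner_add_left]
      map_smul' := fun c y => by ext z; simp [inner_smul_left] }

theorem Jd_apply {n : ℕ} (x y : Ev n) : Jd n x y = ⟪x, y⟫ := by simp [Jd]

theorem grad_fderiv {n : ℕ} {f : Ev n → ℝ} {G : Ev n →L[ℝ] Ev n} {x : Ev n}
    (h : HasFDerivAt (gradient f) G x) : HasFDerivAt (fderiv ℝ f) ((Jd n).comp G) x := by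
  have e : fderiv ℝ f = fun y => Jd n (gradient f y) := by
    funext y
    ext z
    rw [Jd_apply, inner_gradient]
  rw [e]
  exact (Jd n).hasFDerivAt.comp x h

theorem hess_fderiv {n m : ℕ} {φ₀ : Ev n → ℝ} {Φ : Ev n → Ev m} {xb u : Ev n} {v : Ev m}
    (h : ⟪HessOp φ₀ Φ v xb u, u⟫ < 0) :
    HasFDerivAt (fderiv ℝ (fun y => φ₀ y + ⟪Φ y, v⟫)) ((Jd n).comp (HessOp φ₀ Φ v xb)) xb := by
  apply grad_fderiv
  have hd : DifferentiableAt ℝ (gradL φ₀ Φ v) xb := by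
    by_contra hcon
    rw [HessOp, fderiv_zero_of_not_differentiableAt hcon] at h
    simp at h
  exact hd.hasFDerivAt

theorem hess_ne {n m : ℕ} {φ₀ : Ev n → ℝ} {Φ : Ev n → Ev m} {xb u : Ev n} {v : Ev m}
    (h : ⟪HessOp φ₀ Φ v xb u, u⟫ < 0) : ((Jd n).comp (HessOp φ₀ Φ v xb)) u ≠ 0 := by
  intro hcon
  have := congrArg (fun f : Ev n →L[ℝ] ℝ => f u) hcon
  simp only [ContinuousLinearMap.comp_apply, Jd_apply] at this
  rw [this] at h
  simp at h

theorem lagr_hasFDerivAt {n m : ℕ} {φ₀ : Ev n → ℝ} {Φ : Ev n → Ev m} {x : Ev n} (v : Ev m)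
    (hphi : DifferentiableAt ℝ φ₀ x) (hPhi : DifferentiableAt ℝ Φ x) :
    HasFDerivAt (fun y => φ₀ y + ⟪Φ y, v⟫)
      (fderiv ℝ φ₀ x + (innerSL ℝ v).comp (fderiv ℝ Φ x)) x := by
  have h1 : HasFDerivAt (fun y => innerSL ℝ v (Φ y)) ((innerSL ℝ v).comp (fderiv ℝ Φ x)) x :=
    (innerSL ℝ v).hasFDerivAt.comp x hPhi.hasFDerivAt
  have h2 : (fun y => φ₀ y + ⟪Φ y, v⟫) = fun y => φ₀ y + innerSL ℝ v (Φ y) := by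
    funext y
    rw [innerSL_apply_apply, real_inner_comm]
  rw [h2]
  exact hphi.hasFDerivAt.add h1

theorem subdiff_of {m : ℕ} {θ : CPWL m} {zb v : Ev m} (hz : zb ∈ θ.dom) {I : Set (Fin θ.p)}
    {K : Set (Fin θ.l)} (hI : I ⊆ θ.Iact zb) (hK : K ⊆ θ.Kact zb)
    (h : ∀ z, (∀ j ∈ I, ⟪θ.d j, z⟫ ≤ 0) → ∃ i ∈ K, ⟪v, z⟫ ≤ ⟪θ.a i, z⟫) :
    v ∈ θ.subdiff zb := by
  refine ⟨hz, fun z' hz' => ?_⟩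
  obtain ⟨i, hi, h1⟩ := h (z' - zb) (fun j hj => by
    have e1 : ⟪θ.d j, zb⟫ = θ.be j := hI hj
    have e2 := hz' j
    rw [inner_sub_right]; linarith)
  have e1 : θ.val zb = ⟪θ.a i, zb⟫ - θ.al i := hK hi
  have e2 := θ.le_val z' i
  rw [inner_sub_right (θ.a i)] at h1
  linarith

theorem first_path {n : ℕ} {F : Type*} [NormedAddCommGroup F] [NormedSpace ℝ F] {f : Ev n → F}
    {x : Ev n} (hf : DifferentiableAt ℝ f x) {h : ℝ → Ev n} {s : Ev n}
    (hh : Tendsto (fun t : ℝ => (t ^ 2)⁻¹ • h t) (𝓝[>] 0) (𝓝 s)) :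
    Tendsto (fun t : ℝ => (t ^ 2)⁻¹ • (f (x + h t) - f x)) (𝓝[>] 0) (𝓝 (fderiv ℝ f x s)) := by
  have hid : Tendsto (fun t : ℝ => t) (𝓝[>] 0) (𝓝 0) := tendsto_id.mono_left nhdsWithin_le_nhds
  have hpos : ∀ᶠ t in 𝓝[>] (0 : ℝ), 0 < t := eventually_mem_nhdsWithin
  have hinv : Tendsto (fun t : ℝ => (t ^ 2)⁻¹) (𝓝[>] 0) atTop := by
    apply Tendsto.inv_tendsto_nhdsGT_zero
    refine tendsto_nhdsWithin_iff.2 ⟨by simpa using hid.pow 2, ?_⟩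
    filter_upwards [hpos] with t ht
    exact pow_pos ht 2
  have hh0 : Tendsto h (𝓝[>] 0) (𝓝 0) := by
    have := (hid.pow 2).smul hh
    rw [zero_pow two_ne_zero, zero_smul] at this
    refine this.congr' ?_
    filter_upwards [hpos] with t ht
    rw [smul_smul, mul_inv_cancel₀ (by positivity), one_smul]
  exact hf.hasFDerivAt.hasFDerivWithinAt.lim (s := univ) hh0
    (Eventually.of_forall fun _ => mem_univ _) hh

theorem crit_K2 {m : ℕ} {θ : CPWL m} {zb w : Ev m} {μ : ℝ}
    (h : Tendsto (fun t : ℝ => (θ.val (zb + t • w) - θ.val zb) / t) (𝓝[>] (0 : ℝ)) (𝓝 μ)) :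
    (∀ i ∈ θ.Kact zb, ⟪θ.a i, w⟫ ≤ μ) ∧ {i | i ∈ θ.Kact zb ∧ ⟪θ.a i, w⟫ = μ}.Nonempty := by
  have hid : Tendsto (fun t : ℝ => t) (𝓝[>] 0) (𝓝 0) := tendsto_id.mono_left nhdsWithin_le_nhds
  have hpos : ∀ᶠ t in 𝓝[>] (0 : ℝ), 0 < t := eventually_mem_nhdsWithin
  have hle : ∀ i ∈ θ.Kact zb, ⟪θ.a i, w⟫ ≤ μ := by
    intro i hi
    refine ge_of_tendsto h ?_
    filter_upwards [hpos] with t ht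
    rw [le_div_iff₀ ht]
    have e1 : θ.val zb = ⟪θ.a i, zb⟫ - θ.al i := hi
    have e2 := θ.le_val (zb + t • w) i
    rw [inner_add_right, inner_smul_right] at e2
    linarith
  refine ⟨hle, ?_⟩
  by_contra hcon
  have hev : ∀ᶠ t in 𝓝[>] (0 : ℝ), ∀ i : Fin θ.l,
      (⟪θ.a i, zb + t • w⟫ - θ.al i - θ.val zb) < θ.val (zb + t • w) - θ.val zb := by
    rw [eventually_all]
    intro i
    by_cases hi : i ∈ θ.Kact zb
    · have hlt : ⟪θ.a i, w⟫ < μ := lt_of_le_of_ne (hle i hi) fun he => hcon ⟨i, hi, he⟩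
      filter_upwards [hpos, h.eventually_const_lt hlt] with t ht h2
      rw [lt_div_iff₀ ht] at h2
      have e1 : θ.val zb = ⟪θ.a i, zb⟫ - θ.al i := hi
      rw [inner_add_right, inner_smul_right]
      linarith
    · have h1 := θ.le_val zb i
      have h2 : θ.val zb ≠ ⟪θ.a i, zb⟫ - θ.al i := hi
      have h3 := lt_of_le_of_ne h1 h2.symm
      have l1 : Tendsto (fun t : ℝ => t * ((θ.val (zb + t • w) - θ.val zb) / t)) (𝓝[>] 0)
        (𝓝 (0 * μ)) := hid.mul h
      have l2 : Tendsto (fun t : ℝ => ⟪θ.a i, zb + t • w⟫ - θ.al i - θ.val zb) (𝓝[>] 0)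
          (𝓝 (⟪θ.a i, zb⟫ - θ.al i - θ.val zb)) := by
        have hc : Continuous fun t : ℝ => ⟪θ.a i, zb + t • w⟫ - θ.al i - θ.val zb := by fun_prop
        have := (hc.tendsto 0).mono_left (nhdsWithin_le_nhds (s := Ioi 0))
        simpa using this
      filter_upwards [l2.eventually_lt l1 (by linarith), hpos] with t ht hp
      rwa [mul_div_cancel₀ _ hp.ne'] at ht
  obtain ⟨t, ht⟩ := hev.exists
  obtain ⟨i, hi⟩ := θ.exists_val (zb + t • w)
  have := ht i
  linarith

theorem tcone_K {m : ℕ} {θ : CPWL m} {zb w : Ev m} (h : w ∈ tcone θ.dom zb) :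
    ∀ j ∈ θ.Iact zb, ⟪θ.d j, w⟫ ≤ 0 := by
  intro j hj
  obtain ⟨z, c, hz, hc, -, hl⟩ := h
  have := (tendsto_const_nhds (x := θ.d j)).inner (𝕜 := ℝ) hl
  refine le_of_tendsto this (Eventually.of_forall fun k => ?_)
  rw [inner_smul_right, inner_sub_right]
  have e1 : ⟪θ.d j, zb⟫ = θ.be j := hj
  have e2 := hz k j
  exact mul_nonpos_of_nonneg_of_nonpos (hc k) (by linarith)

theorem path_lim {n : ℕ} {u s : Ev n} {e : ℝ → Ev n}
    (he : Tendsto (fun t : ℝ => (t ^ 2)⁻¹ • e t) (𝓝[>] 0) (𝓝 0)) :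
    Tendsto (fun t : ℝ => t⁻¹ • (t • u + t ^ 2 • s + e t)) (𝓝[>] 0) (𝓝 u) := by
  have hid : Tendsto (fun t : ℝ => t) (𝓝[>] 0) (𝓝 0) := tendsto_id.mono_left nhdsWithin_le_nhds
  have hpos : ∀ᶠ t in 𝓝[>] (0 : ℝ), 0 < t := eventually_mem_nhdsWithin
  have h1 : Tendsto (fun t : ℝ => u + t • s + t • ((t ^ 2)⁻¹ • e t)) (𝓝[>] 0)
      (𝓝 (u + (0 : ℝ) • s + (0 : ℝ) • (0 : Ev n))) :=
    ((hid.smul_const s).const_add u).add (hid.smul he)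
  simp only [zero_smul, add_zero] at h1
  refine h1.congr' ?_
  filter_upwards [hpos] with t ht
  simp only [smul_add, smul_smul]
  congr 1
  · congr 1
    · rw [inv_mul_cancel₀ ht.ne', one_smul]
    · congr 1; field_simp
  · congr 1; field_simp

/-- second order expansion along a parabolic path. -/
theorem path_expand {n : ℕ} {F : Type*} [NormedAddCommGroup F] [NormedSpace ℝ F] {f : Ev n → F}
    {x u : Ev n} {B : Ev n →L[ℝ] Ev n →L[ℝ] F}
    (hB : HasFDerivAt (fderiv ℝ f) B x) {s : Ev n} {e : ℝ → Ev n}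
    (he : Tendsto (fun t : ℝ => (t ^ 2)⁻¹ • e t) (𝓝[>] 0) (𝓝 0))
    (hseg : ∀ᶠ t in 𝓝[>] (0 : ℝ), ∀ τ ∈ Icc (0 : ℝ) 1,
      DifferentiableAt ℝ f (x + τ • (t • u + t ^ 2 • s + e t))) :
    Tendsto (fun t : ℝ => (t ^ 2)⁻¹ • (f (x + (t • u + t ^ 2 • s + e t)) - f x - t • fderiv ℝ f x u))
      (𝓝[>] 0) (𝓝 (fderiv ℝ f x s + (1 / 2 : ℝ) • B u u)) := by
  have hpos : ∀ᶠ t in 𝓝[>] (0 : ℝ), 0 < t := eventually_mem_nhdsWithin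
  have h1 := path_taylor hB (path_lim he) hseg
  have h2 := ((fderiv ℝ f x).continuous.tendsto 0).comp he
  rw [map_zero] at h2
  have h3 := (h2.const_add (fderiv ℝ f x s)).add h1
  rw [add_zero] at h3
  refine h3.congr' ?_
  filter_upwards [hpos] with t ht
  simp only [Function.comp, map_add, map_smul, smul_sub, smul_add, smul_smul]
  rw [inv_mul_cancel₀ (by positivity : t ^ 2 ≠ 0), one_smul]
  abel

theorem stmt14_aux {n m : ℕ} (θ : CPWL m) (φ₀ : Ev n → ℝ) (Φ : Ev n → Ev m) (xb : Ev n)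
    (hphi : DifferentiableAt ℝ φ₀ xb) (hPhi : DifferentiableAt ℝ Φ xb)
    (hphi2 : DifferentiableAt ℝ (gradient φ₀) xb)
    (hPhi2 : DifferentiableAt ℝ (fderiv ℝ Φ) xb)
    (hdom : Φ xb ∈ θ.dom)
    (hqc : {v : Ev m | (∀ z ∈ θ.dom, ⟪v, z - Φ xb⟫ ≤ 0) ∧ adjD Φ xb v = 0} = {0})
    (hmin : LocalMin φ₀ Φ θ xb) :
    (LamCom φ₀ Φ θ xb).Nonempty ∧
    ∀ u : Ev n,
      (∃ v ∈ LamCom φ₀ Φ θ xb, fderiv ℝ Φ xb u ∈ θ.crit (Φ xb) v) →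
      ¬ ∀ v ∈ LamCom φ₀ Φ θ xb, ⟪HessOp φ₀ Φ v xb u, u⟫ < 0 := by
  have hid : Tendsto (fun t : ℝ => t) (𝓝[>] 0) (𝓝 0) := tendsto_id.mono_left nhdsWithin_le_nhds
  have hpos : ∀ᶠ t in 𝓝[>] (0 : ℝ), 0 < t := eventually_mem_nhdsWithin
  have hKdom : ∀ z ∈ θ.dom, ∀ j ∈ θ.Iact (Φ xb), ⟪θ.d j, z - Φ xb⟫ ≤ 0 := by
    intro z hz j hj
    have e1 : ⟪θ.d j, Φ xb⟫ = θ.be j := hj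
    have e2 := hz j
    rw [inner_sub_right]; linarith
  have hqc' : ∀ v : Ev m, (∀ z ∈ θ.dom, ⟪v, z - Φ xb⟫ ≤ 0) → adjD Φ xb v = 0 → v = 0 := by
    intro v h1 h2
    have : v ∈ ({0} : Set (Ev m)) := by rw [← hqc]; exact ⟨h1, h2⟩
    exact this
  have hrob := robinson (fderiv ℝ Φ xb) θ.d (θ.Iact (Φ xb))
    (fun v hv hA => hqc' v (fun z hz => hv _ (hKdom z hz)) hA)
  refine ⟨?_, ?_⟩
  · have hc := core hPhi2 hdom hmin hrob 0 (by simp) 0 (by simp) (gradient φ₀ xb) 0 0 (by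
      intro s e he
      have hpath : Tendsto (fun t : ℝ => (t ^ 2)⁻¹ • (t • (0 : Ev n) + t ^ 2 • s + e t)) (𝓝[>] 0)
          (𝓝 s) := by
        have := he.const_add s
        rw [add_zero] at this
        refine this.congr' ?_
        filter_upwards [hpos] with t ht
        rw [smul_zero, zero_add, smul_add, smul_smul, inv_mul_cancel₀ (by positivity), one_smul]
      refine ⟨?_, ?_⟩
      · simpa using first_path hPhi hpath
      · simpa [inner_gradient] using first_path hphi hpath)
    obtain ⟨v, h1, h2, -⟩ := lp_dual (fderiv ℝ Φ xb) θ.d _ θ.a _ (by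
        obtain ⟨i, hi⟩ := θ.exists_val (Φ xb)
        exact ⟨i, hi, by simp⟩) (gradient φ₀ xb) 0 0
      (fun y => by
        obtain ⟨s, k, hk, hy⟩ := hrob y
        exact ⟨s, k, fun j hj => hk j hj.1, hy⟩) hc
    exact ⟨v, h1, subdiff_of hdom (fun j hj => hj.1) (fun i hi => hi.1) h2⟩
  · rintro u ⟨v₀, hv₀, hcr⟩ hneg
    by_cases hA : fderiv ℝ Φ xb = 0
    · -- degenerate case
      have hadj : ∀ v, adjD Φ xb v = 0 := by intro v; rw [adjD, hA]; simp
      have hg : gradient φ₀ xb = 0 := by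
        have := hv₀.1
        rwa [hadj, add_zero] at this
      have hfd : fderiv ℝ φ₀ xb = 0 := by
        ext y; rw [← inner_gradient, hg]; simp
      have hxl : Tendsto (fun t : ℝ => xb + t • u) (𝓝[>] 0) (𝓝 xb) := by
        simpa using (hid.smul_const u).const_add xb
      have hΦl : Tendsto (fun t : ℝ => Φ (xb + t • u)) (𝓝[>] 0) (𝓝 (Φ xb)) :=
        hPhi.continuousAt.tendsto.comp hxl
      have hφl : Tendsto (fun t : ℝ => φ₀ (xb + t • u)) (𝓝[>] 0) (𝓝 (φ₀ xb)) :=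
        hphi.continuousAt.tendsto.comp hxl
      have hfeas : ∀ᶠ t in 𝓝[>] (0 : ℝ), Φ (xb + t • u) ∈ θ.dom := by
        have : ∀ᶠ t in 𝓝[>] (0 : ℝ), ∀ j, ⟪θ.d j, Φ (xb + t • u)⟫ ≤ θ.be j := by
          rw [eventually_all]
          intro j
          by_cases hj : j ∈ θ.Iact (Φ xb)
          · have hd0 : θ.d j = 0 := hqc' _ (fun z hz => hKdom z hz j hj) (hadj _)
            have e1 : ⟪θ.d j, Φ xb⟫ = θ.be j := hj
            rw [hd0] at e1 ⊢
            simp only [inner_zero_left] at e1 ⊢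
            exact Eventually.of_forall fun _ => e1.le
          · have h1 := lt_of_le_of_ne (hdom j) hj
            have h2 := (tendsto_const_nhds (x := θ.d j)).inner (𝕜 := ℝ) hΦl
            filter_upwards [h2.eventually_lt_const h1] with t ht using ht.le
        exact this
      have hval : ∀ᶠ t in 𝓝[>] (0 : ℝ), ∀ i : Fin θ.l,
          φ₀ (xb + t • u) + (⟪θ.a i, Φ (xb + t • u)⟫ - θ.al i) < φ₀ xb + θ.val (Φ xb) := by
        rw [eventually_all]
        intro i
        by_cases hi : i ∈ θ.Kact (Φ xb)
        · have e1 : θ.val (Φ xb) = ⟪θ.a i, Φ xb⟫ - θ.al i := hi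
          have hLam : θ.a i ∈ LamCom φ₀ Φ θ xb := by
            refine ⟨by rw [hadj, hg, add_zero], subdiff_of hdom (I := ∅) (K := {i}) (by simp)
              (by simpa using hi) fun z _ => ⟨i, rfl, le_rfl⟩⟩
          have hn := hneg _ hLam
          have hB := hess_fderiv hn
          have hf := lagr_hasFDerivAt (θ.a i) hphi hPhi
          have hlim : Tendsto (fun t : ℝ => t⁻¹ • (t • u)) (𝓝[>] 0) (𝓝 u) := by
            refine tendsto_const_nhds.congr' ?_
            filter_upwards [hpos] with t ht
            rw [smul_smul, inv_mul_cancel₀ ht.ne', one_smul]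
          have hseg := diff_seg hf.differentiableAt hB (Or.inr (hess_ne hn)) hlim
          have hT := path_taylor hB hlim hseg
          rw [hf.fderiv, hfd, hA] at hT
          simp only [ContinuousLinearMap.comp_apply, Jd_apply, ContinuousLinearMap.comp_zero,
            add_zero, ContinuousLinearMap.zero_apply, sub_zero, smul_eq_mul] at hT
          have h0 : (1 / 2 : ℝ) * ⟪HessOp φ₀ Φ (θ.a i) xb u, u⟫ < 0 := by linarith
          filter_upwards [hT.eventually_lt_const h0, hpos] with t ht hp
          rw [real_inner_comm, real_inner_comm (θ.a i)] at ht
          by_contra hc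
          push Not at hc
          have : 0 ≤ (t ^ 2)⁻¹ * (φ₀ (xb + t • u) + ⟪θ.a i, Φ (xb + t • u)⟫ -
              (φ₀ xb + ⟪θ.a i, Φ xb⟫)) := by
            apply mul_nonneg (by positivity)
            linarith
          linarith
        · have h1 := θ.le_val (Φ xb) i
          have h2 : θ.val (Φ xb) ≠ ⟪θ.a i, Φ xb⟫ - θ.al i := hi
          have h3 := lt_of_le_of_ne h1 h2.symm
          have h4 := hφl.add (((tendsto_const_nhds (x := θ.a i)).inner (𝕜 := ℝ) hΦl).sub_const
            (θ.al i))
          exact h4.eventually_lt_const (by linarith)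
      obtain ⟨t, h1, h2, h3⟩ :=
        (hfeas.and (hval.and (hxl.eventually (localmin_real hdom hmin)))).exists
      have h4 := h3 h1
      obtain ⟨i, hi⟩ := θ.exists_val (Φ (xb + t • u))
      have h5 := h2 i
      rw [hi] at h4
      linarith
    · -- main case
      have hBΦ := hPhi2.hasFDerivAt
      have hBφ := grad_fderiv hphi2.hasFDerivAt
      set BΦ := fderiv ℝ (fderiv ℝ Φ) xb
      set Bφ := (Jd n).comp (fderiv ℝ (gradient φ₀) xb)
      have hn₀ := hneg _ hv₀
      have hf₀ := lagr_hasFDerivAt v₀ hphi hPhi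
      have hsegs : ∀ h : ℝ → Ev n, Tendsto (fun t : ℝ => t⁻¹ • h t) (𝓝[>] 0) (𝓝 u) →
          ∀ᶠ t in 𝓝[>] (0 : ℝ), ∀ τ ∈ Icc (0 : ℝ) 1,
            DifferentiableAt ℝ Φ (xb + τ • h t) ∧ DifferentiableAt ℝ φ₀ (xb + τ • h t) := by
        intro h hlim
        filter_upwards [diff_seg hPhi hBΦ (Or.inl hA) hlim,
          diff_seg hf₀.differentiableAt (hess_fderiv hn₀) (Or.inr (hess_ne hn₀)) hlim]
          with t h1 h2 τ hτ
        refine ⟨h1 τ hτ, ?_⟩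
        have h3 := (h2 τ hτ).sub ((h1 τ hτ).inner ℝ (differentiableAt_const v₀))
        refine h3.congr_of_eventuallyEq (Eventually.of_forall fun y => ?_)
        simp
      have hμ : ⟪gradient φ₀ xb, u⟫ = -⟪v₀, fderiv ℝ Φ xb u⟫ := by
        have h1 := congrArg (fun y => ⟪y, u⟫) hv₀.1
        simp only [inner_add_left, inner_zero_left, adjD,
          ContinuousLinearMap.adjoint_inner_left] at h1
        linarith
      obtain ⟨hK1, hK2⟩ := crit_K2 hcr.2
      have hc := core hPhi2 hdom hmin hrob u (tcone_K hcr.1) ⟪v₀, fderiv ℝ Φ xb u⟫ hK1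
        (gradient φ₀ xb) ((1 / 2 : ℝ) • BΦ u u) ((1 / 2 : ℝ) • Bφ u u) (by
        intro s e he
        have hs := hsegs _ (path_lim (u := u) (s := s) he)
        refine ⟨path_expand hBΦ he (hs.mono fun t ht τ hτ => (ht τ hτ).1), ?_⟩
        have := path_expand hBφ he (hs.mono fun t ht τ hτ => (ht τ hτ).2)
        rw [inner_gradient]
        refine this.congr fun t => ?_
        rw [← inner_gradient, hμ, smul_eq_mul, smul_eq_mul]
        ring)
      obtain ⟨v, h1, h2, h3⟩ := lp_dual (fderiv ℝ Φ xb) θ.d _ θ.a _ hK2 (gradient φ₀ xb) _ _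
        (fun y => by
          obtain ⟨s, k, hk, hy⟩ := hrob y
          exact ⟨s, k, fun j hj => hk j hj.1, hy⟩) hc
      have hv : v ∈ LamCom φ₀ Φ θ xb :=
        ⟨h1, subdiff_of hdom (fun j hj => hj.1) (fun i hi => hi.1) h2⟩
      have hn := hneg _ hv
      have hf := lagr_hasFDerivAt v hphi hPhi
      have hlim : Tendsto (fun t : ℝ => t⁻¹ • (t • u)) (𝓝[>] 0) (𝓝 u) := by
        refine tendsto_const_nhds.congr' ?_
        filter_upwards [hpos] with t ht
        rw [smul_smul, inv_mul_cancel₀ ht.ne', one_smul]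
      have hs := hsegs _ hlim
      have t1 := path_taylor hBΦ hlim (hs.mono fun t ht τ hτ => (ht τ hτ).1)
      have t2 := path_taylor hBφ hlim (hs.mono fun t ht τ hτ => (ht τ hτ).2)
      have t3 := path_taylor (hess_fderiv hn) hlim (hs.mono fun t ht τ hτ =>
        (lagr_hasFDerivAt v (ht τ hτ).2 (ht τ hτ).1).differentiableAt)
      have t4 := t2.add ((tendsto_const_nhds (x := v)).inner (𝕜 := ℝ) t1)
      have t5 := tendsto_nhds_unique t3 (t4.congr fun t => by
        rw [hf.fderiv]
        simp only [inner_smul_right, inner_sub_right, smul_eq_mul, ContinuousLinearMap.add_apply,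
          ContinuousLinearMap.comp_apply, innerSL_apply_apply]
        rw [real_inner_comm v, real_inner_comm v]
        ring)
      rw [← t5] at h3
      simp only [ContinuousLinearMap.comp_apply, Jd_apply, smul_eq_mul] at h3
      linarith

theorem stmt14 {n m : ℕ} (θ : CPWL m) (φ₀ : Ev n → ℝ) (Φ : Ev n → Ev m) (xb : Ev n)
    (hphi : DifferentiableAt ℝ φ₀ xb) (hPhi : DifferentiableAt ℝ Φ xb)
    (hphi2 : DifferentiableAt ℝ (gradient φ₀) xb)
    (hPhi2 : DifferentiableAt ℝ (fderiv ℝ Φ) xb)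
    (hdom : Φ xb ∈ θ.dom)
    (hqc : {v : Ev m | (∀ z ∈ θ.dom, ⟪v, z - Φ xb⟫ ≤ 0) ∧ adjD Φ xb v = 0} = {0})
    (hmin : LocalMin φ₀ Φ θ xb) :
    (LamCom φ₀ Φ θ xb).Nonempty ∧
    ∀ u : Ev n, u ≠ 0 →
      (∃ v ∈ LamCom φ₀ Φ θ xb, fderiv ℝ Φ xb u ∈ θ.crit (Φ xb) v) →
      (0 : EReal) ≤ ⨆ v ∈ LamCom φ₀ Φ θ xb, ((⟪HessOp φ₀ Φ v xb u, u⟫ : ℝ) : EReal) := by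
  obtain ⟨h1, h2⟩ := stmt14_aux θ φ₀ Φ xb hphi hPhi hphi2 hPhi2 hdom hqc hmin
  refine ⟨h1, fun u _ hv => ?_⟩
  have h3 := h2 u hv
  push Not at h3
  obtain ⟨v, hv, h4⟩ := h3
  refine le_trans ?_ (le_iSup₂ (f := fun v (_ : v ∈ LamCom φ₀ Φ θ xb) =>
    ((⟪HessOp φ₀ Φ v xb u, u⟫ : ℝ) : EReal)) v hv)
  exact_mod_cast h4
end
end

section
/- Let θ be a CPWL function, let φ₀ and Φ be twice continuously differentiable around x̄ in the composite optimization setting with v̄ ∈ Λ_com(x̄). Then the following assertions are equivalent: (i) the KKT solution map S_KKT is robustly isolatedly calm at ((0,0),(x̄,v̄)) and x̄ is a local minimizer of φ₀ + θ∘Φ; (ii) ⟨∇²ₓₓL(x̄,v̄)u, u⟩ > 0 for every u ≠ 0 with ∇Φ(x̄)u ∈ 𝒦(z̄,v̄), and Λ_com(x̄) = {v̄}; (iii) Λ_com(x̄) = {v̄}, x̄ is a local minimizer of φ₀ + θ∘Φ, and v̄ is a noncritical multiplier; (iv) S_KKT is isolatedly calm at ((0,0),(x̄,v̄)) and x̄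 is a local minimizer of φ₀ + θ∘Φ. -/
open Filter Topology Set RealInnerProductSpace

noncomputable section

lemma farkas_lin {V ι : Type*} [AddCommGroup V] [Module ℝ V] [DecidableEq ι] (s : Finset ι) :
    ∀ (g : ι → V →ₗ[ℝ] ℝ) (b : V →ₗ[ℝ] ℝ), (∀ x, (∀ i ∈ s, g i x ≤ 0) → b x ≤ 0) →
      ∃ c : ι → ℝ, (∀ i, 0 ≤ c i) ∧ ∀ x, b x = ∑ i ∈ s, c i * g i x := by
  induction s using Finset.induction_on with
  | empty =>
    intro g b h
    refine ⟨0, fun _ => le_rfl, fun x => ?_⟩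
    have h1 := h x (by simp)
    have h2 := h (-x) (by simp)
    simp at h2 ⊢
    linarith
  | insert j s hj ih =>
    intro g b h
    by_cases hb : ∀ x, (∀ i ∈ s, g i x ≤ 0) → b x ≤ 0
    · obtain ⟨c, hc, hcb⟩ := ih g b hb
      refine ⟨fun i => if i = j then 0 else c i, fun i => ?_, fun x => ?_⟩
      · dsimp only; split_ifs
        · exact le_rfl
        · exact hc i
      · rw [Finset.sum_insert hj, hcb x]
        simp only [if_true, zero_mul, zero_add]
        refine Finset.sum_congr rfl fun i hi => ?_
        have : i ≠ j := fun hij => hj (hij ▸ hi)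
        simp [this]
    · push Not at hb
      obtain ⟨x1, hx1, hbx1⟩ := hb
      have hgj : 0 < g j x1 := by
        by_contra hcon
        push Not at hcon
        have := h x1 (by
          intro i hi
          rcases Finset.mem_insert.1 hi with rfl | hi
          · exact hcon
          · exact hx1 i hi)
        linarith
      set x0 := (g j x1)⁻¹ • x1 with hx0
      have hinv : 0 < (g j x1)⁻¹ := inv_pos.2 hgj
      have e1 : g j x0 = 1 := by simp [hx0, hgj.ne']
      have e2 : ∀ i ∈ s, g i x0 ≤ 0 := fun i hi => by
        simp only [hx0, map_smul, smul_eq_mul]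
        exact mul_nonpos_of_nonneg_of_nonpos hinv.le (hx1 i hi)
      have e3 : 0 < b x0 := by
        simp only [hx0, map_smul, smul_eq_mul]
        positivity
      obtain ⟨c, hc, hcb⟩ := ih (fun i => g i - (g i x0) • g j) (b - (b x0) • g j) (by
        intro x hx
        have := h (x - (g j x) • x0) (by
          intro i hi
          rcases Finset.mem_insert.1 hi with rfl | hi
          · simp [e1]
          · have := hx i hi
            simp at this ⊢
            linarith)
        simp at this ⊢
        linarith)
      refine ⟨fun i => if i = j then b x0 - ∑ i ∈ s, c i * g i x0 else c i, fun i => ?_,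
        fun x => ?_⟩
      · dsimp only; split_ifs
        · have : ∑ i ∈ s, c i * g i x0 ≤ 0 := Finset.sum_nonpos fun i hi =>
            mul_nonpos_of_nonneg_of_nonpos (hc i) (e2 i hi)
          linarith
        · exact hc i
      · rw [Finset.sum_insert hj]
        simp only [if_true]
        have h1 : ∑ i ∈ s, (if i = j then b x0 - ∑ i ∈ s, c i * g i x0 else c i) * g i x
            = ∑ i ∈ s, c i * g i x := by
          refine Finset.sum_congr rfl fun i hi => ?_
          have : i ≠ j := fun hij => hj (hij ▸ hi)
          simp [this]
        rw [h1]
        have h2 := hcb x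
        simp only [LinearMap.sub_apply, LinearMap.smul_apply, smul_eq_mul, mul_sub,
          Finset.sum_sub_distrib] at h2
        have h3 : ∑ i ∈ s, c i * (g i x0 * g j x) = (∑ i ∈ s, c i * g i x0) * g j x := by
          rw [Finset.sum_mul]
          exact Finset.sum_congr rfl fun i _ => by ring
        rw [h3] at h2
        linarith

namespace CPWL
variable {m : ℕ} (θ : CPWL m)

lemma val_ge (z : Ev m) (i : Fin θ.l) : ⟪θ.a i, z⟫ - θ.al i ≤ θ.val z :=
  le_ciSup (f := fun i : Fin θ.l => (⟪θ.a i, z⟫ - θ.al i)) (Set.finite_range _).bddAbove i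

lemma exists_Kact (z : Ev m) : ∃ i, i ∈ θ.Kact z := by
  haveI : Nonempty (Fin θ.l) := ⟨⟨0, θ.hl⟩⟩
  obtain ⟨i, hi⟩ := exists_eq_ciSup_of_finite (f := fun i : Fin θ.l => (⟪θ.a i, z⟫ - θ.al i))
  exact ⟨i, hi.symm⟩

lemma val_le (z : Ev m) (c : ℝ) (h : ∀ i, ⟪θ.a i, z⟫ - θ.al i ≤ c) : θ.val z ≤ c := by
  obtain ⟨i, hi⟩ := θ.exists_Kact z
  have : θ.val z = _ := hi
  rw [this]; exact h i

lemma val_cont : Continuous θ.val := by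
  haveI : Nonempty (Fin θ.l) := ⟨⟨0, θ.hl⟩⟩
  have : θ.val = fun z => Finset.univ.sup' Finset.univ_nonempty
      (fun i : Fin θ.l => (⟪θ.a i, z⟫ - θ.al i)) := by
    funext z
    rw [Finset.sup'_univ_eq_ciSup]; rfl
  rw [this]
  exact Continuous.finset_sup'_apply _ fun i _ => by fun_prop

lemma dom_closed : IsClosed θ.dom := by
  have : θ.dom = ⋂ i, {z | ⟪θ.d i, z⟫ ≤ θ.be i} := by ext; simp [dom]
  rw [this]
  exact isClosed_iInter fun i => isClosed_le (by fun_prop) (by fun_prop)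

lemma ev_Kact (z : Ev m) : ∀ᶠ z' in 𝓝 z, θ.Kact z' ⊆ θ.Kact z := by
  have : ∀ i, ∀ᶠ z' in 𝓝 z, i ∈ θ.Kact z' → i ∈ θ.Kact z := by
    intro i
    by_cases hi : i ∈ θ.Kact z
    · exact Eventually.of_forall fun _ _ => hi
    · have h1 : ⟪θ.a i, z⟫ - θ.al i < θ.val z :=
        lt_of_le_of_ne (θ.val_ge z i) fun h => hi h.symm
      have hc : Continuous fun z => ⟪θ.a i, z⟫ - θ.al i := by fun_prop
      filter_upwards [(hc.tendsto z).eventually_lt (θ.val_cont.tendsto z) h1] with z' h2 h3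
      exact absurd h3 h2.ne'
  filter_upwards [eventually_all.2 this] with z' h i hi using h i hi

lemma ev_Iact (z : Ev m) (hz : z ∈ θ.dom) : ∀ᶠ z' in 𝓝 z, θ.Iact z' ⊆ θ.Iact z := by
  have : ∀ i, ∀ᶠ z' in 𝓝 z, i ∈ θ.Iact z' → i ∈ θ.Iact z := by
    intro i
    by_cases hi : i ∈ θ.Iact z
    · exact Eventually.of_forall fun _ _ => hi
    · have h1 : ⟪θ.d i, z⟫ < θ.be i := lt_of_le_of_ne (hz i) hi
      have hc : Continuous fun z => ⟪θ.d i, z⟫ := by fun_prop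
      filter_upwards [(hc.tendsto z).eventually_lt_const h1] with z' h2 h3
      exact absurd h3 h2.ne
  filter_upwards [eventually_all.2 this] with z' h i hi using h i hi

lemma ev_dom (z : Ev m) (hz : z ∈ θ.dom) :
    ∀ᶠ z' in 𝓝 z, (∀ i ∈ θ.Iact z, ⟪θ.d i, z' - z⟫ ≤ 0) → z' ∈ θ.dom := by
  have : ∀ i, ∀ᶠ z' in 𝓝 z, (i ∈ θ.Iact z → ⟪θ.d i, z' - z⟫ ≤ 0) → ⟪θ.d i, z'⟫ ≤ θ.be i := by
    intro i
    by_cases hi : i ∈ θ.Iact z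
    · refine Eventually.of_forall fun z' h => ?_
      have h1 := h hi
      have h2 : ⟪θ.d i, z⟫ = θ.be i := hi
      rw [inner_sub_right] at h1
      linarith
    · have h1 : ⟪θ.d i, z⟫ < θ.be i := lt_of_le_of_ne (hz i) hi
      have hc : Continuous fun z => ⟪θ.d i, z⟫ := by fun_prop
      filter_upwards [(hc.tendsto z).eventually_lt_const h1] with z' h2 h3
      exact h2.le
  filter_upwards [eventually_all.2 this] with z' h h1 i using h i (h1 i)

lemma ev_val (z : Ev m) :
    ∀ᶠ z' in 𝓝 z, ∀ c, (∀ i ∈ θ.Kact z, ⟪θ.a i, z' - z⟫ ≤ c) → θ.val z' ≤ θ.val z + c := by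
  filter_upwards [θ.ev_Kact z] with z' h c hc
  obtain ⟨i, hi⟩ := θ.exists_Kact z'
  have h1 := hc i (h hi)
  have h2 : θ.val z = _ := h hi
  have h3 : θ.val z' = _ := hi
  rw [inner_sub_right] at h1
  linarith

/-- polyhedral description of the critical cone -/
def Kc (z v : Ev m) : Set (Ev m) :=
  {w | (∀ i ∈ θ.Iact z, ⟪θ.d i, w⟫ ≤ 0) ∧ ∀ i ∈ θ.Kact z, ⟪θ.a i, w⟫ ≤ ⟪v, w⟫}

lemma Kc_add {z v w w' : Ev m} (h : w ∈ θ.Kc z v) (h' : w' ∈ θ.Kc z v) : w + w' ∈ θ.Kc z v := by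
  refine ⟨fun i hi => ?_, fun i hi => ?_⟩
  · have h1 := h.1 i hi; have h2 := h'.1 i hi
    rw [inner_add_right]; linarith
  · have h1 := h.2 i hi; have h2 := h'.2 i hi
    rw [inner_add_right, inner_add_right]; linarith

lemma Kc_smul {z v w : Ev m} (h : w ∈ θ.Kc z v) {t : ℝ} (ht : 0 ≤ t) : t • w ∈ θ.Kc z v := by
  refine ⟨fun i hi => ?_, fun i hi => ?_⟩
  · have h1 := h.1 i hi
    rw [inner_smul_right]; exact mul_nonpos_of_nonneg_of_nonpos ht h1
  · have h1 := h.2 i hi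
    rw [inner_smul_right, inner_smul_right]; exact mul_le_mul_of_nonneg_left h1 ht

lemma Kc_zero {z v : Ev m} : (0 : Ev m) ∈ θ.Kc z v := by simp [Kc]

lemma ev_Kc {z v : Ev m} (hv : v ∈ θ.subdiff z) :
    ∀ᶠ z' in 𝓝 z, z' - z ∈ θ.Kc z v → z' ∈ θ.dom ∧ θ.val z' = θ.val z + ⟪v, z' - z⟫ := by
  filter_upwards [θ.ev_dom z hv.1, θ.ev_val z] with z' h1 h2 h3
  have h4 := h1 h3.1
  refine ⟨h4, le_antisymm (h2 _ h3.2) ?_⟩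
  have := hv.2 z' h4
  linarith

lemma tendsto_ray (z w : Ev m) : Tendsto (fun t : ℝ => z + t • w) (𝓝[>] 0) (𝓝 z) := by
  have : Continuous fun t : ℝ => z + t • w := by fun_prop
  simpa using (this.tendsto 0).mono_left nhdsWithin_le_nhds

lemma crit_eq {z v : Ev m} (hv : v ∈ θ.subdiff z) : θ.crit z v = θ.Kc z v := by
  ext w
  constructor
  · rintro ⟨⟨zk, c, hz, hc, hz1, hz2⟩, h2⟩
    refine ⟨fun i hi => ?_, fun i hi => ?_⟩
    · have hcont : Continuous fun w => ⟪θ.d i, w⟫ := by fun_prop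
      refine le_of_tendsto ((hcont.tendsto w).comp hz2) (Eventually.of_forall fun k => ?_)
      have h1 := hz k i
      have h3 : ⟪θ.d i, z⟫ = θ.be i := hi
      simp only [Function.comp, inner_smul_right, inner_sub_right]
      exact mul_nonpos_of_nonneg_of_nonpos (hc k) (by linarith)
    · refine ge_of_tendsto h2 ?_
      filter_upwards [self_mem_nhdsWithin] with t ht
      have ht : 0 < t := ht
      rw [le_div_iff₀ ht]
      have h1 := θ.val_ge (z + t • w) i
      have h3 : θ.val z = _ := hi
      rw [inner_add_right, inner_smul_right] at h1
      linarith
  · intro hw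
    have hev := (tendsto_ray z w).eventually (θ.ev_Kc hv)
    have hev2 : ∀ᶠ t : ℝ in 𝓝[>] 0, z + t • w ∈ θ.dom ∧
        θ.val (z + t • w) = θ.val z + t * ⟪v, w⟫ := by
      filter_upwards [hev, self_mem_nhdsWithin] with t h1 ht
      have h2 := h1 (by simpa using θ.Kc_smul hw (le_of_lt ht))
      simpa [inner_smul_right] using h2
    refine ⟨?_, ?_⟩
    · have hseq : Tendsto (fun k : ℕ => ((k : ℝ) + 1)⁻¹) atTop (𝓝[>] 0) := by
        refine tendsto_nhdsWithin_iff.2 ⟨?_, Eventually.of_forall fun k => ?_⟩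
        · simpa [one_div] using tendsto_one_div_add_atTop_nhds_zero_nat (𝕜 := ℝ)
        · show (0:ℝ) < _
          positivity
      obtain ⟨N, hN⟩ := eventually_atTop.1 (hseq.eventually hev2)
      refine ⟨fun k => z + (((k + N : ℕ) : ℝ) + 1)⁻¹ • w, fun k => ((k + N : ℕ) : ℝ) + 1,
        fun k => (hN (k + N) (by omega)).1, fun k => by positivity, ?_, ?_⟩
      · exact (tendsto_ray z w).comp (hseq.comp (tendsto_add_atTop_nat N))
      · have : ∀ k : ℕ, (((k + N : ℕ) : ℝ) + 1) • (z + (((k + N : ℕ) : ℝ) + 1)⁻¹ • w - z) = w := by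
          intro k
          rw [add_sub_cancel_left, smul_smul, mul_inv_cancel₀ (by positivity), one_smul]
        simp only [this]
        exact tendsto_const_nhds
    · refine tendsto_const_nhds.congr' ?_
      filter_upwards [hev2, self_mem_nhdsWithin] with t h1 ht
      have ht : 0 < t := ht
      rw [h1.2]
      field_simp
      ring

/-- Farkas for the critical cone composed with a linear map -/
lemma Kc_farkas {E : Type*} [AddCommGroup E] [Module ℝ E] {z v : Ev m} (A : E →ₗ[ℝ] Ev m)
    (b : E →ₗ[ℝ] ℝ) (hb : ∀ u, A u ∈ θ.Kc z v → b u ≤ 0) :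
    ∃ w : Ev m, (∀ u, b u = ⟪w, A u⟫) ∧ ∃ (mu : Fin θ.p → ℝ) (la : Fin θ.l → ℝ),
      (∀ i, 0 ≤ mu i) ∧ (∀ i, 0 ≤ la i) ∧ (∀ i, i ∉ θ.Iact z → mu i = 0) ∧
      (∀ i, i ∉ θ.Kact z → la i = 0) ∧
      w = ∑ i, mu i • θ.d i + ∑ i, la i • (θ.a i - v) := by
  classical
  let f : (Fin θ.p ⊕ Fin θ.l) → Ev m := Sum.elim
    (fun i => if i ∈ θ.Iact z then θ.d i else 0) (fun i => if i ∈ θ.Kact z then θ.a i - v else 0)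
  obtain ⟨c, hc, hcb⟩ := farkas_lin Finset.univ (fun i => (innerₗ (Ev m) (f i)) ∘ₗ A) b (by
    intro x hx
    refine hb x ⟨fun i hi => ?_, fun i hi => ?_⟩
    · have := hx (Sum.inl i) (Finset.mem_univ _)
      simpa [f, hi] using this
    · have := hx (Sum.inr i) (Finset.mem_univ _)
      simpa [f, hi, inner_sub_left] using this)
  refine ⟨∑ i, c i • f i, fun u => ?_, fun i => if i ∈ θ.Iact z then c (Sum.inl i) else 0,
    fun i => if i ∈ θ.Kact z then c (Sum.inr i) else 0, fun i => ?_, fun i => ?_, fun i hi => ?_,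
    fun i hi => ?_, ?_⟩
  · rw [hcb, sum_inner]
    simp [inner_smul_left]
  · dsimp only; split_ifs <;> simp [hc]
  · dsimp only; split_ifs <;> simp [hc]
  · simp [hi]
  · simp [hi]
  · rw [Fintype.sum_sum_type]
    congr 1 <;> refine Finset.sum_congr rfl fun i _ => ?_ <;> simp only [f, Sum.elim_inl, Sum.elim_inr] <;>
      split_ifs <;> simp

lemma polar_subdiff {z v η : Ev m} (hv : v ∈ θ.subdiff z) (hη : ∀ w ∈ θ.Kc z v, ⟪η, w⟫ ≤ 0) :
    ∃ ε > (0 : ℝ), ∀ t : ℝ, 0 ≤ t → t ≤ ε → v + t • η ∈ θ.subdiff z := by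
  obtain ⟨w, hw, mu, la, hmu, hla, hmu0, hla0, hwe⟩ := θ.Kc_farkas (z := z) (v := v)
    LinearMap.id (innerₗ (Ev m) η) (by simpa using hη)
  have hηw : η = w := by
    refine ext_inner_right ℝ fun u => ?_
    simpa using hw u
  subst hηw
  have hS : 0 ≤ ∑ i, la i := Finset.sum_nonneg fun i _ => hla i
  refine ⟨(1 + ∑ i, la i)⁻¹, by positivity, fun t ht0 ht => ⟨hv.1, fun z' hz' => ?_⟩⟩
  have h1 : ⟪η, z' - z⟫ ≤ (∑ i, la i) * (θ.val z' - θ.val z - ⟪v, z' - z⟫) := by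
    rw [hwe, inner_add_left, sum_inner, sum_inner, Finset.sum_mul]
    have hA : ∑ i, ⟪mu i • θ.d i, z' - z⟫ ≤ 0 := by
      refine Finset.sum_nonpos fun i _ => ?_
      rw [real_inner_smul_left]
      by_cases hi : i ∈ θ.Iact z
      · have h2 := hz' i
        have h3 : ⟪θ.d i, z⟫ = θ.be i := hi
        rw [inner_sub_right]
        exact mul_nonpos_of_nonneg_of_nonpos (hmu i) (by linarith)
      · simp [hmu0 i hi]
    have hB : ∑ i, ⟪la i • (θ.a i - v), z' - z⟫ ≤
        ∑ i, la i * (θ.val z' - θ.val z - ⟪v, z' - z⟫) := by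
      refine Finset.sum_le_sum fun i _ => ?_
      rw [real_inner_smul_left]
      by_cases hi : i ∈ θ.Kact z
      · have h2 := θ.val_ge z' i
        have h3 : θ.val z = _ := hi
        rw [inner_sub_left, inner_sub_right (θ.a i)]
        exact mul_le_mul_of_nonneg_left (by linarith) (hla i)
      · simp [hla0 i hi]
    linarith
  have h2 := hv.2 z' hz'
  rw [inner_add_left, real_inner_smul_left]
  have h3 : t * (1 + ∑ i, la i) ≤ 1 := by
    rw [← le_div_iff₀ (by positivity)]; simpa using ht
  have h4 := mul_le_mul_of_nonneg_left h1 ht0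
  have h5 : 0 ≤ θ.val z' - θ.val z - ⟪v, z' - z⟫ := by linarith
  have h6 : t * (∑ i, la i) ≤ 1 := by nlinarith
  nlinarith

lemma seq_inv : Tendsto (fun k : ℕ => ((k : ℝ) + 1)⁻¹) atTop (𝓝[>] 0) := by
  refine tendsto_nhdsWithin_iff.2 ⟨?_, Eventually.of_forall fun k => ?_⟩
  · simpa [one_div] using tendsto_one_div_add_atTop_nhds_zero_nat (𝕜 := ℝ)
  · show (0:ℝ) < _
    positivity

lemma Dsub_mem {z v y w : Ev m} (hv : v ∈ θ.subdiff z) (hy : y ∈ θ.Kc z v)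
    (hw : ∀ w' ∈ θ.Kc z v, ⟪w, w'⟫ ≤ 0) (hwy : ⟪w, y⟫ = 0) : w ∈ θ.Dsub z v y := by
  obtain ⟨ε, hε, hsub⟩ := θ.polar_subdiff hv hw
  have hev : ∀ᶠ t : ℝ in 𝓝[>] 0, (z + t • y, v + t • w) ∈ θ.gph := by
    filter_upwards [(tendsto_ray z y).eventually (θ.ev_Kc hv), self_mem_nhdsWithin,
      (tendsto_id.mono_left nhdsWithin_le_nhds : Tendsto id (𝓝[>] (0:ℝ)) (𝓝 0)).eventually_lt_const hε]
      with t h1 ht htε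
    have ht : 0 < t := ht
    obtain ⟨h2, h3⟩ := h1 (by simpa using θ.Kc_smul hy ht.le)
    refine ⟨h2, fun z' hz' => ?_⟩
    have h4 := (hsub t ht.le (le_of_lt htε)).2 z' hz'
    have e : z' - (z + t • y) = (z' - z) - t • y := by abel
    have h5 : ⟪v + t • w, t • y⟫ = t * ⟪v, y⟫ := by
      rw [inner_smul_right, inner_add_left, real_inner_smul_left, hwy]; ring
    simp only [add_sub_cancel_left, inner_smul_right] at h3
    simp only
    rw [e, inner_sub_right, h5, h3]
    linarith
  obtain ⟨N, hN⟩ := eventually_atTop.1 (seq_inv.eventually hev)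
  have hs := seq_inv.comp (tendsto_add_atTop_nat N)
  refine ⟨fun k => (z + (((k + N : ℕ) : ℝ) + 1)⁻¹ • y, v + (((k + N : ℕ) : ℝ) + 1)⁻¹ • w),
    fun k => ((k + N : ℕ) : ℝ) + 1, fun k => hN (k + N) (by omega), fun k => by positivity, ?_, ?_⟩
  · exact ((tendsto_ray z y).comp hs).prodMk_nhds ((tendsto_ray v w).comp hs)
  · have : ∀ k : ℕ, (((k + N : ℕ) : ℝ) + 1) • ((z + (((k + N : ℕ) : ℝ) + 1)⁻¹ • y,
        v + (((k + N : ℕ) : ℝ) + 1)⁻¹ • w) - (z, v)) = (y, w) := by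
      intro k
      rw [Prod.mk_sub_mk, Prod.smul_mk, add_sub_cancel_left, add_sub_cancel_left, smul_smul,
        smul_smul, mul_inv_cancel₀ (by positivity), one_smul, one_smul]
    simp only [this]
    exact tendsto_const_nhds

lemma ev_polar {z : Ev m} (v : Ev m) (hz : z ∈ θ.dom) :
    ∀ᶠ z' in 𝓝 z, ∀ v' ∈ θ.subdiff z', ∀ w ∈ θ.Kc z v, ⟪v', w⟫ ≤ ⟪v, w⟫ := by
  filter_upwards [θ.ev_Kact z, θ.ev_Iact z hz] with z' hK hI v' hv' w hw
  have h1 := (tendsto_ray z' w).eventually (θ.ev_dom z' hv'.1)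
  have h2 := (tendsto_ray z' w).eventually (θ.ev_val z')
  obtain ⟨t, ⟨h1, h2⟩, ht⟩ := ((h1.and h2).and self_mem_nhdsWithin).exists
  have ht : 0 < t := ht
  simp only [add_sub_cancel_left, inner_smul_right] at h1 h2
  have h3 := h1 fun i hi => mul_nonpos_of_nonneg_of_nonpos ht.le (hw.1 i (hI hi))
  have h4 := h2 (t * ⟪v, w⟫) fun i hi => mul_le_mul_of_nonneg_left (hw.2 i (hK hi)) ht.le
  have h5 := hv'.2 _ h3
  rw [add_sub_cancel_left, inner_smul_right] at h5
  exact le_of_mul_le_mul_left (by linarith) ht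

lemma tangent_props {z v y w : Ev m} (hv : v ∈ θ.subdiff z) {zk vk : ℕ → Ev m} {c : ℕ → ℝ}
    (hsub : ∀ k, vk k ∈ θ.subdiff (zk k)) (hc : ∀ k, 0 ≤ c k)
    (hz : Tendsto zk atTop (𝓝 z)) (hvk : Tendsto vk atTop (𝓝 v))
    (hy : Tendsto (fun k => c k • (zk k - z)) atTop (𝓝 y))
    (hw : Tendsto (fun k => c k • (vk k - v)) atTop (𝓝 w)) :
    y ∈ θ.Kc z v ∧ 0 ≤ ⟪w, y⟫ ∧ ∀ w' ∈ θ.Kc z v, ⟪w, w'⟫ ≤ 0 := by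
  refine ⟨⟨fun i hi => ?_, fun i hi => ?_⟩, ?_, fun w' hw' => ?_⟩
  · refine le_of_tendsto (tendsto_const_nhds.inner hy) (Eventually.of_forall fun k => ?_)
    have h1 := (hsub k).1 i
    have h3 : ⟪θ.d i, z⟫ = θ.be i := hi
    simp only [inner_smul_right, inner_sub_right]
    exact mul_nonpos_of_nonneg_of_nonpos (hc k) (by linarith)
  · refine le_of_tendsto_of_tendsto (tendsto_const_nhds.inner hy) (hvk.inner hy)
      (Eventually.of_forall fun k => ?_)
    have h1 := θ.val_ge (zk k) i
    have h3 : θ.val z = _ := hi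
    have h4 := (hsub k).2 z hv.1
    simp only [inner_smul_right]
    refine mul_le_mul_of_nonneg_left ?_ (hc k)
    rw [inner_sub_right] at h4 ⊢
    rw [inner_sub_right]
    linarith
  · refine ge_of_tendsto (hw.inner hy) (Eventually.of_forall fun k => ?_)
    rw [real_inner_smul_left, inner_smul_right]
    have h4 := (hsub k).2 z hv.1
    have h5 := hv.2 _ (hsub k).1
    refine mul_nonneg (hc k) (mul_nonneg (hc k) ?_)
    rw [inner_sub_left]
    rw [inner_sub_right] at h4 h5 ⊢
    rw [inner_sub_right]
    linarith
  · refine le_of_tendsto (hw.inner tendsto_const_nhds) ?_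
    filter_upwards [hz.eventually (θ.ev_polar v hv.1)] with k hk
    have := hk _ (hsub k) w' hw'
    rw [real_inner_smul_left, inner_sub_left]
    exact mul_nonpos_of_nonneg_of_nonpos (hc k) (by linarith)

/-- first order optimality gives a multiplier -/
lemma exists_mult {E : Type*} [AddCommGroup E] [Module ℝ E] {z : Ev m} (hz : z ∈ θ.dom)
    (A : E →ₗ[ℝ] Ev m) (b : E →ₗ[ℝ] ℝ)
    (hb : ∀ u s, (∀ i ∈ θ.Iact z, ⟪θ.d i, A u⟫ ≤ 0) → (∀ i ∈ θ.Kact z, ⟪θ.a i, A u⟫ ≤ s) →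
      0 ≤ b u + s) :
    ∃ v ∈ θ.subdiff z, ∀ u, b u + ⟪v, A u⟫ = 0 := by
  classical
  let f : (Fin θ.p ⊕ Fin θ.l) → (E × ℝ) →ₗ[ℝ] ℝ := Sum.elim
    (fun i => if i ∈ θ.Iact z then (innerₗ (Ev m) (θ.d i)) ∘ₗ A ∘ₗ LinearMap.fst ℝ E ℝ else 0)
    (fun i => if i ∈ θ.Kact z then (innerₗ (Ev m) (θ.a i)) ∘ₗ A ∘ₗ LinearMap.fst ℝ E ℝ
      - LinearMap.snd ℝ E ℝ else 0)
  obtain ⟨c, hc, hcb⟩ := farkas_lin Finset.univ f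
      (-(b ∘ₗ LinearMap.fst ℝ E ℝ) - LinearMap.snd ℝ E ℝ) (by
    rintro ⟨u, s⟩ hx
    have := hb u s (fun i hi => ?_) (fun i hi => ?_)
    · simp; linarith
    · have := hx (Sum.inl i) (Finset.mem_univ _)
      simpa [f, hi] using this
    · have := hx (Sum.inr i) (Finset.mem_univ _)
      simpa [f, hi, inner_sub_left] using this)
  let mu : Fin θ.p → ℝ := fun i => if i ∈ θ.Iact z then c (Sum.inl i) else 0
  let la : Fin θ.l → ℝ := fun i => if i ∈ θ.Kact z then c (Sum.inr i) else 0
  have hmu : ∀ i, 0 ≤ mu i := fun i => by simp only [mu]; split_ifs <;> simp [hc]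
  have hla : ∀ i, 0 ≤ la i := fun i => by simp only [la]; split_ifs <;> simp [hc]
  have key : ∀ u s, - b u - s = ∑ i, mu i * ⟪θ.d i, A u⟫ + ∑ i, la i * (⟪θ.a i, A u⟫ - s) := by
    intro u s
    have := hcb (u, s)
    rw [Fintype.sum_sum_type] at this
    simp only [LinearMap.sub_apply, LinearMap.neg_apply, LinearMap.comp_apply,
      LinearMap.fst_apply, LinearMap.snd_apply] at this
    rw [this]
    congr 1 <;> refine Finset.sum_congr rfl fun i _ => ?_ <;>
      simp only [f, mu, la, Sum.elim_inl, Sum.elim_inr] <;> split_ifs <;> simp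
  have hsum : ∑ i, la i = 1 := by
    have := key 0 1
    simp at this
    linarith
  refine ⟨∑ i, mu i • θ.d i + ∑ i, la i • θ.a i, ⟨hz, fun z' hz' => ?_⟩, fun u => ?_⟩
  · rw [inner_add_left, sum_inner, sum_inner]
    have hA : ∑ i, ⟪mu i • θ.d i, z' - z⟫ ≤ 0 := by
      refine Finset.sum_nonpos fun i _ => ?_
      rw [real_inner_smul_left]
      by_cases hi : i ∈ θ.Iact z
      · have h2 := hz' i
        have h3 : ⟪θ.d i, z⟫ = θ.be i := hi
        rw [inner_sub_right]
        exact mul_nonpos_of_nonneg_of_nonpos (hmu i) (by linarith)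
      · simp [mu, hi]
    have hB : ∑ i, ⟪la i • θ.a i, z' - z⟫ ≤ ∑ i, la i * (θ.val z' - θ.val z) := by
      refine Finset.sum_le_sum fun i _ => ?_
      rw [real_inner_smul_left]
      by_cases hi : i ∈ θ.Kact z
      · have h2 := θ.val_ge z' i
        have h3 : θ.val z = _ := hi
        rw [inner_sub_right]
        exact mul_le_mul_of_nonneg_left (by linarith) (hla i)
      · simp [la, hi]
    rw [← Finset.sum_mul, hsum] at hB
    linarith
  · have := key u 0
    rw [inner_add_left, sum_inner, sum_inner]
    simp only [real_inner_smul_left]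
    simp only [sub_zero] at this
    linarith

end CPWL
lemma surj_of_polar {n m : ℕ} (A : Ev n →L[ℝ] Ev m) (K : Set (Ev m)) (K0 : (0 : Ev m) ∈ K)
    (Kadd : ∀ k ∈ K, ∀ k' ∈ K, k + k' ∈ K) (Ksmul : ∀ t : ℝ, 0 ≤ t → ∀ k ∈ K, t • k ∈ K)
    (h : ∀ η : Ev m, (∀ u, ⟪η, A u⟫ = 0) → (∀ k ∈ K, ⟪η, k⟫ ≤ 0) → η = 0) (y : Ev m) :
    ∃ u, A u - y ∈ K := by
  let C : Set (Ev m) := {y | ∃ u, A u - y ∈ K}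
  have hCconv : Convex ℝ C := by
    rintro y ⟨u, hu⟩ y' ⟨u', hu'⟩ a b ha hb hab
    refine ⟨a • u + b • u', ?_⟩
    have := Kadd _ (Ksmul a ha _ hu) _ (Ksmul b hb _ hu')
    have e : A (a • u + b • u') - (a • y + b • y') = a • (A u - y) + b • (A u' - y') := by
      simp only [map_add, map_smul, smul_sub]; abel
    rw [e]; exact this
  have hCcone : ∀ t : ℝ, 0 ≤ t → ∀ y ∈ C, t • y ∈ C := by
    rintro t ht y ⟨u, hu⟩
    refine ⟨t • u, ?_⟩
    have := Ksmul t ht _ hu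
    rwa [map_smul, ← smul_sub]
  have hcl : closure C = univ := by
    by_contra hne
    obtain ⟨x, hx⟩ := (ne_univ_iff_exists_notMem _).1 hne
    obtain ⟨f, s, hf, hs⟩ := geometric_hahn_banach_closed_point hCconv.closure isClosed_closure hx
    have h0 : (0 : Ev m) ∈ C := ⟨0, by simpa using K0⟩
    have hs0 : 0 < s := by simpa using hf 0 (subset_closure h0)
    have hle : ∀ y ∈ C, f y ≤ 0 := by
      intro y hy
      by_contra hcon
      push Not at hcon
      have := hf _ (subset_closure (hCcone (s / f y) (by positivity) y hy))
      rw [map_smul, smul_eq_mul, div_mul_cancel₀ _ hcon.ne'] at this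
      exact lt_irrefl _ this
    let η : Ev m := (InnerProductSpace.toDual ℝ (Ev m)).symm f
    have hη : ∀ y, ⟪η, y⟫ = f y := fun y => InnerProductSpace.toDual_symm_apply
    have h1 : ∀ u, f (A u) ≤ 0 := fun u => hle _ ⟨u, by simpa using K0⟩
    have h2 : -η = 0 := by
      refine h (-η) (fun u => ?_) (fun k hk => ?_)
      · have a1 := h1 u
        have a2 := h1 (-u)
        rw [inner_neg_left, hη]
        simp at a2
        linarith
      · have := hle (-k) ⟨0, by simpa using hk⟩
        rw [inner_neg_left, hη]
        simpa using this
    have h3 : f x = 0 := by rw [← hη, neg_eq_zero.1 h2]; simp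
    linarith
  have hspan : affineSpan ℝ C = ⊤ := by
    have hc : IsClosed (affineSpan ℝ C : Set (Ev m)) := AffineSubspace.closed_of_finiteDimensional _
    have : closure C ⊆ affineSpan ℝ C := closure_minimal (subset_affineSpan ℝ C) hc
    rw [hcl] at this
    exact SetLike.coe_injective (by simpa using univ_subset_iff.1 this)
  have hint := hCconv.interior_nonempty_iff_affineSpan_eq_top.2 hspan
  have heq := hCconv.interior_closure_eq_interior_of_nonempty_interior hint
  rw [hcl, interior_univ] at heq
  have : y ∈ interior C := heq ▸ mem_univ y
  exact (interior_subset this : y ∈ C)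

lemma right_inv {n m : ℕ} (A : Ev n →L[ℝ] Ev m) (K : Set (Ev m)) (K0 : (0 : Ev m) ∈ K)
    (Kadd : ∀ k ∈ K, ∀ k' ∈ K, k + k' ∈ K) (Ksmul : ∀ t : ℝ, 0 ≤ t → ∀ k ∈ K, t • k ∈ K)
    (h : ∀ y, ∃ u, A u - y ∈ K) :
    ∃ κ : ℝ, 0 < κ ∧ ∃ u : Ev m → Ev n, (∀ y, A (u y) - y ∈ K) ∧ u 0 = 0 ∧
      ∀ y y', ‖u y - u y'‖ ≤ κ * ‖y - y'‖ := by
  let b := EuclideanSpace.basisFun (Fin m) ℝ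
  choose P hP using fun i => h (b i)
  choose N hN using fun i => h (-(b i))
  have Ksum : ∀ (s : Finset (Fin m)) (f : Fin m → Ev m), (∀ i, f i ∈ K) → ∑ i ∈ s, f i ∈ K := by
    intro s f hf
    induction s using Finset.induction_on with
    | empty => simpa using K0
    | insert a s ha ih => rw [Finset.sum_insert ha]; exact Kadd _ (hf a) _ ih
  let u : Ev m → Ev n := fun y => ∑ i, (max (y i) 0 • P i + max (-y i) 0 • N i)
  refine ⟨∑ i, (‖P i‖ + ‖N i‖) + 1, by positivity, u, fun y => ?_, by simp [u], fun y y' => ?_⟩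
  · have hy : y = ∑ i, (max (y i) 0 • b i + max (-y i) 0 • (-(b i))) := by
      conv_lhs => rw [← b.sum_repr y]
      refine Finset.sum_congr rfl fun i _ => ?_
      rw [smul_neg, ← sub_eq_add_neg, ← sub_smul, max_zero_sub_max_neg_zero_eq_self]
      simp [b]
    have e : A (u y) - y = ∑ i, (max (y i) 0 • (A (P i) - b i) + max (-y i) 0 • (A (N i) - -(b i))) := by
      refine (congrArg (fun t => A (u y) - t) hy).trans ?_
      simp only [u, map_sum, map_add, map_smul]
      rw [← Finset.sum_sub_distrib]
      refine Finset.sum_congr rfl fun i _ => ?_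
      simp only [smul_sub]; abel
    rw [e]
    exact Ksum _ _ fun i => Kadd _ (Ksmul _ (le_max_right _ _) _ (hP i)) _
      (Ksmul _ (le_max_right _ _) _ (hN i))
  · have hcoord : ∀ i, |y i - y' i| ≤ ‖y - y'‖ := fun i => by
      simpa using PiLp.norm_apply_le (y - y') i
    calc ‖u y - u y'‖ = ‖∑ i, ((max (y i) 0 - max (y' i) 0) • P i +
          (max (-y i) 0 - max (-y' i) 0) • N i)‖ := by
          simp only [u]
          rw [← Finset.sum_sub_distrib]
          congr 1
          refine Finset.sum_congr rfl fun i _ => ?_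
          simp only [sub_smul]; abel
      _ ≤ ∑ i, (‖P i‖ + ‖N i‖) * ‖y - y'‖ := by
          refine (norm_sum_le _ _).trans (Finset.sum_le_sum fun i _ => ?_)
          refine (norm_add_le _ _).trans ?_
          rw [norm_smul, norm_smul, add_mul]
          have h1 : ‖max (y i) 0 - max (y' i) 0‖ ≤ ‖y - y'‖ :=
            (abs_max_sub_max_le_abs _ _ _).trans (hcoord i)
          have h2 : ‖max (-y i) 0 - max (-y' i) 0‖ ≤ ‖y - y'‖ := by
            refine (abs_max_sub_max_le_abs _ _ _).trans ?_
            have := hcoord i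
            rwa [neg_sub_neg, abs_sub_comm]
          have h3 := mul_le_mul_of_nonneg_right h1 (norm_nonneg (P i))
          have h4 := mul_le_mul_of_nonneg_right h2 (norm_nonneg (N i))
          linarith
      _ ≤ _ := by
          rw [← Finset.sum_mul]
          have := norm_nonneg (y - y')
          linarith

lemma metric_reg {n m : ℕ} {g : Ev n → Ev m} {xb : Ev n} (A : Ev n →L[ℝ] Ev m)
    (hg : HasStrictFDerivAt g A xb) (K : Set (Ev m)) (u : Ev m → Ev n) {κ : ℝ} (hκ : 0 < κ)
    (hu : ∀ y, A (u y) - y ∈ K) (hu0 : u 0 = 0) (hul : ∀ y y', ‖u y - u y'‖ ≤ κ * ‖y - y'‖) :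
    ∃ ρ : ℝ, 0 < ρ ∧ ∀ x, ‖x - xb‖ < ρ → ∀ e, ‖e‖ < ρ →
      ∃ x', ‖x' - x‖ ≤ 2 * κ * ‖e‖ ∧ g x' - g x - e ∈ K := by
  have hc0 : 0 < (1 / (2 * κ)) := by positivity
  have happ := hg.isLittleO.def hc0
  rw [nhds_prod_eq] at happ
  obtain ⟨δ, hδ, hball⟩ : ∃ δ > 0, ∀ x y : Ev n, ‖x - xb‖ < δ → ‖y - xb‖ < δ →
      ‖g x - g y - A (x - y)‖ ≤ 1 / (2 * κ) * ‖x - y‖ := by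
    rw [← nhds_prod_eq] at happ
    obtain ⟨δ, hδ, h⟩ := Metric.eventually_nhds_iff.1 happ
    refine ⟨δ, hδ, fun x y hx hy => ?_⟩
    have := @h (x, y) (by
      rw [Prod.dist_eq]
      simpa [dist_eq_norm] using ⟨hx, hy⟩)
    simpa using this
  refine ⟨δ / (1 + 2 * κ), by positivity, fun x hx e he => ?_⟩
  have hsz : ‖x - xb‖ + 2 * κ * ‖e‖ < δ := by
    have : δ / (1 + 2 * κ) * (1 + 2 * κ) = δ := by field_simp
    nlinarith
  have huy : ∀ y, ‖u y‖ ≤ κ * ‖y‖ := fun y => by simpa [hu0] using hul y 0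
  let T : Ev m → Ev m := fun y => e - (g (x + u y) - g x - A (u y))
  have hin : ∀ y ∈ Metric.closedBall (0 : Ev m) (2 * ‖e‖), ‖x + u y - xb‖ < δ := by
    intro y hy
    have h1 : ‖y‖ ≤ 2 * ‖e‖ := by simpa using hy
    have h2 := huy y
    have h3 : ‖x + u y - xb‖ ≤ ‖x - xb‖ + ‖u y‖ := by
      have : x + u y - xb = (x - xb) + u y := by abel
      rw [this]; exact norm_add_le _ _
    nlinarith
  have hx' : ‖x - xb‖ < δ := by
    have : 0 ≤ 2 * κ * ‖e‖ := by positivity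
    linarith
  have hmaps : MapsTo T (Metric.closedBall 0 (2 * ‖e‖)) (Metric.closedBall 0 (2 * ‖e‖)) := by
    intro y hy
    have h1 : ‖y‖ ≤ 2 * ‖e‖ := by simpa using hy
    have h2 := hball _ _ (hin y hy) hx'
    rw [add_sub_cancel_left] at h2
    have h3 := huy y
    have h4 : 1 / (2 * κ) * ‖u y‖ ≤ ‖e‖ := by
      rw [div_mul_eq_mul_div, div_le_iff₀ (by positivity)]
      nlinarith
    have h5 : ‖T y‖ ≤ ‖e‖ + ‖g (x + u y) - g x - A (u y)‖ := norm_sub_le _ _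
    simp only [Metric.mem_closedBall, dist_zero_right]
    linarith
  have hcontr : ContractingWith (1 / 2 : NNReal) (hmaps.restrict T _ _) := by
    refine ⟨by norm_num, LipschitzWith.of_dist_le_mul ?_⟩
    rintro ⟨y, hy⟩ ⟨y', hy'⟩
    rw [Subtype.dist_eq, Subtype.dist_eq]
    simp only [MapsTo.val_restrict_apply, dist_eq_norm]
    have h2 := hball _ _ (hin y hy) (hin y' hy')
    have e1 : x + u y - (x + u y') = u y - u y' := by abel
    rw [e1] at h2
    have e2 : T y - T y' = -(g (x + u y) - g (x + u y') - A (u y - u y')) := by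
      simp only [T, map_sub]; abel
    rw [e2, norm_neg]
    refine h2.trans ?_
    have h3 := hul y y'
    rw [div_mul_eq_mul_div, div_le_iff₀ (by positivity)]
    push_cast
    linarith
  obtain ⟨y, hy, hfix, -⟩ := hcontr.exists_fixedPoint' (Metric.isClosed_closedBall.isComplete)
    hmaps (x := 0) (by simp) (edist_ne_top _ _)
  refine ⟨x + u y, ?_, ?_⟩
  · have h1 : ‖y‖ ≤ 2 * ‖e‖ := by simpa using hy
    have := huy y
    rw [add_sub_cancel_left]
    nlinarith
  · have h1 : e - (g (x + u y) - g x - A (u y)) = y := hfix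
    have e1 : g (x + u y) - g x - e = A (u y) - y := by
      refine Eq.trans ?_ (congrArg (fun t => A (u y) - t) h1)
      abel
    rw [e1]; exact hu y

lemma deriv_seq {E F : Type*} [NormedAddCommGroup E] [NormedSpace ℝ E] [NormedAddCommGroup F]
    [NormedSpace ℝ F] {f : E → F} {f' : E →L[ℝ] F} {x ξ : E} (hf : HasFDerivAt f f' x)
    {xk : ℕ → E} {c : ℕ → ℝ} (hx : Tendsto xk atTop (𝓝 x))
    (hc : Tendsto (fun k => c k • (xk k - x)) atTop (𝓝 ξ)) :
    Tendsto (fun k => c k • (f (xk k) - f x)) atTop (𝓝 (f' ξ)) := by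
  have h1 := hf.isLittleO.comp_tendsto hx
  have h2 := (Asymptotics.isBigO_refl c atTop).smul_isLittleO h1
  have h3 := h2.trans_isBigO (hc.isBigO_one ℝ)
  have h4 := (Asymptotics.isLittleO_one_iff ℝ).1 h3
  have h5 := h4.add ((f'.continuous.tendsto ξ).comp hc)
  rw [zero_add] at h5
  refine h5.congr fun k => ?_
  simp only [Function.comp, map_smul, smul_sub, map_sub]
  abel

lemma hess_symm {n : ℕ} {L : Ev n → ℝ} {xb : Ev n} (hL : ContDiffAt ℝ 2 L xb) :
    HasFDerivAt (gradient L) (fderiv ℝ (gradient L) xb) xb ∧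
    ∀ u w, ⟪fderiv ℝ (gradient L) xb u, w⟫ = ⟪fderiv ℝ (gradient L) xb w, u⟫ := by
  have h1 : DifferentiableAt ℝ (fderiv ℝ L) xb :=
    (hL.fderiv_right (m := 1) (by norm_num)).differentiableAt (by norm_num)
  let J : (Ev n →L[ℝ] ℝ) →L[ℝ] Ev n :=
    { toFun := fun f => (InnerProductSpace.toDual ℝ (Ev n)).symm f
      map_add' := fun f g => map_add _ f g
      map_smul' := fun c f => by simp
      cont := (InnerProductSpace.toDual ℝ (Ev n)).symm.continuous }
  have hJ : ∀ f w, ⟪J f, w⟫ = f w := fun f w => InnerProductSpace.toDual_symm_apply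
  have h2 : HasFDerivAt (gradient L) (J.comp (fderiv ℝ (fderiv ℝ L) xb)) xb :=
    J.hasFDerivAt.comp xb h1.hasFDerivAt
  have hs : IsSymmSndFDerivAt ℝ L xb := hL.isSymmSndFDerivAt (by simp)
  rw [h2.fderiv]
  refine ⟨h2, fun u w => ?_⟩
  simp only [ContinuousLinearMap.comp_apply, hJ]
  exact hs u w

lemma taylor_two {n : ℕ} {L : Ev n → ℝ} {xb : Ev n} (hL : ContDiffAt ℝ 2 L xb)
    (h0 : gradient L xb = 0) :
    (fun x => L x - L xb - (1 / 2) * ⟪fderiv ℝ (gradient L) xb (x - xb), x - xb⟫) =o[𝓝 xb]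
      fun x => ‖x - xb‖ ^ 2 := by
  obtain ⟨hd, hsymm⟩ := hess_symm hL
  set H := fderiv ℝ (gradient L) xb with hH
  rw [Asymptotics.isLittleO_iff]
  intro ε hε
  have hdiff : ∀ᶠ x in 𝓝 xb, DifferentiableAt ℝ L x := by
    filter_upwards [hL.eventually (by simp)] with x hx
    exact hx.differentiableAt (by norm_num)
  obtain ⟨δ, hδ, hball⟩ := Metric.eventually_nhds_iff_ball.1 (hdiff.and (hd.isLittleO.def hε))
  filter_upwards [Metric.ball_mem_nhds xb hδ] with x hx
  let r : Ev n → ℝ := fun x => L x - L xb - (1 / 2) * ⟪H (x - xb), x - xb⟫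
  have hr : ∀ y ∈ Metric.ball xb δ, HasFDerivAt r
      (innerSL ℝ (gradient L y - H (y - xb))) y := by
    intro y hy
    have a1 : HasFDerivAt L (innerSL ℝ (gradient L y)) y :=
      ((hball y hy).1.hasGradientAt).hasFDerivAt
    have a2 : HasFDerivAt (fun x => H (x - xb)) H y := by
      have := H.hasFDerivAt.comp y ((hasFDerivAt_id (𝕜 := ℝ) y).sub_const xb)
      refine this.congr_fderiv ?_
      ext; simp
    have a3 := (a2.inner ℝ ((hasFDerivAt_id (𝕜 := ℝ) y).sub_const xb)).const_mul (1 / 2)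
    have a4 := (a1.sub_const (L xb)).sub a3
    refine a4.congr_fderiv ?_
    ext w
    simp [fderivInnerCLM_apply, inner_sub_left]
    have s1 := hsymm (y - xb) w
    simp [inner_sub_left, inner_sub_right] at s1 ⊢
    linarith
  have hx' : ‖x - xb‖ < δ := by simpa [dist_eq_norm] using hx
  have hsub : segment ℝ xb x ⊆ Metric.ball xb δ :=
    (convex_ball xb δ).segment_subset (Metric.mem_ball_self hδ) hx
  have hseg : ∀ y ∈ segment ℝ xb x, ‖y - xb‖ ≤ ‖x - xb‖ := by
    intro y hy
    rw [segment_eq_image'] at hy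
    obtain ⟨t, ⟨ht0, ht1⟩, rfl⟩ := hy
    rw [add_sub_cancel_left, norm_smul, Real.norm_of_nonneg ht0]
    exact mul_le_of_le_one_left (norm_nonneg _) ht1
  have hmv := (convex_segment xb x).norm_image_sub_le_of_norm_hasFDerivWithin_le
    (f := r) (f' := fun y => innerSL ℝ (gradient L y - H (y - xb))) (C := ε * ‖x - xb‖)
    (fun y hy => (hr y (hsub hy)).hasFDerivWithinAt) (fun y hy => by
      rw [innerSL_apply_norm]
      have := (hball y (hsub hy)).2
      rw [h0, sub_zero] at this
      exact this.trans (mul_le_mul_of_nonneg_left (hseg y hy) hε.le))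
    (left_mem_segment ℝ xb x) (right_mem_segment ℝ xb x)
  have hr0 : r xb = 0 := by simp [r]
  rw [hr0, sub_zero] at hmv
  refine hmv.trans ?_
  rw [Real.norm_of_nonneg (by positivity)]
  nlinarith

lemma taylor_seq {n : ℕ} {L : Ev n → ℝ} {xb ξ : Ev n} (hL : ContDiffAt ℝ 2 L xb)
    (h0 : gradient L xb = 0) {xk : ℕ → Ev n} {c : ℕ → ℝ} (hx : Tendsto xk atTop (𝓝 xb))
    (hc : Tendsto (fun k => c k • (xk k - xb)) atTop (𝓝 ξ)) :
    Tendsto (fun k => c k ^ 2 * (L (xk k) - L xb)) atTop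
      (𝓝 ((1 / 2) * ⟪fderiv ℝ (gradient L) xb ξ, ξ⟫)) := by
  have h1 := (taylor_two hL h0).comp_tendsto hx
  have h2 := (Asymptotics.isBigO_refl (fun k => c k ^ 2) atTop).mul_isLittleO h1
  have h3 : (fun k => c k ^ 2 * (‖xk k - xb‖ ^ 2)) =O[atTop] (fun _ => (1 : ℝ)) := by
    have := (hc.norm.pow 2).isBigO_one ℝ
    refine this.congr_left fun k => ?_
    rw [norm_smul, mul_pow, Real.norm_eq_abs, sq_abs]
  have h4 := (Asymptotics.isLittleO_one_iff ℝ).1 (h2.trans_isBigO h3)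
  have h5 := h4.add (((((fderiv ℝ (gradient L) xb).continuous.tendsto ξ).comp hc).inner hc).const_mul
    (1 / 2))
  rw [zero_add] at h5
  refine h5.congr fun k => ?_
  simp only [Function.comp, map_smul, real_inner_smul_left, inner_smul_right]
  ring

section KKTbasic

variable {n m : ℕ} {θ : CPWL m} {φ₀ : Ev n → ℝ} {Φ : Ev n → Ev m} {xb : Ev n} {vb : Ev m}

lemma Lag_contDiff (hphi : ContDiffAt ℝ 2 φ₀ xb) (hPhi : ContDiffAt ℝ 2 Φ xb) (v : Ev m) :
    ContDiffAt ℝ 2 (fun y => φ₀ y + ⟪Φ y, v⟫) xb :=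
  hphi.add (hPhi.inner ℝ contDiffAt_const)

lemma adjD_inner (x : Ev n) (v : Ev m) (u : Ev n) : ⟪adjD Φ x v, u⟫ = ⟪v, fderiv ℝ Φ x u⟫ :=
  ContinuousLinearMap.adjoint_inner_left _ _ _

lemma gradient_inner {f : Ev n → ℝ} (x u : Ev n) : ⟪gradient f x, u⟫ = fderiv ℝ f x u :=
  InnerProductSpace.toDual_symm_apply

lemma ev_diff (hphi : ContDiffAt ℝ 2 φ₀ xb) (hPhi : ContDiffAt ℝ 2 Φ xb) :
    ∀ᶠ x in 𝓝 xb, DifferentiableAt ℝ φ₀ x ∧ DifferentiableAt ℝ Φ x := by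
  filter_upwards [hphi.eventually (by simp), hPhi.eventually (by simp)] with x h1 h2
  exact ⟨h1.differentiableAt (by norm_num), h2.differentiableAt (by norm_num)⟩

lemma gradL_eq {x : Ev n} (v : Ev m) (h : DifferentiableAt ℝ φ₀ x ∧ DifferentiableAt ℝ Φ x) :
    gradient (fun y => φ₀ y + ⟪Φ y, v⟫) x = gradient φ₀ x + adjD Φ x v := by
  refine ext_inner_right ℝ fun u => ?_
  have h2 : HasFDerivAt (fun y => φ₀ y + ⟪Φ y, v⟫) _ x :=
    h.1.hasFDerivAt.add (h.2.hasFDerivAt.inner ℝ (hasFDerivAt_const v x))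
  rw [inner_add_left, gradient_inner, gradient_inner, adjD_inner, h2.fderiv]
  simp [fderivInnerCLM_apply, real_inner_comm]

lemma gradPsi_deriv (hphi : ContDiffAt ℝ 2 φ₀ xb) (hPhi : ContDiffAt ℝ 2 Φ xb) (v : Ev m) :
    HasFDerivAt (fun x => gradient φ₀ x + adjD Φ x v) (HessOp φ₀ Φ v xb) xb := by
  have h := (hess_symm (Lag_contDiff hphi hPhi v)).1
  refine h.congr_of_eventuallyEq ?_
  filter_upwards [ev_diff hphi hPhi] with x hx
  exact (gradL_eq v hx).symm

lemma adjD_cont (hPhi : ContDiffAt ℝ 2 Φ xb) : ContinuousAt (adjD Φ) xb := by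
  have : ContinuousAt (fderiv ℝ Φ) xb :=
    (hPhi.fderiv_right (m := 1) (by norm_num)).continuousAt
  exact (ContinuousLinearMap.adjoint (𝕜 := ℝ) (E := Ev n) (F := Ev m)).continuous.continuousAt.comp
    this

lemma grad_cont (hphi : ContDiffAt ℝ 2 φ₀ xb) : ContinuousAt (gradient φ₀) xb :=
  (hess_symm hphi).1.continuousAt

lemma clm_seq {E F : Type*} [NormedAddCommGroup E] [NormedSpace ℝ E] [NormedAddCommGroup F]
    [NormedSpace ℝ F] {A : ℕ → E →L[ℝ] F} {A0 : E →L[ℝ] F} {x : ℕ → E} {x0 : E}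
    (hA : Tendsto A atTop (𝓝 A0)) (hx : Tendsto x atTop (𝓝 x0)) :
    Tendsto (fun k => A k (x k)) atTop (𝓝 (A0 x0)) :=
  ((isBoundedBilinearMap_apply (𝕜 := ℝ) (E := E) (F := F)).continuous.tendsto
      (A0, x0)).comp (hA.prodMk_nhds hx)

lemma kkt_seq (hphi : ContDiffAt ℝ 2 φ₀ xb) (hPhi : ContDiffAt ℝ 2 Φ xb)
    (h0 : gradient φ₀ xb + adjD Φ xb vb = 0)
    {xk : ℕ → Ev n} {vk : ℕ → Ev m} {c : ℕ → ℝ} {ξ : Ev n} {η : Ev m}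
    (hx : Tendsto xk atTop (𝓝 xb))
    (hcx : Tendsto (fun k => c k • (xk k - xb)) atTop (𝓝 ξ))
    (hcv : Tendsto (fun k => c k • (vk k - vb)) atTop (𝓝 η)) :
    Tendsto (fun k => c k • (gradient φ₀ (xk k) + adjD Φ (xk k) (vk k))) atTop
      (𝓝 (HessOp φ₀ Φ vb xb ξ + adjD Φ xb η)) := by
  have h1 := deriv_seq (gradPsi_deriv hphi hPhi vb) hx hcx
  have h2 : Tendsto (fun k => adjD Φ (xk k) (c k • (vk k - vb))) atTop (𝓝 (adjD Φ xb η)) :=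
    clm_seq ((adjD_cont hPhi).tendsto.comp hx) hcv
  refine (h1.add h2).congr fun k => ?_
  simp only [h0, sub_zero]
  rw [ContinuousLinearMap.map_smul, ← smul_add, ContinuousLinearMap.map_sub]
  rw [add_assoc, add_sub_cancel]

lemma localMin_iff (hdom : Φ xb ∈ θ.dom) : LocalMin φ₀ Φ θ xb ↔
    ∀ᶠ x in 𝓝 xb, Φ x ∈ θ.dom → φ₀ xb + θ.val (Φ xb) ≤ φ₀ x + θ.val (Φ x) := by
  have e : ∀ x, (((φ₀ xb : ℝ) : EReal) + θ.eval (Φ xb) ≤ ((φ₀ x : ℝ) : EReal) + θ.eval (Φ x)) ↔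
      (Φ x ∈ θ.dom → φ₀ xb + θ.val (Φ xb) ≤ φ₀ x + θ.val (Φ x)) := by
    intro x
    unfold CPWL.eval
    rw [if_pos hdom]
    by_cases hx : Φ x ∈ θ.dom
    · rw [if_pos hx]
      simp only [hx, forall_true_left]
      norm_cast
    · rw [if_neg hx]
      simp [hx]
  unfold LocalMin
  simp only [e]
  constructor
  · rintro ⟨U, hU, h⟩
    exact Filter.mem_of_superset hU h
  · intro h
    exact ⟨_, h, fun x hx => hx⟩

lemma unique_polar (hvb : vb ∈ LamCom φ₀ Φ θ xb) (hΛ : LamCom φ₀ Φ θ xb = {vb}) (η : Ev m)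
    (h1 : ∀ u, ⟪η, fderiv ℝ Φ xb u⟫ = 0) (h2 : ∀ k ∈ θ.Kc (Φ xb) vb, ⟪η, k⟫ ≤ 0) : η = 0 := by
  obtain ⟨ε, hε, h⟩ := CPWL.polar_subdiff θ hvb.2 h2
  have h3 : adjD Φ xb η = 0 := by
    refine ext_inner_right ℝ fun u => ?_
    rw [adjD_inner, h1, inner_zero_left]
  have h4 : vb + ε • η ∈ LamCom φ₀ Φ θ xb := by
    refine ⟨?_, h ε hε.le le_rfl⟩
    rw [map_add, map_smul, h3, smul_zero, add_zero]
    exact hvb.1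
  rw [hΛ, mem_singleton_iff] at h4
  have : ε • η = 0 := by simpa using h4
  exact (smul_eq_zero.1 this).resolve_left hε.ne'

lemma mreg (hPhi : ContDiffAt ℝ 2 Φ xb) (hvb : vb ∈ LamCom φ₀ Φ θ xb)
    (hΛ : LamCom φ₀ Φ θ xb = {vb}) :
    ∃ κ : ℝ, 0 < κ ∧ (∃ u : Ev m → Ev n, (∀ y, fderiv ℝ Φ xb (u y) - y ∈ θ.Kc (Φ xb) vb) ∧
      ∀ y, ‖u y‖ ≤ κ * ‖y‖) ∧
     ∃ ρ : ℝ, 0 < ρ ∧ ∀ x, ‖x - xb‖ < ρ → ∀ e, ‖e‖ < ρ →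
      ∃ x', ‖x' - x‖ ≤ 2 * κ * ‖e‖ ∧ Φ x' - Φ x - e ∈ θ.Kc (Φ xb) vb := by
  obtain ⟨κ, hκ, u, hu, hu0, hul⟩ := right_inv (fderiv ℝ Φ xb) (θ.Kc (Φ xb) vb)
    (CPWL.Kc_zero θ) (fun _ h _ h' => CPWL.Kc_add θ h h') (fun _ ht _ h => CPWL.Kc_smul θ h ht)
    (surj_of_polar _ _ (CPWL.Kc_zero θ) (fun _ h _ h' => CPWL.Kc_add θ h h')
      (fun _ ht _ h => CPWL.Kc_smul θ h ht) (unique_polar hvb hΛ))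
  refine ⟨κ, hκ, ⟨u, hu, fun y => by simpa [hu0] using hul y 0⟩, ?_⟩
  exact metric_reg _ (hPhi.hasStrictFDerivAt (by norm_num)) _ u hκ hu hu0 hul

end KKTbasic

section Nec

variable {n m : ℕ} {θ : CPWL m} {φ₀ : Ev n → ℝ} {Φ : Ev n → Ev m} {xb : Ev n} {vb : Ev m}

lemma isol_unique (hvb : vb ∈ LamCom φ₀ Φ θ xb)
    (hS : IsolCalm (fun p : Ev n × Ev m => SKKT φ₀ Φ θ p.1 p.2) (xb, vb)) :
    LamCom φ₀ Φ θ xb = {vb} := by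
  obtain ⟨c, hc, U, hU, V, hV, h⟩ := hS
  refine Subset.antisymm (fun v hv => ?_) (by rintro _ rfl; exact hvb)
  have hcont : Tendsto (fun t : ℝ => (xb, vb + t • (v - vb))) (𝓝[>] 0) (𝓝 (xb, vb)) :=
    tendsto_const_nhds.prodMk_nhds (CPWL.tendsto_ray vb (v - vb))
  have h1 : ∀ᶠ t : ℝ in 𝓝[>] 0, t < 1 :=
    (tendsto_id.mono_left nhdsWithin_le_nhds : Tendsto id (𝓝[>] (0:ℝ)) (𝓝 0)).eventually_lt_const
      one_pos
  obtain ⟨t, ⟨htV, ht1⟩, ht0⟩ := (((hcont.eventually hV).and h1).and self_mem_nhdsWithin).exists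
  have ht0 : 0 < t := ht0
  have hmem : (xb, vb + t • (v - vb)) ∈ SKKT φ₀ Φ θ 0 0 := by
    refine ⟨?_, ?_⟩
    · show gradient φ₀ xb + adjD Φ xb (vb + t • (v - vb)) = 0
      have e1 := hvb.1
      have e2 := hv.1
      have e3 : adjD Φ xb v = adjD Φ xb vb := by
        have := e2.trans e1.symm
        exact add_left_cancel this
      rw [map_add, map_smul, map_sub, e3, sub_self, smul_zero, add_zero, e1]
    · show vb + t • (v - vb) ∈ θ.subdiff (Φ xb + 0)
      rw [add_zero]
      refine ⟨hvb.2.1, fun z' hz' => ?_⟩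
      have a1 := hvb.2.2 z' hz'
      have a2 := hv.2.2 z' hz'
      rw [inner_add_left, real_inner_smul_left, inner_sub_left]
      nlinarith
  have h2 := h 0 (mem_of_mem_nhds hU) _ ⟨hmem, htV⟩
  simp only [Prod.fst_zero, Prod.snd_zero, norm_zero, add_zero, mul_zero] at h2
  have h3 := norm_le_zero_iff.1 h2
  have h4 : t • (v - vb) = 0 := by
    have := congrArg Prod.snd h3
    simpa using this
  have h5 := (smul_eq_zero.1 h4).resolve_left ht0.ne'
  exact mem_singleton_iff.2 (sub_eq_zero.1 h5)

lemma inv_tendsto_zero_of {E : Type*} [NormedAddCommGroup E] [NormedSpace ℝ E]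
    {c : ℕ → ℝ} (hc0 : ∀ k, 0 ≤ c k) {e : ℕ → E} {w : E}
    (he : Tendsto e atTop (𝓝 0)) (hw : Tendsto (fun k => c k • e k) atTop (𝓝 w)) (hw0 : w ≠ 0) :
    (∀ᶠ k in atTop, 0 < c k) ∧ Tendsto (fun k => (c k)⁻¹) atTop (𝓝 0) := by
  have hwn : 0 < ‖w‖ := norm_pos_iff.2 hw0
  have h1 : ∀ᶠ k in atTop, ‖w‖ / 2 < ‖c k • e k‖ :=
    hw.norm.eventually_const_lt (half_lt_self hwn)
  have h2 : ∀ᶠ k in atTop, 0 < c k := by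
    filter_upwards [h1] with k hk
    rcases (hc0 k).eq_or_lt with h | h
    · rw [← h, zero_smul, norm_zero] at hk; linarith
    · exact h
  refine ⟨h2, ?_⟩
  have h3 : Tendsto (fun k => 2 / ‖w‖ * ‖e k‖) atTop (𝓝 0) := by
    simpa using he.norm.const_mul (2 / ‖w‖)
  refine squeeze_zero' (Eventually.of_forall fun k => inv_nonneg.2 (hc0 k)) ?_ h3
  filter_upwards [h1, h2] with k hk hck
  rw [norm_smul, Real.norm_of_nonneg (hc0 k)] at hk
  rw [inv_eq_one_div, div_le_iff₀ hck, div_mul_eq_mul_div, div_mul_eq_mul_div, le_div_iff₀ hwn]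
  linarith

/-- Core computation: approximating sequences with suitable scaling contradict isolated calmness. -/
lemma isol_seq (hphi : ContDiffAt ℝ 2 φ₀ xb) (hPhi : ContDiffAt ℝ 2 Φ xb)
    (hvb : vb ∈ LamCom φ₀ Φ θ xb)
    (hS : IsolCalm (fun p : Ev n × Ev m => SKKT φ₀ Φ θ p.1 p.2) (xb, vb))
    {ξ : Ev n} {w : Ev m} (hcr : HessOp φ₀ Φ vb xb ξ + adjD Φ xb w = 0)
    {zk vk : ℕ → Ev m} {c t : ℕ → ℝ} (ht : Tendsto t atTop (𝓝 0))
    (hct : ∀ᶠ k in atTop, 0 < c k ∧ c k * t k = 1)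
    (hsub : ∀ k, vk k ∈ θ.subdiff (zk k))
    (hz : Tendsto zk atTop (𝓝 (Φ xb))) (hv : Tendsto vk atTop (𝓝 vb))
    (hcz : Tendsto (fun k => c k • (zk k - Φ xb)) atTop (𝓝 (fderiv ℝ Φ xb ξ)))
    (hcv : Tendsto (fun k => c k • (vk k - vb)) atTop (𝓝 w)) : ξ = 0 := by
  obtain ⟨cc, hcc, U, hU, V, hV, h⟩ := hS
  let xk : ℕ → Ev n := fun k => xb + t k • ξ
  have hx : Tendsto xk atTop (𝓝 xb) := by
    simpa using (ht.smul_const ξ).const_add xb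
  have hcx : Tendsto (fun k => c k • (xk k - xb)) atTop (𝓝 ξ) := by
    refine tendsto_const_nhds.congr' ?_
    filter_upwards [hct] with k hk
    simp [xk, smul_smul, hk.2]
  have hg := kkt_seq hphi hPhi hvb.1 hx hcx hcv
  rw [hcr] at hg
  have hΦ := deriv_seq (hPhi.differentiableAt (by norm_num)).hasFDerivAt hx hcx
  let p2 : ℕ → Ev m := fun k => zk k - Φ (xk k)
  let p1 : ℕ → Ev n := fun k => gradient φ₀ (xk k) + adjD Φ (xk k) (vk k)
  have hp2 : Tendsto (fun k => c k • p2 k) atTop (𝓝 0) := by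
    have := hcz.sub hΦ
    rw [sub_self] at this
    refine this.congr fun k => ?_
    simp only [p2, smul_sub]; abel
  have hp20 : Tendsto p2 atTop (𝓝 0) := by
    have := hz.sub (hPhi.continuousAt.tendsto.comp hx)
    rwa [sub_self] at this
  have hp10 : Tendsto p1 atTop (𝓝 0) := by
    have h1 := ((grad_cont hphi).tendsto.comp hx).add
      (clm_seq ((adjD_cont hPhi).tendsto.comp hx) hv)
    rw [hvb.1] at h1
    exact h1
  have hpU : ∀ᶠ k in atTop, (p1 k, p2 k) ∈ U := by
    have := hp10.prodMk_nhds hp20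
    exact this.eventually hU
  have hqV : ∀ᶠ k in atTop, (xk k, vk k) ∈ V := (hx.prodMk_nhds hv).eventually hV
  have hlim : Tendsto (fun k => cc * (‖c k • p1 k‖ + ‖c k • p2 k‖)) atTop (𝓝 0) := by
    have := (hg.norm.add hp2.norm).const_mul cc
    rw [norm_zero, norm_zero, add_zero, mul_zero] at this
    exact this
  have hle : ‖ξ‖ ≤ 0 := by
    refine le_of_tendsto_of_tendsto tendsto_const_nhds hlim ?_
    filter_upwards [hpU, hqV, hct] with k h1 h2 h3
    have hmem : (xk k, vk k) ∈ SKKT φ₀ Φ θ (p1 k) (p2 k) := by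
      refine ⟨rfl, ?_⟩
      show vk k ∈ θ.subdiff (Φ (xk k) + (zk k - Φ (xk k)))
      rw [add_sub_cancel]; exact hsub k
    have h4 := h (p1 k, p2 k) h1 _ ⟨hmem, h2⟩
    have h5 : ‖xk k - xb‖ ≤ ‖(xk k, vk k) - (xb, vb)‖ := norm_fst_le ((xk k, vk k) - (xb, vb))
    have h6 := mul_le_mul_of_nonneg_left (h5.trans h4) h3.1.le
    have h7 : c k * ‖xk k - xb‖ = ‖ξ‖ := by
      have : c k • (xk k - xb) = ξ := by simp [xk, smul_smul, h3.2]
      rw [← this, norm_smul, Real.norm_of_nonneg h3.1.le]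
    rw [h7] at h6
    rw [norm_smul, norm_smul, Real.norm_of_nonneg h3.1.le]
    refine h6.trans (le_of_eq ?_)
    ring
  exact norm_le_zero_iff.1 hle

lemma isol_noncrit (hphi : ContDiffAt ℝ 2 φ₀ xb) (hPhi : ContDiffAt ℝ 2 Φ xb)
    (hvb : vb ∈ LamCom φ₀ Φ θ xb)
    (hS : IsolCalm (fun p : Ev n × Ev m => SKKT φ₀ Φ θ p.1 p.2) (xb, vb)) :
    ¬ IsCriticalCom φ₀ Φ θ xb vb := by
  rintro ⟨ξ, hξ, w, ⟨q, c, hq, hc, hq1, hq2⟩, hcr⟩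
  apply hξ
  by_cases h0 : (fderiv ℝ Φ xb ξ, w) = 0
  · have h1 : fderiv ℝ Φ xb ξ = 0 := congrArg Prod.fst h0
    have h2 : w = 0 := congrArg Prod.snd h0
    refine isol_seq hphi hPhi hvb hS hcr (zk := fun _ => Φ xb) (vk := fun _ => vb)
      (c := fun k => (k : ℝ) + 1) (t := fun k => ((k : ℝ) + 1)⁻¹)
      (tendsto_nhds_of_tendsto_nhdsWithin CPWL.seq_inv) (Eventually.of_forall fun k => ?_)
      (fun _ => hvb.2) tendsto_const_nhds tendsto_const_nhds ?_ ?_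
    · have : (0:ℝ) < k + 1 := by positivity
      exact ⟨this, mul_inv_cancel₀ this.ne'⟩
    · simp [h1]
    · simp [h2]
  · have he : Tendsto (fun k => q k - (Φ xb, vb)) atTop (𝓝 0) := by
      have := hq1.sub_const (Φ xb, vb)
      rwa [sub_self] at this
    obtain ⟨h1, h2⟩ := inv_tendsto_zero_of hc he hq2 h0
    refine isol_seq hphi hPhi hvb hS hcr (zk := fun k => (q k).1) (vk := fun k => (q k).2)
      (c := c) (t := fun k => (c k)⁻¹) h2 ?_ hq ?_ ?_ ?_ ?_
    · filter_upwards [h1] with k hk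
      exact ⟨hk, mul_inv_cancel₀ hk.ne'⟩
    · exact (continuous_fst.tendsto _).comp hq1
    · exact (continuous_snd.tendsto _).comp hq1
    · exact (continuous_fst.tendsto _).comp hq2
    · exact (continuous_snd.tendsto _).comp hq2

lemma second_nec (hphi : ContDiffAt ℝ 2 φ₀ xb) (hPhi : ContDiffAt ℝ 2 Φ xb)
    (hvb : vb ∈ LamCom φ₀ Φ θ xb) (hΛ : LamCom φ₀ Φ θ xb = {vb}) (hmin : LocalMin φ₀ Φ θ xb)
    (u : Ev n) (hu : fderiv ℝ Φ xb u ∈ θ.Kc (Φ xb) vb) :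
    0 ≤ ⟪HessOp φ₀ Φ vb xb u, u⟫ := by
  obtain ⟨κ, hκ, -, ρ, hρ, hreg⟩ := mreg hPhi hvb hΛ
  set A := fderiv ℝ Φ xb with hA
  have hmin' := (localMin_iff hvb.2.1).1 hmin
  let t : ℕ → ℝ := fun k => ((k : ℝ) + 1)⁻¹
  let c : ℕ → ℝ := fun k => (k : ℝ) + 1
  have hcp : ∀ k, 0 < c k := fun k => by simp only [c]; positivity
  have htp : ∀ k, 0 < t k := fun k => inv_pos.2 (hcp k)
  have hct : ∀ k, c k * t k = 1 := fun k => mul_inv_cancel₀ (hcp k).ne'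
  have ht : Tendsto t atTop (𝓝 0) := tendsto_nhds_of_tendsto_nhdsWithin CPWL.seq_inv
  let yk : ℕ → Ev n := fun k => xb + t k • u
  have hy : Tendsto yk atTop (𝓝 xb) := by
    simpa using (ht.smul_const u).const_add xb
  have hcy : ∀ k, c k • (yk k - xb) = u := fun k => by simp [yk, smul_smul, hct]
  have hcy' : Tendsto (fun k => c k • (yk k - xb)) atTop (𝓝 u) := by
    simp only [hcy]; exact tendsto_const_nhds
  have hΦ := deriv_seq (hPhi.differentiableAt (by norm_num)).hasFDerivAt hy hcy'
  let e : ℕ → Ev m := fun k => -(Φ (yk k) - Φ xb - t k • A u)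
  have hce : Tendsto (fun k => c k • e k) atTop (𝓝 0) := by
    have := (hΦ.sub_const (A u)).neg
    rw [sub_self, neg_zero] at this
    refine this.congr fun k => ?_
    simp only [e, smul_neg, smul_sub, smul_smul, hct, one_smul]
  have he : Tendsto e atTop (𝓝 0) := by
    have := ht.smul hce
    rw [zero_smul] at this
    refine this.congr fun k => ?_
    rw [smul_smul, mul_comm, hct, one_smul]
  have hex : ∀ k, ∃ x', (‖yk k - xb‖ < ρ → ‖e k‖ < ρ → ‖x' - yk k‖ ≤ 2 * κ * ‖e k‖ ∧
      Φ x' - Φ (yk k) - e k ∈ θ.Kc (Φ xb) vb) := by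
    intro k
    by_cases h1 : ‖yk k - xb‖ < ρ
    · by_cases h2 : ‖e k‖ < ρ
      · obtain ⟨x', hx'⟩ := hreg _ h1 _ h2
        exact ⟨x', fun _ _ => hx'⟩
      · exact ⟨0, fun _ h => absurd h h2⟩
    · exact ⟨0, fun h => absurd h h1⟩
  choose xk hxk using hex
  have hev : ∀ᶠ k in atTop, ‖xk k - yk k‖ ≤ 2 * κ * ‖e k‖ ∧
      Φ (xk k) - Φ (yk k) - e k ∈ θ.Kc (Φ xb) vb := by
    have a1 : Tendsto (fun k => ‖yk k - xb‖) atTop (𝓝 0) := by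
      simpa using (hy.sub_const xb).norm
    have a2 : Tendsto (fun k => ‖e k‖) atTop (𝓝 0) := by simpa using he.norm
    filter_upwards [a1.eventually_lt_const hρ, a2.eventually_lt_const hρ] with k h1 h2
    exact hxk k h1 h2
  have hd : Tendsto (fun k => c k • (xk k - yk k)) atTop (𝓝 0) := by
    refine squeeze_zero_norm' (a := fun k => 2 * κ * ‖c k • e k‖) ?_ (by
      simpa using hce.norm.const_mul (2 * κ))
    filter_upwards [hev] with k hk
    rw [norm_smul, norm_smul]
    have := mul_le_mul_of_nonneg_left hk.1 (norm_nonneg (c k))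
    linarith
  have hcx : Tendsto (fun k => c k • (xk k - xb)) atTop (𝓝 u) := by
    have := hd.add hcy'
    rw [zero_add] at this
    refine this.congr fun k => ?_
    rw [← smul_add]; congr 1; abel
  have hx : Tendsto xk atTop (𝓝 xb) := by
    have := (ht.smul hcx).add_const xb
    rw [zero_smul, zero_add] at this
    refine this.congr fun k => ?_
    rw [smul_smul, mul_comm, hct, one_smul, sub_add_cancel]
  have hL := Lag_contDiff hphi hPhi vb
  have hg0 : gradient (fun y => φ₀ y + ⟪Φ y, vb⟫) xb = 0 := by
    rw [gradL_eq vb (ev_diff hphi hPhi).self_of_nhds]; exact hvb.1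
  have hT := taylor_seq hL hg0 hx hcx
  have hT' : 0 ≤ (1 / 2 : ℝ) * ⟪HessOp φ₀ Φ vb xb u, u⟫ := by
    refine ge_of_tendsto hT ?_
    filter_upwards [hev, hx.eventually hmin',
      (hPhi.continuousAt.tendsto.comp hx).eventually (θ.ev_Kc hvb.2)] with k h1 h2 h3
    have hK : Φ (xk k) - Φ xb ∈ θ.Kc (Φ xb) vb := by
      have := θ.Kc_add (θ.Kc_smul hu (htp k).le) h1.2
      have e1 : t k • A u + (Φ (xk k) - Φ (yk k) - e k) = Φ (xk k) - Φ xb := by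
        simp only [e]; abel
      rwa [e1] at this
    obtain ⟨h4, h5⟩ := h3 hK
    have h6 := h2 h4
    refine mul_nonneg (sq_nonneg _) ?_
    simp only [Function.comp] at h5
    rw [h5, inner_sub_right, real_inner_comm (Φ (xk k)), real_inner_comm (Φ xb)] at h6
    linarith
  linarith

lemma hess_symm' (hphi : ContDiffAt ℝ 2 φ₀ xb) (hPhi : ContDiffAt ℝ 2 Φ xb) (u w : Ev n) :
    ⟪HessOp φ₀ Φ vb xb u, w⟫ = ⟪HessOp φ₀ Φ vb xb w, u⟫ :=
  (hess_symm (Lag_contDiff hphi hPhi vb)).2 u w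

lemma second_suff (hphi : ContDiffAt ℝ 2 φ₀ xb) (hPhi : ContDiffAt ℝ 2 Φ xb)
    (hvb : vb ∈ LamCom φ₀ Φ θ xb) (hΛ : LamCom φ₀ Φ θ xb = {vb}) (hmin : LocalMin φ₀ Φ θ xb)
    (hnc : ¬ IsCriticalCom φ₀ Φ θ xb vb)
    (u : Ev n) (hu0 : u ≠ 0) (hu : fderiv ℝ Φ xb u ∈ θ.Kc (Φ xb) vb) :
    0 < ⟪HessOp φ₀ Φ vb xb u, u⟫ := by
  have hnec := second_nec hphi hPhi hvb hΛ hmin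
  rcases (hnec u hu).eq_or_lt with h0 | h0
  swap
  · exact h0
  exfalso
  set H := HessOp φ₀ Φ vb xb with hH
  set A := fderiv ℝ Φ xb with hA
  have hb : ∀ u', A u' ∈ θ.Kc (Φ xb) vb → 0 ≤ ⟪H u, u'⟫ := by
    intro u' hu'
    by_contra hneg
    push Not at hneg
    have hq : ∀ s : ℝ, 0 ≤ s → 0 ≤ 2 * s * ⟪H u, u'⟫ + s ^ 2 * ⟪H u', u'⟫ := by
      intro s hs
      have h1 := hnec (u + s • u') (by
        rw [map_add, map_smul]; exact θ.Kc_add hu (θ.Kc_smul hu' hs))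
      have h2 : ⟪H u', u⟫ = ⟪H u, u'⟫ := hess_symm' hphi hPhi _ _
      rw [map_add, map_smul, inner_add_left, inner_add_right, inner_add_right,
        real_inner_smul_left, real_inner_smul_left, inner_smul_right, inner_smul_right] at h1
      rw [h2, ← h0] at h1
      linarith
    have hB : 0 ≤ ⟪H u', u'⟫ := hnec u' hu'
    have h3 := hq (-⟪H u, u'⟫ / (⟪H u', u'⟫ + 1)) (by
      apply div_nonneg <;> linarith)
    set P := ⟪H u, u'⟫
    set B := ⟪H u', u'⟫
    have h4 : 2 * (-P / (B + 1)) * P + (-P / (B + 1)) ^ 2 * B = - (P ^ 2 * (B + 2)) / (B + 1) ^ 2 := by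
      field_simp; ring
    rw [h4] at h3
    have h5 : 0 < P ^ 2 * (B + 2) / (B + 1) ^ 2 := by
      have : 0 < P ^ 2 := by nlinarith
      positivity
    rw [neg_div] at h3
    linarith
  obtain ⟨w, hw, mu, la, hmu, hla, hmu0, hla0, hrep⟩ := θ.Kc_farkas (z := Φ xb) (v := vb)
    (A : Ev n →ₗ[ℝ] Ev m) (-(innerₗ (Ev n) (H u))) (fun u' hu' => by
      have := hb u' hu'
      simpa using this)
  have hw' : ∀ u', -⟪H u, u'⟫ = ⟪w, A u'⟫ := fun u' => by simpa using hw u'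
  have hpol : ∀ k ∈ θ.Kc (Φ xb) vb, ⟪w, k⟫ ≤ 0 := by
    intro k hk
    rw [hrep, inner_add_left, sum_inner, sum_inner]
    refine add_nonpos (Finset.sum_nonpos fun i _ => ?_) (Finset.sum_nonpos fun i _ => ?_)
    · rw [real_inner_smul_left]
      by_cases hi : i ∈ θ.Iact (Φ xb)
      · exact mul_nonpos_of_nonneg_of_nonpos (hmu i) (hk.1 i hi)
      · rw [hmu0 i hi, zero_mul]
    · rw [real_inner_smul_left]
      by_cases hi : i ∈ θ.Kact (Φ xb)
      · refine mul_nonpos_of_nonneg_of_nonpos (hla i) ?_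
        have := hk.2 i hi
        rw [inner_sub_left]; linarith
      · rw [hla0 i hi, zero_mul]
  refine hnc ⟨u, hu0, w, θ.Dsub_mem hvb.2 hu hpol ?_, ?_⟩
  · have := hw' u
    rw [← h0] at this
    simpa using this.symm
  · refine ext_inner_right ℝ fun u' => ?_
    rw [inner_add_left, adjD_inner, ← hw' u', inner_zero_left]
    exact add_neg_cancel _

end Nec

section Suf

variable {n m : ℕ} {θ : CPWL m} {φ₀ : Ev n → ℝ} {Φ : Ev n → Ev m} {xb : Ev n} {vb : Ev m}

lemma sphere_subseq {E : Type*} [NormedAddCommGroup E] [NormedSpace ℝ E] [ProperSpace E]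
    (e : ℕ → E) (he : ∀ k, e k ≠ 0) :
    ∃ ξ : E, ‖ξ‖ = 1 ∧ ∃ s : ℕ → ℕ, StrictMono s ∧
      Tendsto (fun k => ‖e (s k)‖⁻¹ • e (s k)) atTop (𝓝 ξ) := by
  obtain ⟨ξ, hξ, s, hs, hlim⟩ := (isCompact_sphere (0 : E) 1).tendsto_subseq
    (x := fun k => ‖e k‖⁻¹ • e k) (fun k => by
      rw [mem_sphere_zero_iff_norm, norm_smul, norm_inv, norm_norm]
      exact inv_mul_cancel₀ (norm_ne_zero_iff.2 (he k)))
  exact ⟨ξ, mem_sphere_zero_iff_norm.1 hξ, s, hs, hlim⟩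

lemma suff_isol (hphi : ContDiffAt ℝ 2 φ₀ xb) (hPhi : ContDiffAt ℝ 2 Φ xb)
    (hvb : vb ∈ LamCom φ₀ Φ θ xb) (hΛ : LamCom φ₀ Φ θ xb = {vb})
    (hpos : ∀ u : Ev n, u ≠ 0 → fderiv ℝ Φ xb u ∈ θ.Kc (Φ xb) vb →
          0 < ⟪HessOp φ₀ Φ vb xb u, u⟫) :
    IsolCalm (fun p : Ev n × Ev m => SKKT φ₀ Φ θ p.1 p.2) (xb, vb) := by
  by_contra hcon
  have hex : ∀ k : ℕ, ∃ p q : Ev n × Ev m, ‖p‖ < ((k : ℝ) + 1)⁻¹ ∧ q ∈ SKKT φ₀ Φ θ p.1 p.2 ∧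
      ‖q - (xb, vb)‖ < ((k : ℝ) + 1)⁻¹ ∧ ((k : ℝ) + 1) * (‖p.1‖ + ‖p.2‖) < ‖q - (xb, vb)‖ := by
    intro k
    by_contra hk
    push Not at hk
    have hk0 : (0:ℝ) < ((k : ℝ) + 1)⁻¹ := by positivity
    refine hcon ⟨(k : ℝ) + 1, by positivity, Metric.ball 0 ((k : ℝ) + 1)⁻¹,
      Metric.ball_mem_nhds _ hk0, Metric.ball (xb, vb) ((k : ℝ) + 1)⁻¹,
      Metric.ball_mem_nhds _ hk0, fun p hp q hq => ?_⟩
    exact hk p q (by simpa using hp) hq.1 (by simpa [dist_eq_norm] using hq.2)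
  choose p q hp hS hq hpq using hex
  have hne : ∀ k, q k - (xb, vb) ≠ 0 := fun k => by
    refine norm_pos_iff.1 (lt_of_le_of_lt ?_ (hpq k))
    positivity
  obtain ⟨ξη, hn, s, hs, hlim⟩ := sphere_subseq _ hne
  have hsi : Tendsto (fun k => ((s k : ℝ) + 1)⁻¹) atTop (𝓝 0) :=
    (tendsto_nhds_of_tendsto_nhdsWithin CPWL.seq_inv).comp hs.tendsto_atTop
  let c : ℕ → ℝ := fun k => ‖q (s k) - (xb, vb)‖⁻¹
  have hc : ∀ k, 0 ≤ c k := fun k => inv_nonneg.2 (norm_nonneg _)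
  have hqlim : Tendsto (fun k => q (s k)) atTop (𝓝 (xb, vb)) := by
    rw [tendsto_iff_norm_sub_tendsto_zero]
    exact squeeze_zero (fun _ => norm_nonneg _) (fun k => (hq (s k)).le) hsi
  have hplim : Tendsto (fun k => p (s k)) atTop (𝓝 0) :=
    squeeze_zero_norm (fun k => (hp (s k)).le) hsi
  have hcp : ∀ k, c k * (‖(p (s k)).1‖ + ‖(p (s k)).2‖) ≤ ((s k : ℝ) + 1)⁻¹ := by
    intro k
    have h1 := hpq (s k)
    have h2 : 0 < ‖q (s k) - (xb, vb)‖ := norm_pos_iff.2 (hne _)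
    have h3 : (0:ℝ) < (s k : ℝ) + 1 := by positivity
    simp only [c]
    rw [inv_mul_le_iff₀ h2, ← div_eq_mul_inv, le_div_iff₀ h3]
    linarith
  have hcp1 : Tendsto (fun k => c k • (p (s k)).1) atTop (𝓝 0) := by
    refine squeeze_zero_norm (fun k => ?_) hsi
    rw [norm_smul, Real.norm_of_nonneg (hc k)]
    refine le_trans (mul_le_mul_of_nonneg_left ?_ (hc k)) (hcp k)
    linarith [norm_nonneg (p (s k)).2]
  have hcp2 : Tendsto (fun k => c k • (p (s k)).2) atTop (𝓝 0) := by
    refine squeeze_zero_norm (fun k => ?_) hsi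
    rw [norm_smul, Real.norm_of_nonneg (hc k)]
    refine le_trans (mul_le_mul_of_nonneg_left ?_ (hc k)) (hcp k)
    linarith [norm_nonneg (p (s k)).1]
  have hx : Tendsto (fun k => (q (s k)).1) atTop (𝓝 xb) := (continuous_fst.tendsto _).comp hqlim
  have hv : Tendsto (fun k => (q (s k)).2) atTop (𝓝 vb) := (continuous_snd.tendsto _).comp hqlim
  have hp2 : Tendsto (fun k => (p (s k)).2) atTop (𝓝 0) := (continuous_snd.tendsto _).comp hplim
  have hcx : Tendsto (fun k => c k • ((q (s k)).1 - xb)) atTop (𝓝 ξη.1) :=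
    (continuous_fst.tendsto _).comp hlim
  have hcv : Tendsto (fun k => c k • ((q (s k)).2 - vb)) atTop (𝓝 ξη.2) :=
    (continuous_snd.tendsto _).comp hlim
  have hΦ := deriv_seq (hPhi.differentiableAt (by norm_num)).hasFDerivAt hx hcx
  have hz : Tendsto (fun k => Φ (q (s k)).1 + (p (s k)).2) atTop (𝓝 (Φ xb)) := by
    have := (hPhi.continuousAt.tendsto.comp hx).add hp2
    rw [add_zero] at this
    exact this
  have hcz : Tendsto (fun k => c k • (Φ (q (s k)).1 + (p (s k)).2 - Φ xb)) atTop
      (𝓝 (fderiv ℝ Φ xb ξη.1)) := by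
    have := hΦ.add hcp2
    rw [add_zero] at this
    refine this.congr fun k => ?_
    rw [← smul_add]; congr 1; abel
  obtain ⟨h1, h2, h3⟩ := θ.tangent_props hvb.2 (fun k => (hS (s k)).2) hc hz hv hcz hcv
  have hK := kkt_seq hphi hPhi hvb.1 hx hcx hcv
  have hK0 : HessOp φ₀ Φ vb xb ξη.1 + adjD Φ xb ξη.2 = 0 := by
    refine tendsto_nhds_unique hK (hcp1.congr fun k => ?_)
    rw [(hS (s k)).1]
  have hξ : ξη.1 = 0 := by
    by_contra hne
    have h4 := hpos _ hne h1
    have h5 := congrArg (fun y => ⟪y, ξη.1⟫) hK0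
    simp only [inner_add_left, adjD_inner, inner_zero_left] at h5
    linarith
  have hη : ξη.2 = 0 := by
    refine unique_polar hvb hΛ _ (fun u => ?_) h3
    rw [hξ, map_zero, zero_add] at hK0
    rw [← adjD_inner, hK0, inner_zero_left]
  have : ξη = 0 := Prod.ext hξ hη
  rw [this, norm_zero] at hn
  exact zero_ne_one hn

lemma suff_strict (hphi : ContDiffAt ℝ 2 φ₀ xb) (hPhi : ContDiffAt ℝ 2 Φ xb)
    (hvb : vb ∈ LamCom φ₀ Φ θ xb)
    (hpos : ∀ u : Ev n, u ≠ 0 → fderiv ℝ Φ xb u ∈ θ.Kc (Φ xb) vb →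
          0 < ⟪HessOp φ₀ Φ vb xb u, u⟫) :
    ∀ᶠ x in 𝓝 xb, x ≠ xb → Φ x ∈ θ.dom → φ₀ xb + θ.val (Φ xb) < φ₀ x + θ.val (Φ x) := by
  by_contra hcon
  rw [Filter.not_eventually] at hcon
  obtain ⟨y, hy, hy2⟩ := Filter.exists_seq_forall_of_frequently hcon
  push Not at hy2
  have hne : ∀ k, y k - xb ≠ 0 := fun k => sub_ne_zero.2 (hy2 k).1
  obtain ⟨u, hun, s, hs, hcx⟩ := sphere_subseq _ hne
  have hu0 : u ≠ 0 := by
    rintro rfl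
    simp at hun
  let c : ℕ → ℝ := fun k => ‖y (s k) - xb‖⁻¹
  have hc : ∀ k, 0 ≤ c k := fun k => inv_nonneg.2 (norm_nonneg _)
  have hx : Tendsto (fun k => y (s k)) atTop (𝓝 xb) := hy.comp hs.tendsto_atTop
  have hcx : Tendsto (fun k => c k • (y (s k) - xb)) atTop (𝓝 u) := hcx
  have hΦ := deriv_seq (hPhi.differentiableAt (by norm_num)).hasFDerivAt hx hcx
  have hφ := deriv_seq (hphi.differentiableAt (by norm_num)).hasFDerivAt hx hcx
  have hgr : fderiv ℝ φ₀ xb u + ⟪vb, fderiv ℝ Φ xb u⟫ = 0 := by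
    have h5 := congrArg (fun y => ⟪y, u⟫) hvb.1
    simp only [inner_add_left, adjD_inner, inner_zero_left, gradient_inner] at h5
    exact h5
  have hL := Lag_contDiff hphi hPhi vb
  have hg0 : gradient (fun y => φ₀ y + ⟪Φ y, vb⟫) xb = 0 := by
    rw [gradL_eq vb (ev_diff hphi hPhi).self_of_nhds]; exact hvb.1
  have hT := taylor_seq hL hg0 hx hcx
  have hK : fderiv ℝ Φ xb u ∈ θ.Kc (Φ xb) vb := by
    refine ⟨fun i hi => ?_, fun i hi => ?_⟩
    · refine le_of_tendsto (tendsto_const_nhds.inner hΦ) (Eventually.of_forall fun k => ?_)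
      rw [inner_smul_right]
      refine mul_nonpos_of_nonneg_of_nonpos (hc k) ?_
      have h1 := (hy2 (s k)).2.1 i
      have h2 : ⟪θ.d i, Φ xb⟫ = θ.be i := hi
      rw [inner_sub_right]; linarith
    · have h1 : Tendsto (fun k => ⟪θ.a i, c k • (Φ (y (s k)) - Φ xb)⟫ +
          c k • (φ₀ (y (s k)) - φ₀ xb)) atTop
          (𝓝 (⟪θ.a i, fderiv ℝ Φ xb u⟫ + fderiv ℝ φ₀ xb u)) :=
        (tendsto_const_nhds.inner hΦ).add hφ
      have h2 := le_of_tendsto h1 (b := 0) (Eventually.of_forall fun k => by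
        rw [inner_smul_right, smul_eq_mul, ← mul_add]
        refine mul_nonpos_of_nonneg_of_nonpos (hc k) ?_
        have a1 := (hy2 (s k)).2.2
        have a2 := θ.val_ge (Φ (y (s k))) i
        have a3 : θ.val (Φ xb) = ⟪θ.a i, Φ xb⟫ - θ.al i := hi
        rw [inner_sub_right]; linarith)
      linarith
  have h1 := hpos u hu0 hK
  have h2 : (1 / 2 : ℝ) * ⟪HessOp φ₀ Φ vb xb u, u⟫ ≤ 0 := by
    refine le_of_tendsto hT (Eventually.of_forall fun k => ?_)
    refine mul_nonpos_of_nonneg_of_nonpos (sq_nonneg _) ?_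
    have a1 := (hy2 (s k)).2.2
    have a2 := hvb.2.2 _ (hy2 (s k)).2.1
    rw [inner_sub_right, real_inner_comm (Φ (y (s k))), real_inner_comm (Φ xb)] at a2
    linarith
  linarith

end Suf

section Rob

variable {n m : ℕ} {θ : CPWL m} {φ₀ : Ev n → ℝ} {Φ : Ev n → Ev m} {xb : Ev n} {vb : Ev m}

lemma curve {κ ρ : ℝ} {K : Set (Ev m)}
    (hρ : 0 < ρ) (hreg : ∀ x, ‖x - xb‖ < ρ → ∀ e, ‖e‖ < ρ →
      ∃ x', ‖x' - x‖ ≤ 2 * κ * ‖e‖ ∧ Φ x' - Φ x - e ∈ K)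
    {x : Ev n} (hxρ : ‖x - xb‖ < ρ) (hd : DifferentiableAt ℝ Φ x) (u : Ev n) :
    ∃ xk : ℕ → Ev n, Tendsto xk atTop (𝓝 x) ∧
      Tendsto (fun k : ℕ => ((k : ℝ) + 1) • (xk k - x)) atTop (𝓝 u) ∧
      ∀ᶠ k : ℕ in atTop, Φ (xk k) - Φ x - ((k : ℝ) + 1)⁻¹ • fderiv ℝ Φ x u ∈ K := by
  set A := fderiv ℝ Φ x with hA
  let t : ℕ → ℝ := fun k => ((k : ℝ) + 1)⁻¹
  let c : ℕ → ℝ := fun k => (k : ℝ) + 1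
  have hcp : ∀ k, 0 < c k := fun k => by simp only [c]; positivity
  have htp : ∀ k, 0 < t k := fun k => inv_pos.2 (hcp k)
  have hct : ∀ k, c k * t k = 1 := fun k => mul_inv_cancel₀ (hcp k).ne'
  have ht : Tendsto t atTop (𝓝 0) := tendsto_nhds_of_tendsto_nhdsWithin CPWL.seq_inv
  let yk : ℕ → Ev n := fun k => x + t k • u
  have hy : Tendsto yk atTop (𝓝 x) := by
    simpa using (ht.smul_const u).const_add x
  have hcy : ∀ k, c k • (yk k - x) = u := fun k => by simp [yk, smul_smul, hct]
  have hcy' : Tendsto (fun k => c k • (yk k - x)) atTop (𝓝 u) := by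
    simp only [hcy]; exact tendsto_const_nhds
  have hΦ := deriv_seq hd.hasFDerivAt hy hcy'
  let e : ℕ → Ev m := fun k => -(Φ (yk k) - Φ x - t k • A u)
  have hce : Tendsto (fun k => c k • e k) atTop (𝓝 0) := by
    have := (hΦ.sub_const (A u)).neg
    rw [sub_self, neg_zero] at this
    refine this.congr fun k => ?_
    simp only [e, smul_neg, smul_sub, smul_smul, hct, one_smul]
  have he : Tendsto e atTop (𝓝 0) := by
    have := ht.smul hce
    rw [zero_smul] at this
    refine this.congr fun k => ?_
    rw [smul_smul, mul_comm, hct, one_smul]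
  have hex : ∀ k, ∃ x', (‖yk k - xb‖ < ρ → ‖e k‖ < ρ → ‖x' - yk k‖ ≤ 2 * κ * ‖e k‖ ∧
      Φ x' - Φ (yk k) - e k ∈ K) := by
    intro k
    by_cases h1 : ‖yk k - xb‖ < ρ
    · by_cases h2 : ‖e k‖ < ρ
      · obtain ⟨x', hx'⟩ := hreg _ h1 _ h2
        exact ⟨x', fun _ _ => hx'⟩
      · exact ⟨0, fun _ h => absurd h h2⟩
    · exact ⟨0, fun h => absurd h h1⟩
  choose xk hxk using hex
  have hev : ∀ᶠ k in atTop, ‖xk k - yk k‖ ≤ 2 * κ * ‖e k‖ ∧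
      Φ (xk k) - Φ (yk k) - e k ∈ K := by
    have a1 : Tendsto (fun k => ‖yk k - xb‖) atTop (𝓝 ‖x - xb‖) := (hy.sub_const xb).norm
    have a2 : Tendsto (fun k => ‖e k‖) atTop (𝓝 0) := by simpa using he.norm
    filter_upwards [a1.eventually_lt_const hxρ, a2.eventually_lt_const hρ] with k h1 h2
    exact hxk k h1 h2
  have hdd : Tendsto (fun k => c k • (xk k - yk k)) atTop (𝓝 0) := by
    refine squeeze_zero_norm' (a := fun k => 2 * κ * ‖c k • e k‖) ?_ (by
      simpa using hce.norm.const_mul (2 * κ))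
    filter_upwards [hev] with k hk
    rw [norm_smul, norm_smul]
    have := mul_le_mul_of_nonneg_left hk.1 (norm_nonneg (c k))
    linarith
  have hcx : Tendsto (fun k => c k • (xk k - x)) atTop (𝓝 u) := by
    have := hdd.add hcy'
    rw [zero_add] at this
    refine this.congr fun k => ?_
    rw [← smul_add]; congr 1; abel
  have hx : Tendsto xk atTop (𝓝 x) := by
    have := (ht.smul hcx).add_const x
    rw [zero_smul, zero_add] at this
    refine this.congr fun k => ?_
    rw [smul_smul, mul_comm, hct, one_smul, sub_add_cancel]
  refine ⟨xk, hx, hcx, ?_⟩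
  filter_upwards [hev] with k h1
  have e1 : Φ (xk k) - Φ (yk k) - e k = Φ (xk k) - Φ x - t k • A u := by
    simp only [e]; abel
  rw [e1] at h1
  exact h1.2

lemma first_order (hphi : ContDiffAt ℝ 2 φ₀ xb) (hPhi : ContDiffAt ℝ 2 Φ xb)
    (hvb : vb ∈ LamCom φ₀ Φ θ xb) (hΛ : LamCom φ₀ Φ θ xb = {vb}) :
    ∀ᶠ q : Ev n × (Ev n × Ev m) in 𝓝 (xb, 0), Φ q.1 + q.2.2 ∈ θ.dom →
      (∀ᶠ x' in 𝓝 q.1, Φ x' + q.2.2 ∈ θ.dom →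
        φ₀ q.1 - ⟪q.2.1, q.1⟫ + θ.val (Φ q.1 + q.2.2) ≤
          φ₀ x' - ⟪q.2.1, x'⟫ + θ.val (Φ x' + q.2.2)) →
      ∃ v ∈ θ.subdiff (Φ q.1 + q.2.2), gradient φ₀ q.1 + adjD Φ q.1 v = q.2.1 := by
  obtain ⟨κ, hκ, -, ρ, hρ, hreg⟩ := mreg hPhi hvb hΛ
  have hfst : Tendsto (fun q : Ev n × (Ev n × Ev m) => q.1) (𝓝 (xb, 0)) (𝓝 xb) :=
    continuous_fst.tendsto _
  have hz : Tendsto (fun q : Ev n × (Ev n × Ev m) => Φ q.1 + q.2.2) (𝓝 (xb, 0)) (𝓝 (Φ xb)) := by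
    have h2 : Tendsto (fun q : Ev n × (Ev n × Ev m) => q.2.2) (𝓝 (xb, 0)) (𝓝 0) :=
      (continuous_snd.comp continuous_snd).tendsto _
    have := (hPhi.continuousAt.tendsto.comp hfst).add h2
    rwa [add_zero] at this
  filter_upwards [hz.eventually (θ.ev_Kact (Φ xb)), hz.eventually (θ.ev_Iact (Φ xb) hvb.2.1),
    hfst.eventually (ev_diff hphi hPhi), hfst.eventually (Metric.ball_mem_nhds xb hρ)]
    with q hK hI hdf hball hdom hmin
  obtain ⟨x, p1, p2⟩ := q
  dsimp only at *
  have hball : ‖x - xb‖ < ρ := by simpa [dist_eq_norm] using hball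
  obtain ⟨v, hv, hvu⟩ := θ.exists_mult hdom (fderiv ℝ Φ x : Ev n →ₗ[ℝ] Ev m)
    (innerₗ (Ev n) (gradient φ₀ x - p1)) (by
      intro u s h1 h2
      simp only [ContinuousLinearMap.coe_coe, innerₗ_apply_apply] at h1 h2 ⊢
      obtain ⟨xk, hx, hcx, hev⟩ := curve hρ hreg hball hdf.2 u
      have hΦ := deriv_seq hdf.2.hasFDerivAt hx hcx
      have hφ := deriv_seq hdf.1.hasFDerivAt hx hcx
      have hzk : Tendsto (fun k => Φ (xk k) + p2) atTop (𝓝 (Φ x + p2)) :=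
        (hdf.2.continuousAt.tendsto.comp hx).add_const p2
      have hlim : Tendsto (fun k : ℕ => ((k : ℝ) + 1) • (φ₀ (xk k) - φ₀ x) -
          ⟪p1, ((k : ℝ) + 1) • (xk k - x)⟫ + s +
          ⟪vb, ((k : ℝ) + 1) • (Φ (xk k) - Φ x) - fderiv ℝ Φ x u⟫) atTop
          (𝓝 (fderiv ℝ φ₀ x u - ⟪p1, u⟫ + s + ⟪vb, fderiv ℝ Φ x u - fderiv ℝ Φ x u⟫)) :=
        ((hφ.sub (tendsto_const_nhds.inner hcx)).add_const s).add
          (tendsto_const_nhds.inner (hΦ.sub_const _))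
      rw [sub_self, inner_zero_right, add_zero] at hlim
      rw [inner_sub_left, gradient_inner]
      refine ge_of_tendsto hlim ?_
      filter_upwards [hev, hx.eventually hmin, hzk.eventually (θ.ev_dom _ hdom),
        hzk.eventually (θ.ev_val _)] with k g1 g2 g3 g4
      have hc : (0:ℝ) < (k : ℝ) + 1 := by positivity
      set κk := Φ (xk k) - Φ x - ((k : ℝ) + 1)⁻¹ • fderiv ℝ Φ x u with hκk
      have e1 : Φ (xk k) + p2 - (Φ x + p2) = ((k : ℝ) + 1)⁻¹ • fderiv ℝ Φ x u + κk := by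
        rw [hκk]; abel
      have e2 : ((k : ℝ) + 1) • (Φ (xk k) - Φ x) - fderiv ℝ Φ x u = ((k : ℝ) + 1) • κk := by
        rw [hκk, smul_sub _ (Φ (xk k) - Φ x), smul_smul, mul_inv_cancel₀ hc.ne', one_smul]
      rw [e1] at g3 g4
      have g5 := g3 (fun i hi => by
        rw [inner_add_right, inner_smul_right]
        have a1 := mul_nonpos_of_nonneg_of_nonpos (inv_pos.2 hc).le (h1 i hi)
        have a2 := g1.1 i (hI hi)
        linarith)
      have g6 := g4 (((k : ℝ) + 1)⁻¹ * s + ⟪vb, κk⟫) (fun i hi => by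
        rw [inner_add_right, inner_smul_right]
        have a1 := mul_le_mul_of_nonneg_left (h2 i hi) (inv_pos.2 hc).le
        have a2 := g1.2 i (hK hi)
        linarith)
      have g7 := g2 g5
      have g8 : 0 ≤ φ₀ (xk k) - φ₀ x - ⟪p1, xk k - x⟫ + (((k : ℝ) + 1)⁻¹ * s + ⟪vb, κk⟫) := by
        rw [inner_sub_right]; linarith
      have g9 := mul_nonneg hc.le g8
      rw [e2, inner_smul_right, inner_smul_right, smul_eq_mul]
      have e3 : ((k : ℝ) + 1) * (((k : ℝ) + 1)⁻¹ * s) = s := by field_simp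
      linarith)
  refine ⟨v, hv, ?_⟩
  refine ext_inner_right ℝ fun u => ?_
  have := hvu u
  simp only [ContinuousLinearMap.coe_coe, innerₗ_apply_apply, inner_sub_left] at this
  rw [inner_add_left, adjD_inner]
  linarith

lemma close_mult (hphi : ContDiffAt ℝ 2 φ₀ xb) (hPhi : ContDiffAt ℝ 2 Φ xb)
    (hvb : vb ∈ LamCom φ₀ Φ θ xb) (hΛ : LamCom φ₀ Φ θ xb = {vb}) {ε : ℝ} (hε : 0 < ε) :
    ∀ᶠ q : Ev n × (Ev n × Ev m) in 𝓝 (xb, 0), ∀ v ∈ θ.subdiff (Φ q.1 + q.2.2),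
      gradient φ₀ q.1 + adjD Φ q.1 v = q.2.1 → ‖v - vb‖ < ε := by
  obtain ⟨κ, hκ, ⟨u, hu, hun⟩, -⟩ := mreg hPhi hvb hΛ
  have hfst : Tendsto (fun q : Ev n × (Ev n × Ev m) => q.1) (𝓝 (xb, 0)) (𝓝 xb) :=
    continuous_fst.tendsto _
  have hz : Tendsto (fun q : Ev n × (Ev n × Ev m) => Φ q.1 + q.2.2) (𝓝 (xb, 0)) (𝓝 (Φ xb)) := by
    have h2 : Tendsto (fun q : Ev n × (Ev n × Ev m) => q.2.2) (𝓝 (xb, 0)) (𝓝 0) :=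
      (continuous_snd.comp continuous_snd).tendsto _
    have := (hPhi.continuousAt.tendsto.comp hfst).add h2
    rwa [add_zero] at this
  have hp1 : Tendsto (fun q : Ev n × (Ev n × Ev m) => q.2.1) (𝓝 (xb, 0)) (𝓝 0) :=
    (continuous_fst.comp continuous_snd).tendsto _
  have hG : Tendsto (fun q : Ev n × (Ev n × Ev m) =>
      2 * κ * (‖q.2.1‖ + ‖gradient φ₀ q.1 + adjD Φ q.1 vb‖)) (𝓝 (xb, 0)) (𝓝 0) := by
    have h1 := (gradPsi_deriv hphi hPhi vb).continuousAt.tendsto.comp hfst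
    have h2 := (hp1.norm.add h1.norm).const_mul (2 * κ)
    rw [hvb.1, norm_zero, add_zero, mul_zero] at h2
    exact h2
  have hAd : Tendsto (fun q : Ev n × (Ev n × Ev m) => κ * ‖adjD Φ xb - adjD Φ q.1‖)
      (𝓝 (xb, 0)) (𝓝 0) := by
    have := (((adjD_cont hPhi).tendsto.comp hfst).const_sub (adjD Φ xb)).norm.const_mul κ
    rw [sub_self, norm_zero, mul_zero] at this
    exact this
  filter_upwards [hz.eventually (θ.ev_polar vb hvb.2.1), hG.eventually_lt_const hε,
    hAd.eventually_lt_const (half_pos one_pos)] with q h1 h2 h3 v hv hkkt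
  set η := v - vb with hη
  have hpol : ⟪η, fderiv ℝ Φ xb (u (-η)) - -η⟫ ≤ 0 := by
    rw [hη, inner_sub_left]
    have := h1 v hv _ (hu (-(v - vb)))
    linarith
  have hun' := hun (-η)
  rw [norm_neg] at hun'
  rw [sub_neg_eq_add, inner_add_right, ← adjD_inner, real_inner_self_eq_norm_sq] at hpol
  have hcs : -⟪adjD Φ xb η, u (-η)⟫ ≤ ‖adjD Φ xb η‖ * ‖u (-η)‖ :=
    (neg_le_abs _).trans (abs_real_inner_le_norm _ _)
  have hle : ‖η‖ ≤ κ * ‖adjD Φ xb η‖ := by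
    rcases (norm_nonneg η).eq_or_lt with h0 | h0
    · rw [← h0]; positivity
    · have := mul_le_mul_of_nonneg_left hun' (norm_nonneg (adjD Φ xb η))
      have h5 : ‖η‖ * ‖η‖ ≤ κ * ‖adjD Φ xb η‖ * ‖η‖ := by nlinarith
      exact le_of_mul_le_mul_right h5 h0
  have hdec : adjD Φ xb η = q.2.1 - (gradient φ₀ q.1 + adjD Φ q.1 vb) +
      (adjD Φ xb - adjD Φ q.1) η := by
    rw [ContinuousLinearMap.sub_apply, ← hkkt, hη, map_sub, map_sub]; abel
  have hnorm : ‖adjD Φ xb η‖ ≤ ‖q.2.1‖ + ‖gradient φ₀ q.1 + adjD Φ q.1 vb‖ +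
      ‖adjD Φ xb - adjD Φ q.1‖ * ‖η‖ := by
    conv_lhs => rw [hdec]
    refine (norm_add_le _ _).trans (add_le_add (norm_sub_le _ _) ?_)
    exact ContinuousLinearMap.le_opNorm _ _
  have h6 := mul_le_mul_of_nonneg_left hnorm hκ.le
  have h7 := mul_le_mul_of_nonneg_right h3.le (norm_nonneg η)
  nlinarith

lemma exists_min (hphi : ContDiffAt ℝ 2 φ₀ xb) (hPhi : ContDiffAt ℝ 2 Φ xb)
    (hvb : vb ∈ LamCom φ₀ Φ θ xb) (hΛ : LamCom φ₀ Φ θ xb = {vb})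
    (hstrict : ∀ᶠ x in 𝓝 xb, x ≠ xb → Φ x ∈ θ.dom →
      φ₀ xb + θ.val (Φ xb) < φ₀ x + θ.val (Φ x)) {r : ℝ} (hr : 0 < r) :
    ∀ᶠ p : Ev n × Ev m in 𝓝 0, ∃ x, ‖x - xb‖ < r ∧ Φ x + p.2 ∈ θ.dom ∧
      (∀ᶠ x' in 𝓝 x, Φ x' + p.2 ∈ θ.dom →
        φ₀ x - ⟪p.1, x⟫ + θ.val (Φ x + p.2) ≤ φ₀ x' - ⟪p.1, x'⟫ + θ.val (Φ x' + p.2)) := by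
  obtain ⟨κ, hκ, -, ρ, hρ, hreg⟩ := mreg hPhi hvb hΛ
  obtain ⟨δ, hδ, hball⟩ := Metric.eventually_nhds_iff_ball.1 ((ev_diff hphi hPhi).and hstrict)
  set r0 := min r (δ / 2) with hr0
  have hr0p : 0 < r0 := lt_min hr (half_pos hδ)
  have hr0r : r0 ≤ r := min_le_left _ _
  have hr0δ : r0 < δ := (min_le_right _ _).trans_lt (half_lt_self hδ)
  have hsub : Metric.closedBall xb r0 ⊆ Metric.ball xb δ := Metric.closedBall_subset_ball hr0δ
  have hφc : ContinuousOn φ₀ (Metric.closedBall xb r0) := fun x hx =>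
    (hball x (hsub hx)).1.1.continuousAt.continuousWithinAt
  have hΦc : ContinuousOn Φ (Metric.closedBall xb r0) := fun x hx =>
    (hball x (hsub hx)).1.2.continuousAt.continuousWithinAt
  -- feasibility
  have hp2 : Tendsto (fun p : Ev n × Ev m => p.2) (𝓝 0) (𝓝 0) := continuous_snd.tendsto _
  have hfeas : ∃ X : Ev n × Ev m → Ev n, Tendsto X (𝓝 0) (𝓝 xb) ∧
      ∀ᶠ p in 𝓝 (0 : Ev n × Ev m), Φ (X p) + p.2 ∈ θ.dom := by
    have hex : ∀ p : Ev n × Ev m, ∃ x', ‖p.2‖ < ρ → ‖x' - xb‖ ≤ 2 * κ * ‖p.2‖ ∧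
        Φ x' - Φ xb - -p.2 ∈ θ.Kc (Φ xb) vb := by
      intro p
      by_cases h : ‖p.2‖ < ρ
      · obtain ⟨x', hx'⟩ := hreg xb (by simpa using hρ) (-p.2) (by simpa using h)
        rw [norm_neg] at hx'
        exact ⟨x', fun _ => hx'⟩
      · exact ⟨0, fun h' => absurd h' h⟩
    choose X hX using hex
    have hn : ∀ᶠ p : Ev n × Ev m in 𝓝 0, ‖p.2‖ < ρ := by
      have := hp2.norm
      rw [norm_zero] at this
      exact this.eventually_lt_const hρ
    have hXt : Tendsto X (𝓝 0) (𝓝 xb) := by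
      rw [tendsto_iff_norm_sub_tendsto_zero]
      have h1 : Tendsto (fun p : Ev n × Ev m => 2 * κ * ‖p.2‖) (𝓝 0) (𝓝 0) := by
        have := hp2.norm.const_mul (2 * κ)
        rwa [norm_zero, mul_zero] at this
      refine squeeze_zero' (Eventually.of_forall fun _ => norm_nonneg _) ?_ h1
      filter_upwards [hn] with p hp
      exact (hX p hp).1
    refine ⟨X, hXt, ?_⟩
    have hz : Tendsto (fun p => Φ (X p) + p.2) (𝓝 0) (𝓝 (Φ xb)) := by
      have := (hPhi.continuousAt.tendsto.comp hXt).add hp2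
      rwa [add_zero] at this
    filter_upwards [hn, hz.eventually (θ.ev_Kc hvb.2)] with p h1 h2
    refine (h2 ?_).1
    have := (hX p h1).2
    have e : Φ (X p) - Φ xb - -p.2 = Φ (X p) + p.2 - Φ xb := by abel
    rwa [e] at this
  obtain ⟨X, hXt, hXd⟩ := hfeas
  have hXb : ∀ᶠ p in 𝓝 (0 : Ev n × Ev m), X p ∈ Metric.closedBall xb r0 :=
    hXt.eventually (Metric.closedBall_mem_nhds xb hr0p)
  by_contra hcon
  rw [Filter.not_eventually] at hcon
  obtain ⟨p, hp, hpk⟩ := Filter.exists_seq_forall_of_frequently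
    (hcon.and_eventually (hXb.and hXd))
  have hmin : ∀ k, ∃ x ∈ Metric.closedBall xb r0, Φ x + (p k).2 ∈ θ.dom ∧
      ∀ x' ∈ Metric.closedBall xb r0, Φ x' + (p k).2 ∈ θ.dom →
        φ₀ x - ⟪(p k).1, x⟫ + θ.val (Φ x + (p k).2) ≤
          φ₀ x' - ⟪(p k).1, x'⟫ + θ.val (Φ x' + (p k).2) := by
    intro k
    have hc1 : ContinuousOn (fun x => Φ x + (p k).2) (Metric.closedBall xb r0) :=
      hΦc.add continuousOn_const
    have hcomp : IsCompact (Metric.closedBall xb r0 ∩ (fun x => Φ x + (p k).2) ⁻¹' θ.dom) :=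
      (isCompact_closedBall xb r0).of_isClosed_subset
        (hc1.preimage_isClosed_of_isClosed Metric.isClosed_closedBall θ.dom_closed)
        inter_subset_left
    have hcont : ContinuousOn (fun x => φ₀ x - ⟪(p k).1, x⟫ + θ.val (Φ x + (p k).2))
        (Metric.closedBall xb r0 ∩ (fun x => Φ x + (p k).2) ⁻¹' θ.dom) := by
      refine ContinuousOn.mono ?_ inter_subset_left
      refine (hφc.sub ?_).add (θ.val_cont.comp_continuousOn hc1)
      exact (Continuous.inner continuous_const continuous_id).continuousOn
    obtain ⟨x, hx, hxm⟩ := hcomp.exists_isMinOn ⟨X (p k), (hpk k).2⟩ hcont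
    exact ⟨x, hx.1, hx.2, fun x' h1 h2 => hxm ⟨h1, h2⟩⟩
  choose x hxb hxd hxm using hmin
  have hxr : ∀ k, x k ∈ Metric.sphere xb r0 := by
    intro k
    have h1 : dist (x k) xb ≤ r0 := hxb k
    rcases h1.eq_or_lt with h | h
    · exact h
    · exfalso
      refine (hpk k).1 ⟨x k, ?_, hxd k, ?_⟩
      · rw [← dist_eq_norm]; exact h.trans_le hr0r
      · filter_upwards [Metric.isOpen_ball.mem_nhds (show x k ∈ Metric.ball xb r0 from h)]
          with x' hx' hd
        exact hxm k x' (Metric.ball_subset_closedBall hx') hd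
  obtain ⟨xt, hxt, s, hs, hlim⟩ := (isCompact_sphere xb r0).tendsto_subseq hxr
  have hxtb : xt ∈ Metric.closedBall xb r0 := Metric.sphere_subset_closedBall hxt
  have hne : xt ≠ xb := by
    rintro rfl
    rw [mem_sphere_iff_norm, sub_self, norm_zero] at hxt
    exact hr0p.ne hxt
  obtain ⟨⟨d1, d2⟩, hst⟩ := hball xt (hsub hxtb)
  have hps : Tendsto (fun k => p (s k)) atTop (𝓝 0) := hp.comp hs.tendsto_atTop
  have hps1 : Tendsto (fun k => (p (s k)).1) atTop (𝓝 0) := (continuous_fst.tendsto _).comp hps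
  have hps2 : Tendsto (fun k => (p (s k)).2) atTop (𝓝 0) := (continuous_snd.tendsto _).comp hps
  have hgen : ∀ (y : ℕ → Ev n) (y0 : Ev n), DifferentiableAt ℝ φ₀ y0 → DifferentiableAt ℝ Φ y0 →
      Tendsto y atTop (𝓝 y0) → Tendsto (fun k => Φ (y k) + (p (s k)).2) atTop (𝓝 (Φ y0)) ∧
      Tendsto (fun k => φ₀ (y k) - ⟪(p (s k)).1, y k⟫ + θ.val (Φ (y k) + (p (s k)).2)) atTop
        (𝓝 (φ₀ y0 + θ.val (Φ y0))) := by
    intro y y0 g1 g2 hy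
    have a1 : Tendsto (fun k => Φ (y k) + (p (s k)).2) atTop (𝓝 (Φ y0)) := by
      have := (g2.continuousAt.tendsto.comp hy).add hps2
      rwa [add_zero] at this
    refine ⟨a1, ?_⟩
    have a2 := (((g1.continuousAt.tendsto.comp hy).sub (hps1.inner hy)).add
      ((θ.val_cont.tendsto _).comp a1))
    rw [inner_zero_left, sub_zero] at a2
    exact a2
  have hxs := hgen _ xt d1 d2 hlim
  have hXs := hgen (fun k => X (p (s k))) xb (ev_diff hphi hPhi).self_of_nhds.1
    (ev_diff hphi hPhi).self_of_nhds.2 (hXt.comp hps)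
  have hxtd : Φ xt ∈ θ.dom :=
    θ.dom_closed.mem_of_tendsto hxs.1 (Eventually.of_forall fun k => hxd (s k))
  have hle := le_of_tendsto_of_tendsto hxs.2 hXs.2
    (Eventually.of_forall fun k => hxm (s k) _ (hpk (s k)).2.1 (hpk (s k)).2.2)
  exact absurd hle (not_le.2 (hst hne hxtd))

lemma suff_robust (hphi : ContDiffAt ℝ 2 φ₀ xb) (hPhi : ContDiffAt ℝ 2 Φ xb)
    (hvb : vb ∈ LamCom φ₀ Φ θ xb) (hΛ : LamCom φ₀ Φ θ xb = {vb})
    (hstrict : ∀ᶠ x in 𝓝 xb, x ≠ xb → Φ x ∈ θ.dom →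
      φ₀ xb + θ.val (Φ xb) < φ₀ x + θ.val (Φ x)) {V : Set (Ev n × Ev m)} (hV : V ∈ 𝓝 (xb, vb)) :
    ∀ᶠ p : Ev n × Ev m in 𝓝 0, (SKKT φ₀ Φ θ p.1 p.2 ∩ V).Nonempty := by
  obtain ⟨ε, hε, hεV⟩ := Metric.mem_nhds_iff.1 hV
  obtain ⟨r, hr, hball⟩ := Metric.eventually_nhds_iff_ball.1
    ((first_order hphi hPhi hvb hΛ).and (close_mult hphi hPhi hvb hΛ hε))
  filter_upwards [exists_min hphi hPhi hvb hΛ hstrict (lt_min hr hε), Metric.ball_mem_nhds 0 hr]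
    with p h1 h2
  obtain ⟨x, hx, hxd, hxm⟩ := h1
  have hq : (x, p) ∈ Metric.ball (xb, (0 : Ev n × Ev m)) r := by
    rw [Metric.mem_ball, Prod.dist_eq, max_lt_iff]
    refine ⟨?_, h2⟩
    rw [dist_eq_norm]; exact hx.trans_le (min_le_left _ _)
  obtain ⟨f1, f2⟩ := hball _ hq
  obtain ⟨v, hv, hk⟩ := f1 hxd hxm
  refine ⟨(x, v), ⟨hk, hv⟩, hεV ?_⟩
  rw [Metric.mem_ball, Prod.dist_eq, max_lt_iff, dist_eq_norm, dist_eq_norm]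
  exact ⟨hx.trans_le (min_le_right _ _), f2 v hv hk⟩

end Rob

theorem stmt16_proof {n m : ℕ} (θ : CPWL m) (φ₀ : Ev n → ℝ) (Φ : Ev n → Ev m)
    (xb : Ev n) (vb : Ev m)
    (hphi : ContDiffAt ℝ 2 φ₀ xb) (hPhi : ContDiffAt ℝ 2 Φ xb)
    (hdom : Φ xb ∈ θ.dom)
    (hvb : vb ∈ LamCom φ₀ Φ θ xb) :
    ((RobustIsolCalm (fun p => SKKT φ₀ Φ θ p.1 p.2) (xb, vb) ∧ LocalMin φ₀ Φ θ xb) ↔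
      ((∀ u : Ev n, u ≠ 0 → fderiv ℝ Φ xb u ∈ θ.crit (Φ xb) vb →
          0 < ⟪HessOp φ₀ Φ vb xb u, u⟫) ∧ LamCom φ₀ Φ θ xb = {vb})) ∧
    (((∀ u : Ev n, u ≠ 0 → fderiv ℝ Φ xb u ∈ θ.crit (Φ xb) vb →
          0 < ⟪HessOp φ₀ Φ vb xb u, u⟫) ∧ LamCom φ₀ Φ θ xb = {vb}) ↔
      (LamCom φ₀ Φ θ xb = {vb} ∧ LocalMin φ₀ Φ θ xb ∧ ¬ IsCriticalCom φ₀ Φ θ xb vb)) ∧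
    ((LamCom φ₀ Φ θ xb = {vb} ∧ LocalMin φ₀ Φ θ xb ∧ ¬ IsCriticalCom φ₀ Φ θ xb vb) ↔
      (IsolCalm (fun p => SKKT φ₀ Φ θ p.1 p.2) (xb, vb) ∧ LocalMin φ₀ Φ θ xb)) := by
  rw [θ.crit_eq hvb.2]
  have h14 : RobustIsolCalm (fun p => SKKT φ₀ Φ θ p.1 p.2) (xb, vb) →
      IsolCalm (fun p => SKKT φ₀ Φ θ p.1 p.2) (xb, vb) := by
    rintro ⟨c, hc, U, hU, V, hV, h, -⟩
    exact ⟨c, hc, U, hU, V, hV, h⟩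
  have h43 : IsolCalm (fun p => SKKT φ₀ Φ θ p.1 p.2) (xb, vb) →
      LamCom φ₀ Φ θ xb = {vb} ∧ ¬ IsCriticalCom φ₀ Φ θ xb vb := fun h =>
    ⟨isol_unique hvb h, isol_noncrit hphi hPhi hvb h⟩
  have h32 : LamCom φ₀ Φ θ xb = {vb} → LocalMin φ₀ Φ θ xb → ¬ IsCriticalCom φ₀ Φ θ xb vb →
      (∀ u : Ev n, u ≠ 0 → fderiv ℝ Φ xb u ∈ θ.Kc (Φ xb) vb →
          0 < ⟪HessOp φ₀ Φ vb xb u, u⟫) := fun h1 h2 h3 =>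
    second_suff hphi hPhi hvb h1 h2 h3
  have h21 : (∀ u : Ev n, u ≠ 0 → fderiv ℝ Φ xb u ∈ θ.Kc (Φ xb) vb →
          0 < ⟪HessOp φ₀ Φ vb xb u, u⟫) → LamCom φ₀ Φ θ xb = {vb} →
      RobustIsolCalm (fun p => SKKT φ₀ Φ θ p.1 p.2) (xb, vb) ∧ LocalMin φ₀ Φ θ xb := by
    intro hpos hΛ
    have hs := suff_strict hphi hPhi hvb hpos
    refine ⟨?_, (localMin_iff hdom).2 ?_⟩
    · obtain ⟨c, hc, U, hU, V, hV, h⟩ := suff_isol hphi hPhi hvb hΛ hpos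
      have hR := suff_robust hphi hPhi hvb hΛ hs hV
      exact ⟨c, hc, U ∩ _, inter_mem hU hR, V, hV, fun p hp => h p hp.1, fun p hp => hp.2⟩
    · filter_upwards [hs] with x hx hd
      by_cases he : x = xb
      · rw [he]
      · exact (hx he hd).le
  refine ⟨⟨fun h => ?_, fun h => h21 h.1 h.2⟩, ⟨fun h => ?_, fun h => ⟨h32 h.1 h.2.1 h.2.2, h.1⟩⟩,
    ⟨fun h => ?_, fun h => ⟨(h43 h.1).1, h.2, (h43 h.1).2⟩⟩⟩
  · obtain ⟨a, b⟩ := h43 (h14 h.1)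
    exact ⟨h32 a h.2 b, a⟩
  · obtain ⟨a, b⟩ := h21 h.1 h.2
    exact ⟨h.2, b, (h43 (h14 a)).2⟩
  · obtain ⟨a, b⟩ := h21 (h32 h.1 h.2.1 h.2.2) h.1
    exact ⟨h14 a, b⟩

/-- characterization of robust isolated calmness of the KKT solution map in
composite optimization. -/
theorem stmt16 {n m : ℕ} (θ : CPWL m) (φ₀ : Ev n → ℝ) (Φ : Ev n → Ev m)
    (xb : Ev n) (vb : Ev m)
    (hphi : ContDiffAt ℝ 2 φ₀ xb) (hPhi : ContDiffAt ℝ 2 Φ xb)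
    (hdom : Φ xb ∈ θ.dom)
    (hvb : vb ∈ LamCom φ₀ Φ θ xb) :
    ((RobustIsolCalm (fun p => SKKT φ₀ Φ θ p.1 p.2) (xb, vb) ∧ LocalMin φ₀ Φ θ xb) ↔
      ((∀ u : Ev n, u ≠ 0 → fderiv ℝ Φ xb u ∈ θ.crit (Φ xb) vb →
          0 < ⟪HessOp φ₀ Φ vb xb u, u⟫) ∧ LamCom φ₀ Φ θ xb = {vb})) ∧
    (((∀ u : Ev n, u ≠ 0 → fderiv ℝ Φ xb u ∈ θ.crit (Φ xb) vb →
          0 < ⟪HessOp φ₀ Φ vb xb u, u⟫) ∧ LamCom φ₀ Φ θ xb = {vb}) ↔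
      (LamCom φ₀ Φ θ xb = {vb} ∧ LocalMin φ₀ Φ θ xb ∧ ¬ IsCriticalCom φ₀ Φ θ xb vb)) ∧
    ((LamCom φ₀ Φ θ xb = {vb} ∧ LocalMin φ₀ Φ θ xb ∧ ¬ IsCriticalCom φ₀ Φ θ xb vb) ↔
      (IsolCalm (fun p => SKKT φ₀ Φ θ p.1 p.2) (xb, vb) ∧ LocalMin φ₀ Φ θ xb)) := by
  exact stmt16_proof θ φ₀ Φ xb vb hphi hPhi hdom hvb
end
end
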